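/- Let Ω be a connected open set in ℝ² and let 1 < p < ∞. Let σ : Ω → ℝ be Lipschitz continuous with σ ≥ c₀ > 0, and let A : Ω → (2×2 real matrices) be Lipschitz continuous with A(x) symmetric and c₀|ξ|² ≤ A(x)ξ·ξ for all x ∈ Ω, ξ ∈ ℝ². If u ∈ C¹(Ω) satisfies ∫_Ω σ(x)·|A(x)∇u(x)·∇u(x)|^{(p−2)/2}·(A(x)∇u(x)·∇φ(x)) dx = 0 for every C¹ function φ with compact support in Ω, and u is constant on some nonempty open subset of Ω, then u is constant on all of Ω. -/

import Mathlib

open MeasureTheory Real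
open scoped RealInnerProductSpace

/-- The linear action of an `n × n` real matrix on Euclidean space, as a
continuous linear map. -/
noncomputable def matCLM {n : ℕ} (M : Matrix (Fin n) (Fin n) ℝ) :
    EuclideanSpace ℝ (Fin n) →L[ℝ] EuclideanSpace ℝ (Fin n) :=
  LinearMap.toContinuousLinearMap (Matrix.toEuclideanLin M)

namespace PlanarUCP

/-- The Euclidean plane. -/
abbrev Plane : Type := EuclideanSpace ℝ (Fin 2)

/-- The `i`-th partial derivative of a function on the plane. -/
noncomputable def pd (i : Fin 2) (f : Plane → ℝ) (x : Plane) : ℝ :=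
  fderiv ℝ f x (EuclideanSpace.single i 1)

section PartialDerivatives

variable {f g : Plane → ℝ} {x : Plane} {i : Fin 2}

lemma pd_add (hf : DifferentiableAt ℝ f x) (hg : DifferentiableAt ℝ g x) :
    pd i (fun y => f y + g y) x = pd i f x + pd i g x := by
  simp [pd, fderiv_fun_add hf hg]

lemma pd_mul (hf : DifferentiableAt ℝ f x) (hg : DifferentiableAt ℝ g x) :
    pd i (fun y => f y * g y) x = f x * pd i g x + g x * pd i f x := by
  simp [pd, fderiv_fun_mul hf hg]

lemma pd_sq (hf : DifferentiableAt ℝ f x) :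
    pd i (fun y => f y ^ 2) x = 2 * f x * pd i f x := by
  simp only [pow_two]
  rw [pd_mul hf hf]; ring

lemma pd_comp {k : ℝ → ℝ} {k' : ℝ} (hk : HasDerivAt k k' (f x)) (hf : DifferentiableAt ℝ f x) :
    pd i (fun y => k (f y)) x = k' * pd i f x := by
  have := hk.comp_hasFDerivAt x hf.hasFDerivAt
  simp only [pd]
  rw [show (fun y => k (f y)) = k ∘ f from rfl, this.fderiv]
  simp

lemma pd_comp_add (z : Plane) : pd i (fun y => f (y + z)) x = pd i f (x + z) := by
  simp only [pd]
  rw [fderiv_comp_add_right]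

lemma pd_comp_sub (z : Plane) : pd i (fun y => f (y - z)) x = pd i f (x - z) := by
  simp only [sub_eq_add_neg, pd_comp_add]

lemma pd_comp_const_sub (hf : Differentiable ℝ f) (z : Plane) :
    pd i (fun y => f (z - y)) x = -pd i f (z - x) := by
  have h := (hf (z - x)).hasFDerivAt.comp x ((hasFDerivAt_id x).const_sub z)
  simp only [pd]
  rw [show (fun y => f (z - y)) = f ∘ HSub.hSub z from rfl, h.fderiv]
  simp

lemma pd_congr {U : Set Plane} (hU : IsOpen U) (h : ∀ y ∈ U, f y = g y) (hx : x ∈ U) :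
    pd i f x = pd i g x := by
  have : f =ᶠ[nhds x] g := Filter.eventuallyEq_of_mem (hU.mem_nhds hx) h
  simp [pd, this.fderiv_eq]

lemma _root_.ContDiff.continuous_pd (hf : ContDiff ℝ 1 f) : Continuous (pd i f) :=
  (hf.continuous_fderiv (by simp)).clm_apply continuous_const

lemma _root_.ContDiff.pd_one (hf : ContDiff ℝ 2 f) : ContDiff ℝ 1 (pd i f) :=
  (hf.fderiv_right (m := 1) (by norm_num)).clm_apply contDiff_const

lemma tsupport_pd_subset : tsupport (pd i f) ⊆ tsupport f :=
  tsupport_fderiv_apply_subset ℝ _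

lemma _root_.HasCompactSupport.pd (hf : HasCompactSupport f) : HasCompactSupport (pd i f) :=
  hf.of_isClosed_subset (isClosed_tsupport _) tsupport_pd_subset

lemma fderiv_apply_eq_pd (v : Plane) :
    fderiv ℝ f x v = v 0 * pd 0 f x + v 1 * pd 1 f x := by
  have hv : v = v 0 • EuclideanSpace.single (0 : Fin 2) (1 : ℝ)
      + v 1 • EuclideanSpace.single (1 : Fin 2) (1 : ℝ) := by
    ext j; fin_cases j <;> simp
  conv_lhs => rw [hv]
  rw [map_add, map_smul, map_smul]
  simp [pd]

lemma pd_symm (hf : ContDiff ℝ 2 f) : pd 0 (pd 1 f) x = pd 1 (pd 0 f) x := by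
  have hs : IsSymmSndFDerivAt ℝ f x :=
    hf.contDiffAt.isSymmSndFDerivAt (by simp)
  have hd : DifferentiableAt ℝ (fderiv ℝ f) x :=
    ((hf.fderiv_right (m := 1) (by norm_num)).differentiable (by simp)) x
  have key : ∀ i j : Fin 2, pd i (pd j f) x
      = fderiv ℝ (fderiv ℝ f) x (EuclideanSpace.single i 1) (EuclideanSpace.single j 1) := by
    intro i j
    have : pd j f = fun y => fderiv ℝ f y (EuclideanSpace.single j 1) := rfl
    rw [this]
    simp only [pd]
    rw [fderiv_clm_apply hd (differentiableAt_const _)]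
    simp
  rw [key, key]
  exact hs _ _

end PartialDerivatives

/-- The product of a function continuous on an open set and a continuous function supported in
that set is continuous. -/
lemma continuous_mul_of_tsupport_subset {O : Set Plane} {f g : Plane → ℝ} (hO : IsOpen O)
    (hf : ContinuousOn f O) (hg : Continuous g) (hs : tsupport g ⊆ O) :
    Continuous (fun x => f x * g x) := by
  rw [continuous_iff_continuousAt]
  intro x
  by_cases hx : x ∈ O
  · exact (hf.continuousAt (hO.mem_nhds hx)).mul hg.continuousAt
  · have h0 : (fun y => f y * g y) =ᶠ[nhds x] fun _ => 0 := by
      have : (tsupport g)ᶜ ∈ nhds x :=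
        (isClosed_tsupport g).isOpen_compl.mem_nhds fun h => hx (hs h)
      filter_upwards [this] with y hy
      rw [image_eq_zero_of_notMem_tsupport hy, mul_zero]
    exact continuousAt_const.congr h0.symm

lemma integrable_mul_of_tsupport_subset {O : Set Plane} {f g : Plane → ℝ} (hO : IsOpen O)
    (hf : ContinuousOn f O) (hg : Continuous g) (hs : tsupport g ⊆ O)
    (hc : HasCompactSupport g) : Integrable (fun x => f x * g x) :=
  (continuous_mul_of_tsupport_subset hO hf hg hs).integrable_of_hasCompactSupport hc.mul_left

lemma integral_mul_pd {f g : Plane → ℝ} (i : Fin 2) (hf : ContDiff ℝ 1 f) (hg : ContDiff ℝ 1 g)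
    (hc : HasCompactSupport f) : ∫ x, f x * pd i g x = -∫ x, pd i f x * g x := by
  have hg' := hg.continuous_pd (i := i)
  have hf' := hf.continuous_pd (i := i)
  refine integral_mul_fderiv_eq_neg_fderiv_mul_of_integrable ?_ ?_ ?_ ?_ ?_
  · exact (hf'.mul hg.continuous).integrable_of_hasCompactSupport hc.pd.mul_right
  · exact (hf.continuous.mul hg').integrable_of_hasCompactSupport hc.mul_right
  · exact (hf.continuous.mul hg.continuous).integrable_of_hasCompactSupport hc.mul_right
  · exact fun x _ => hf.differentiable (by simp) x
  · exact fun x _ => hg.differentiable (by simp) x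

/-- The integral of a partial derivative of a compactly supported function vanishes. -/
lemma integral_pd_eq_zero {f : Plane → ℝ} (i : Fin 2) (hf : ContDiff ℝ 1 f)
    (hc : HasCompactSupport f) : ∫ x, pd i f x = 0 := by
  have h := integral_mul_pd i hf (contDiff_const (c := (1 : ℝ))) hc
  have h1 : ∀ x, pd i (fun _ : Plane => (1 : ℝ)) x = 0 := fun x => by simp [pd]
  simp only [h1, mul_zero, mul_one, integral_zero] at h
  linarith

/-- The Jacobian determinant of a planar map. -/
noncomputable def jac (f g : Plane → ℝ) (x : Plane) : ℝ := pd 0 f x * pd 1 g x - pd 1 f x * pd 0 g x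

lemma integral_jac_eq_zero {f g : Plane → ℝ} (hf : ContDiff ℝ 1 f) (hg : ContDiff ℝ 2 g)
    (hc : HasCompactSupport f) : ∫ x, jac f g x = 0 := by
  have h0 := integral_mul_pd 0 hf (hg.pd_one (i := 1)) hc
  have h1 := integral_mul_pd 1 hf (hg.pd_one (i := 0)) hc
  have hsymm : ∀ x, f x * pd 0 (pd 1 g) x = f x * pd 1 (pd 0 g) x := fun x => by rw [pd_symm hg]
  simp only [hsymm] at h0
  have i0 : Integrable fun x => pd 0 f x * pd 1 g x :=
    (hf.continuous_pd.mul (hg.of_le (by norm_num)).continuous_pd).integrable_of_hasCompactSupport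
      hc.pd.mul_right
  have i1 : Integrable fun x => pd 1 f x * pd 0 g x :=
    (hf.continuous_pd.mul (hg.of_le (by norm_num)).continuous_pd).integrable_of_hasCompactSupport
      hc.pd.mul_right
  simp only [jac]
  rw [integral_sub i0 i1]
  linarith

/-- The convolution of a kernel `ρ` and a function `f` on the plane. -/
noncomputable def mol (ρ f : Plane → ℝ) (x : Plane) : ℝ := ∫ t, ρ t * f (x - t)

section Convolution

open scoped Convolution

variable {ρ f : Plane → ℝ}

lemma mol_eq_convolution : mol ρ f = (ρ ⋆[ContinuousLinearMap.lsmul ℝ ℝ, volume] f) := by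
  ext x; simp [mol, convolution_def]

lemma contDiff_mol {n : ℕ∞} (hc : HasCompactSupport ρ) (hρ : ContDiff ℝ n ρ) (hf : Continuous f) :
    ContDiff ℝ n (mol ρ f) := by
  rw [mol_eq_convolution]
  exact hc.contDiff_convolution_left _ hρ hf.locallyIntegrable

lemma integrable_mol (hc : HasCompactSupport ρ) (hρ : Continuous ρ) (hf : Continuous f)
    (x : Plane) : Integrable fun t => ρ t * f (x - t) :=
  (hρ.mul (hf.comp (by fun_prop : Continuous fun t => x - t))).integrable_of_hasCompactSupport
    hc.mul_right

lemma pd_mol_left (i : Fin 2) (hc : HasCompactSupport ρ) (hρ : ContDiff ℝ 1 ρ) (hf : Continuous f)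
    (x : Plane) : pd i (mol ρ f) x = mol (pd i ρ) f x := by
  have h := hc.hasFDerivAt_convolution_left (ContinuousLinearMap.lsmul ℝ ℝ) hρ
    (hf.locallyIntegrable (μ := volume)) x
  rw [← mol_eq_convolution] at h
  have hi : Integrable fun t => (ContinuousLinearMap.precompL Plane (ContinuousLinearMap.lsmul ℝ ℝ))
      (fderiv ℝ ρ t) (f (x - t)) :=
    ((hc.fderiv ℝ).convolutionExists_left _ (hρ.continuous_fderiv (by simp))
      hf.locallyIntegrable) x
  rw [pd, h.fderiv, convolution_def, ContinuousLinearMap.integral_apply hi]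
  simp [mol, pd, ContinuousLinearMap.precompL]

lemma pd_mol_right (i : Fin 2) (hρ : Continuous ρ) (hc : HasCompactSupport f)
    (hf : ContDiff ℝ 1 f) (x : Plane) : pd i (mol ρ f) x = mol ρ (pd i f) x := by
  have h := hc.hasFDerivAt_convolution_right (ContinuousLinearMap.lsmul ℝ ℝ)
    (hρ.locallyIntegrable (μ := volume)) hf x
  rw [← mol_eq_convolution] at h
  have hi : Integrable fun t => (ContinuousLinearMap.precompR Plane (ContinuousLinearMap.lsmul ℝ ℝ))
      (ρ t) (fderiv ℝ f (x - t)) :=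
    ((hc.fderiv ℝ).convolutionExists_right _ hρ.locallyIntegrable
      (hf.continuous_fderiv (by simp))) x
  rw [pd, h.fderiv, convolution_def, ContinuousLinearMap.integral_apply hi]
  simp [mol, pd, ContinuousLinearMap.precompR]

end Convolution

/-- A smooth nonnegative kernel of unit mass supported in the closed ball of radius `ε`, whose
partial derivatives have `L¹` norm at most `C / ε`. -/
structure IsMollifier (C ε : ℝ) (ρ : Plane → ℝ) : Prop where
  contDiff : ContDiff ℝ (⊤ : ℕ∞) ρ
  compact : HasCompactSupport ρ
  nonneg : ∀ x, 0 ≤ ρ x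
  integral_eq : ∫ x, ρ x = 1
  support : ∀ x, ε < ‖x‖ → ρ x = 0
  pd_bound : ∀ i, ∫ x, |pd i ρ x| ≤ C / ε

lemma exists_mollifier : ∃ C : ℝ, 0 ≤ C ∧ ∀ ε > 0, ∃ ρ, IsMollifier C ε ρ := by
  let b : ContDiffBump (0 : Plane) := ⟨1 / 2, 1, by norm_num, by norm_num⟩
  let k : Plane → ℝ := b.normed volume
  have hk : ContDiff ℝ (⊤ : ℕ∞) k := b.contDiff_normed
  have hkc : HasCompactSupport k := b.hasCompactSupport_normed
  refine ⟨(∫ x, |pd 0 k x|) + ∫ x, |pd 1 k x|, by positivity, fun ε hε => ?_⟩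
  have hε' : ε ≠ 0 := hε.ne'
  have hpd : ∀ i x, pd i (fun x => (ε ^ 2)⁻¹ * k (ε⁻¹ • x)) x = (ε ^ 3)⁻¹ * pd i k (ε⁻¹ • x) := by
    intro i x
    have h1 := ((hk.differentiable (by simp)) (ε⁻¹ • x)).hasFDerivAt.comp x
      ((hasFDerivAt_id x).const_smul ε⁻¹)
    have h2 := (h1.const_mul (ε ^ 2)⁻¹).fderiv
    have h3 : (fun x => (ε ^ 2)⁻¹ * k (ε⁻¹ • x))
        = fun y => (ε ^ 2)⁻¹ * (k ∘ HSMul.hSMul ε⁻¹) y := rfl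
    rw [h3, pd, h2]
    simp [pd]
    field_simp
  have hscale : ∀ g : Plane → ℝ, ∫ x, g (ε⁻¹ • x) = ε ^ 2 * ∫ x, g x := by
    intro g
    rw [Measure.integral_comp_smul]
    simp [abs_of_pos hε]
  refine ⟨fun x => (ε ^ 2)⁻¹ * k (ε⁻¹ • x), ?_, ?_, ?_, ?_, ?_, ?_⟩
  · exact contDiff_const.mul (hk.comp (contDiff_const_smul ε⁻¹))
  · exact (hkc.comp_smul (inv_ne_zero hε')).mul_left
  · intro x
    exact mul_nonneg (by positivity) (b.nonneg_normed _)
  · rw [integral_const_mul, hscale k, b.integral_normed]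
    field_simp
  · intro x hx
    have : ε⁻¹ • x ∉ Function.support k := by
      rw [b.support_normed_eq]
      simp only [Metric.mem_ball, dist_zero_right, norm_smul, norm_inv, Real.norm_eq_abs,
        abs_of_pos hε, not_lt]
      change 1 ≤ _
      rw [inv_mul_eq_div, le_div_iff₀ hε]
      linarith
    rw [Function.notMem_support.1 this, mul_zero]
  · intro i
    simp only [hpd, abs_mul]
    rw [integral_const_mul, hscale fun x => |pd i k x|, abs_of_pos (by positivity : 0 < (ε ^ 3)⁻¹)]
    have h0 : 0 ≤ ∫ x, |pd 0 k x| := integral_nonneg fun _ => abs_nonneg _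
    have h1 : 0 ≤ ∫ x, |pd 1 k x| := integral_nonneg fun _ => abs_nonneg _
    have : ∫ x, |pd i k x| ≤ (∫ x, |pd 0 k x|) + ∫ x, |pd 1 k x| := by
      fin_cases i <;> simp <;> linarith
    rw [le_div_iff₀ hε]
    calc (ε ^ 3)⁻¹ * (ε ^ 2 * ∫ x, |pd i k x|) * ε = ∫ x, |pd i k x| := by field_simp
      _ ≤ _ := this

/-- Convolution with a mollifier moves a function by at most its oscillation. -/
lemma abs_mol_sub_le {C ε : ℝ} {ρ f : Plane → ℝ} (hρ : IsMollifier C ε ρ) (hf : Continuous f)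
    {x : Plane} {κ : ℝ} (h : ∀ y, dist y x ≤ ε → |f y - f x| ≤ κ) : |mol ρ f x - f x| ≤ κ := by
  have hi := integrable_mol hρ.compact hρ.contDiff.continuous hf x
  have hρi := hρ.contDiff.continuous.integrable_of_hasCompactSupport (μ := volume) hρ.compact
  have h1 : mol ρ f x - f x = ∫ t, ρ t * (f (x - t) - f x) := by
    simp only [mul_sub]
    rw [integral_sub hi (hρi.mul_const _), integral_mul_const, hρ.integral_eq, one_mul, mol]
  rw [h1]
  have h2 : ∀ t, ‖ρ t * (f (x - t) - f x)‖ ≤ ρ t * κ := by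
    intro t
    rw [norm_mul, Real.norm_eq_abs, Real.norm_eq_abs, abs_of_nonneg (hρ.nonneg t)]
    by_cases ht : ε < ‖t‖
    · simp [hρ.support t ht]
    · exact mul_le_mul_of_nonneg_left (h _ (by simpa [dist_eq_norm] using ht)) (hρ.nonneg t)
  calc |∫ t, ρ t * (f (x - t) - f x)| ≤ ∫ t, ρ t * κ :=
        norm_integral_le_of_norm_le (hρi.mul_const κ) (.of_forall h2)
    _ = κ := by rw [integral_mul_const, hρ.integral_eq, one_mul]

lemma hasDerivAt_comp_max {k k' : ℝ → ℝ} {δ r : ℝ} (h : HasDerivAt k (k' (max r δ)) (max r δ))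
    (h0 : k' δ = 0) : HasDerivAt (fun s => k (max s δ)) (k' (max r δ)) r := by
  rcases lt_trichotomy r δ with hr | hr | hr
  · rw [max_eq_right hr.le, h0]
    refine (hasDerivAt_const r (k δ)).congr_of_eventuallyEq ?_
    filter_upwards [gt_mem_nhds hr] with s hs
    rw [max_eq_right hs.le]
  · subst hr
    rw [max_self] at h ⊢
    rw [h0] at h ⊢
    rw [hasDerivAt_iff_isLittleO] at h ⊢
    simp only [smul_zero, sub_zero, max_self] at h ⊢
    have ht : Filter.Tendsto (fun s => max s r) (nhds r) (nhds r) := by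
      have : Continuous fun s => max s r := by fun_prop
      simpa using this.tendsto r
    refine (h.comp_tendsto ht).trans_isBigO (Asymptotics.IsBigO.of_bound 1 (.of_forall fun s => ?_))
    simp only [Function.comp, Real.norm_eq_abs, one_mul]
    rcases le_total s r with h | h
    · simp [max_eq_right h]
    · simp [max_eq_left h]
  · rw [max_eq_left hr.le] at h ⊢
    refine h.congr_of_eventuallyEq ?_
    filter_upwards [lt_mem_nhds hr] with s hs
    rw [max_eq_left hs.le]

/-- Radial profiles `K` and `Ψ`, vanishing near the origin, for a logarithmic Caccioppoli estimate:
the function `Ψ` is controlled by `(r K)'` although it is as large as desired away from `0`. -/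
structure IsProfile (R₀ r₀ N δ : ℝ) (K K' Ψ Ψ' : ℝ → ℝ) : Prop where
  hasDerivAt_K : ∀ r ∈ Set.Icc 0 R₀, HasDerivAt K (K' r) r
  continuousOn_K' : ContinuousOn K' (Set.Icc 0 R₀)
  hasDerivAt_Ψ : ∀ r ∈ Set.Icc 0 R₀, HasDerivAt Ψ (Ψ' r) r
  continuousOn_Ψ' : ContinuousOn Ψ' (Set.Icc 0 R₀)
  K_eq_zero : ∀ r ≤ δ, K r = 0
  K'_eq_zero : ∀ r ≤ δ, K' r = 0
  Ψ_eq_zero : ∀ r ≤ δ, Ψ r = 0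
  le_Ψ : ∀ r ∈ Set.Icc r₀ R₀, N ≤ Ψ r
  mul_K_sq_le : ∀ r ∈ Set.Icc 0 R₀, r * K r ^ 2 ≤ K r + r * K' r
  mul_deriv_le : ∀ r ∈ Set.Icc 0 R₀, r * (K r + r * K' r) ≤ 1
  mul_Ψ'_sq_le : ∀ r ∈ Set.Icc 0 R₀, r * Ψ' r ^ 2 ≤ K r + r * K' r

lemma exists_profile {R₀ r₀ : ℝ} (N : ℝ) (hr₀ : 0 < r₀) (hR₀ : r₀ ≤ R₀) :
    ∃ δ > 0, ∃ K K' Ψ Ψ', IsProfile R₀ r₀ N δ K K' Ψ Ψ' := by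
  set Λ := 1 + log R₀ with hΛ
  set L₀ := Λ - log r₀ with hL₀
  have hlogr : log r₀ ≤ log R₀ := log_le_log hr₀ hR₀
  have hL₀1 : 1 ≤ L₀ := by linarith
  set δ := min r₀ (exp (Λ - L₀ * exp (N + 1))) with hδdef
  have hδ : 0 < δ := lt_min hr₀ (exp_pos _)
  have hδr : δ ≤ r₀ := min_le_left _ _
  set m := Λ - log δ with hm
  have hm1 : L₀ * exp (N + 1) ≤ m := by
    have : log δ ≤ Λ - L₀ * exp (N + 1) := by
      rw [← log_exp (Λ - L₀ * exp (N + 1))]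
      exact log_le_log hδ (min_le_right _ _)
    linarith
  have hlogδ : log δ ≤ log r₀ := log_le_log hδ hδr
  have hm0 : 1 ≤ m := by linarith
  have hmpos : 0 < m := by linarith
  let l : ℝ → ℝ := fun r => log r - log δ
  have hlδ : l δ = 0 := sub_self _
  have hl : ∀ r ∈ Set.Icc δ R₀, 0 ≤ l r ∧ 1 ≤ m - l r := by
    intro r hr
    have h1 := log_le_log hδ hr.1
    have h2 := log_le_log (hδ.trans_le hr.1) hr.2
    simp only [l]
    constructor <;> linarith
  let k : ℝ → ℝ := fun r => l r ^ 2 / (m ^ 2 * (m - l r)) / r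
  let q : ℝ → ℝ := fun r => l r * (2 * m - l r) / (m ^ 2 * (m - l r) ^ 2)
  let k' : ℝ → ℝ := fun r => (q r - l r ^ 2 / (m ^ 2 * (m - l r))) / r ^ 2
  let g : ℝ → ℝ := fun r => log m - log (m - l r) - l r / m
  let g' : ℝ → ℝ := fun r => l r / (m * (m - l r)) / r
  have hdl : ∀ r ∈ Set.Icc δ R₀, HasDerivAt l (1 / r) r := by
    intro r hr
    rw [one_div]
    exact (hasDerivAt_log (hδ.trans_le hr.1).ne').sub_const (log δ)
  have hdk : ∀ r ∈ Set.Icc δ R₀, HasDerivAt k (k' r) r := by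
    intro r hr
    have hr0 : r ≠ 0 := (hδ.trans_le hr.1).ne'
    have hL : m - l r ≠ 0 := by linarith [(hl r hr).2]
    have h1 := (((hdl r hr).pow 2).div (((hdl r hr).const_sub m).const_mul (m ^ 2))
      (by positivity)).div (hasDerivAt_id r) hr0
    refine h1.congr_deriv ?_
    simp only [k', q, id, Pi.pow_apply, Pi.div_apply]
    field_simp
    ring
  have hdg : ∀ r ∈ Set.Icc δ R₀, HasDerivAt g (g' r) r := by
    intro r hr
    have hr0 : r ≠ 0 := (hδ.trans_le hr.1).ne'
    have hL : m - l r ≠ 0 := by linarith [(hl r hr).2]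
    have h1 := ((((hdl r hr).const_sub m).log hL).const_sub (log m)).sub ((hdl r hr).div_const m)
    refine h1.congr_deriv ?_
    simp only [g']
    field_simp
    ring
  have hcl : ContinuousOn l (Set.Icc δ R₀) := fun r hr =>
    (hdl r hr).continuousAt.continuousWithinAt
  have hne : ∀ r ∈ Set.Icc δ R₀, m - l r ≠ 0 := fun r hr => by linarith [(hl r hr).2]
  have hck' : ContinuousOn k' (Set.Icc δ R₀) := by
    intro r hr
    have := hcl r hr
    have hr0 : r ≠ 0 := (hδ.trans_le hr.1).ne'
    have hL := hne r hr
    simp only [k', q]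
    refine ContinuousWithinAt.div (ContinuousWithinAt.sub (ContinuousWithinAt.div ?_ ?_ ?_)
      (ContinuousWithinAt.div ?_ ?_ ?_)) ?_ ?_ <;> first | positivity | fun_prop
  have hcg' : ContinuousOn g' (Set.Icc δ R₀) := by
    intro r hr
    have := hcl r hr
    have hr0 : r ≠ 0 := (hδ.trans_le hr.1).ne'
    have hL := hne r hr
    simp only [g']
    refine ContinuousWithinAt.div (ContinuousWithinAt.div ?_ ?_ ?_) ?_ ?_ <;>
      first | positivity | fun_prop | exact continuousWithinAt_id
  have hmax : ∀ r ∈ Set.Icc 0 R₀, max r δ ∈ Set.Icc δ R₀ := fun r hr =>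
    ⟨le_max_right _ _, max_le hr.2 (hδr.trans hR₀)⟩
  have hcm : ContinuousOn (fun r => max r δ) (Set.Icc 0 R₀) := by fun_prop
  have hk0 : k' δ = 0 := by simp [k', q, hlδ]
  have hg0 : g' δ = 0 := by simp [g', hlδ]
  have hkq : ∀ r ∈ Set.Icc δ R₀, k r + r * k' r = q r / r := by
    intro r hr
    have hr0 : r ≠ 0 := (hδ.trans_le hr.1).ne'
    simp only [k, k']
    field_simp
    ring
  have hsmall : ∀ r ≤ δ, max r δ = δ := fun r hr => max_eq_right hr
  refine ⟨δ, hδ, fun r => k (max r δ), fun r => k' (max r δ), fun r => g (max r δ),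
    fun r => g' (max r δ), ?_, ?_, ?_, ?_, ?_, ?_, ?_, ?_, ?_, ?_, ?_⟩
  · exact fun r hr => hasDerivAt_comp_max (hdk _ (hmax r hr)) hk0
  · exact hck'.comp hcm hmax
  · exact fun r hr => hasDerivAt_comp_max (hdg _ (hmax r hr)) hg0
  · exact hcg'.comp hcm hmax
  · intro r hr; simp [hsmall r hr, k, hlδ]
  · intro r hr; simp [hsmall r hr, hk0]
  · intro r hr; simp [hsmall r hr, g, hlδ]
  · intro r hr
    have hr' : r ∈ Set.Icc δ R₀ := ⟨hδr.trans hr.1, hr.2⟩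
    have h1 := hl r hr'
    rw [max_eq_left hr'.1]
    have h2 : m - l r ≤ L₀ := by
      have := log_le_log hr₀ hr.1
      simp only [l]; linarith
    have h3 : log (m - l r) ≤ log L₀ := log_le_log (by linarith) h2
    have h4 : log L₀ + (N + 1) ≤ log m := by
      rw [← log_exp (N + 1), ← log_mul (by positivity) (by positivity), ]
      exact log_le_log (by positivity) hm1
    have h5 : l r / m ≤ 1 := by rw [div_le_one hmpos]; linarith
    simp only [g]; linarith
  · intro r hr
    rcases le_total r δ with h | h
    · simp [hsmall r h, hk0, k, hlδ]
    have hr' : r ∈ Set.Icc δ R₀ := ⟨h, hr.2⟩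
    have hr0 : 0 < r := hδ.trans_le h
    rw [max_eq_left h, hkq r hr']
    obtain ⟨h1, h2⟩ := hl r hr'
    simp only [k, q]
    generalize l r = a at *
    have hL : 0 < m - a := by linarith
    rw [show r * (a ^ 2 / (m ^ 2 * (m - a)) / r) ^ 2
      = (a ^ 4 / m ^ 2) / (m ^ 2 * (m - a) ^ 2) / r by field_simp]
    gcongr
    rw [div_le_iff₀ (by positivity)]
    have ham : a ≤ m := by linarith
    calc a ^ 4 = a * a ^ 3 := by ring
      _ ≤ a * m ^ 3 := by gcongr
      _ = a * m * m ^ 2 := by ring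
      _ ≤ a * (2 * m - a) * m ^ 2 := by gcongr; linarith
  · intro r hr
    rcases le_total r δ with h | h
    · simp [hsmall r h, hk0, k, hlδ]
    have hr' : r ∈ Set.Icc δ R₀ := ⟨h, hr.2⟩
    have hr0 : 0 < r := hδ.trans_le h
    rw [max_eq_left h, hkq r hr']
    obtain ⟨h1, h2⟩ := hl r hr'
    simp only [q]
    generalize l r = a at *
    rw [mul_div_cancel₀ _ hr0.ne']
    have hL : 0 < m - a := by linarith
    rw [div_le_one (by positivity)]
    nlinarith [sq_nonneg (m - a), mul_le_mul_of_nonneg_left (show 1 ≤ (m - a) ^ 2 by nlinarith)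
      (sq_nonneg m)]
  · intro r hr
    rcases le_total r δ with h | h
    · simp [hsmall r h, hk0, hg0, k, hlδ]
    have hr' : r ∈ Set.Icc δ R₀ := ⟨h, hr.2⟩
    have hr0 : 0 < r := hδ.trans_le h
    rw [max_eq_left h, hkq r hr']
    obtain ⟨h1, h2⟩ := hl r hr'
    simp only [q, g']
    generalize l r = a at *
    have hL : 0 < m - a := by linarith
    rw [show r * (a / (m * (m - a)) / r) ^ 2 = a ^ 2 / (m ^ 2 * (m - a) ^ 2) / r by field_simp]
    gcongr
    nlinarith

/-- The `ℓ¹` norm of the gradient. -/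
noncomputable def gnorm (u : Plane → ℝ) (x : Plane) : ℝ := |pd 0 u x| + |pd 1 u x|

/-- The `ℓ¹` distance between the gradients at two points. -/
noncomputable def gosc (u : Plane → ℝ) (y x : Plane) : ℝ :=
  |pd 0 u y - pd 0 u x| + |pd 1 u y - pd 1 u x|

/-- A divergence free flux `(F₁, F₂)` on `O` which, to first order, is a uniformly elliptic linear
function of the gradient of `u`. -/
structure IsEllipticFlux (O : Set Plane) (u F₁ F₂ lam a b d : Plane → ℝ) (μ C : ℝ) : Prop where
  isOpen : IsOpen O
  contDiff : ContDiff ℝ 1 u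
  contF₁ : ContinuousOn F₁ O
  contF₂ : ContinuousOn F₂ O
  weak : ∀ φ : Plane → ℝ, ContDiff ℝ 1 φ → HasCompactSupport φ → tsupport φ ⊆ O →
    ∫ x, (F₁ x * pd 0 φ x + F₂ x * pd 1 φ x) = 0
  contlam : ContinuousOn lam O
  lam_pos : ∀ x ∈ O, 0 < lam x
  μ_pos : 0 < μ
  C_nonneg : 0 ≤ C
  abs_a_le : ∀ x ∈ O, |a x| ≤ C
  abs_b_le : ∀ x ∈ O, |b x| ≤ C
  abs_d_le : ∀ x ∈ O, |d x| ≤ C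
  elliptic : ∀ x ∈ O, ∀ s t : ℝ, μ * (s ^ 2 + t ^ 2) ≤ a x * s ^ 2 + 2 * b x * s * t + d x * t ^ 2
  expansion : ∀ K ⊆ O, IsCompact K → ∀ ε > 0, ∃ s > 0, ∀ x ∈ K, ∀ y, dist y x < s →
    |F₁ y - F₁ x - lam x * (a x * (pd 0 u y - pd 0 u x) + b x * (pd 1 u y - pd 1 u x))|
      ≤ lam x * (C * gnorm u x * dist y x + ε * gosc u y x) ∧
    |F₂ y - F₂ x - lam x * (b x * (pd 0 u y - pd 0 u x) + d x * (pd 1 u y - pd 1 u x))|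
      ≤ lam x * (C * gnorm u x * dist y x + ε * gosc u y x)

lemma flux_test_lower_bound {μ C lam N h G a b d v₁ v₂ f₁ f₂ η η₁ η₂ w : ℝ}
    (hμ : 0 < μ) (hC : 0 ≤ C) (hlam : 0 < lam) (hN : 0 ≤ N) (hh : 0 ≤ h) (hG : 0 ≤ G)
    (ha : |a| ≤ C) (hb : |b| ≤ C) (hd : |d| ≤ C)
    (hell : μ * (v₁ ^ 2 + v₂ ^ 2) ≤ a * v₁ ^ 2 + 2 * b * v₁ * v₂ + d * v₂ ^ 2)
    (hf₁ : |f₁ - lam * (a * v₁ + b * v₂)| ≤ lam * (C * N * h + μ / 8 * (|v₁| + |v₂|)))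
    (hf₂ : |f₂ - lam * (b * v₁ + d * v₂)| ≤ lam * (C * N * h + μ / 8 * (|v₁| + |v₂|)))
    (hη₀ : 0 ≤ η) (hη : η ≤ 1) (hη₁ : |η₁| ≤ G) (hη₂ : |η₂| ≤ G) (hw : |w| ≤ 2 * N * h) :
    lam * (μ / 8 * (η * (|v₁| + |v₂|)) ^ 2
        - ((C * N + 8 * N * G * (C + μ)) ^ 2 / μ + 8 * N ^ 2 * G * C) * h ^ 2)
      ≤ η ^ 2 * (f₁ * v₁ + f₂ * v₂) + 2 * η * w * (f₁ * η₁ + f₂ * η₂) := by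
  set D := |v₁| + |v₂| with hD
  have hD0 : 0 ≤ D := by positivity
  set e := C * N * h + μ / 8 * D with he
  have he0 : 0 ≤ e := by positivity
  set g₁ := f₁ - lam * (a * v₁ + b * v₂) with hg₁
  set g₂ := f₂ - lam * (b * v₁ + d * v₂) with hg₂
  have hD2 : D ^ 2 ≤ 2 * (v₁ ^ 2 + v₂ ^ 2) := by
    rw [← sq_abs v₁, ← sq_abs v₂]; nlinarith [sq_nonneg (|v₁| - |v₂|)]
  have hgv : |g₁ * v₁ + g₂ * v₂| ≤ lam * e * D := by
    calc |g₁ * v₁ + g₂ * v₂| ≤ |g₁| * |v₁| + |g₂| * |v₂| := by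
          rw [← abs_mul, ← abs_mul]; exact abs_add_le _ _
      _ ≤ lam * e * |v₁| + lam * e * |v₂| := by gcongr
      _ = lam * e * D := by rw [hD]; ring
  have h1 : lam * (μ / 2 * D ^ 2 - e * D) ≤ f₁ * v₁ + f₂ * v₂ := by
    have h2 : f₁ * v₁ + f₂ * v₂ = lam * (a * v₁ ^ 2 + 2 * b * v₁ * v₂ + d * v₂ ^ 2)
        + (g₁ * v₁ + g₂ * v₂) := by rw [hg₁, hg₂]; ring
    have h3 := mul_le_mul_of_nonneg_left hell hlam.le
    have h4 := mul_le_mul_of_nonneg_left hD2 (mul_pos hlam hμ).le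
    have h5 := (abs_le.1 hgv).1
    rw [h2]; linarith
  have hlin : ∀ a b : ℝ, |a| ≤ C → |b| ≤ C → |a * v₁ + b * v₂| ≤ C * D := by
    intro a b ha hb
    calc |a * v₁ + b * v₂| ≤ |a| * |v₁| + |b| * |v₂| := by
          rw [← abs_mul, ← abs_mul]; exact abs_add_le _ _
      _ ≤ C * |v₁| + C * |v₂| := by gcongr
      _ = C * D := by rw [hD]; ring
  have hF : ∀ f a b : ℝ, |a| ≤ C → |b| ≤ C → |f - lam * (a * v₁ + b * v₂)| ≤ lam * e →
      |f| ≤ lam * ((C + μ) * D + C * N * h) := by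
    intro f a b ha hb hf
    have h2 : |f| ≤ |f - lam * (a * v₁ + b * v₂)| + |lam * (a * v₁ + b * v₂)| := by
      have := abs_add_le (f - lam * (a * v₁ + b * v₂)) (lam * (a * v₁ + b * v₂))
      simpa using this
    rw [abs_mul, abs_of_pos hlam] at h2
    have h3 := mul_le_mul_of_nonneg_left (hlin a b ha hb) hlam.le
    have h4 : e ≤ C * N * h + μ * D := by
      have := mul_nonneg hμ.le hD0
      rw [he]; linarith
    have h5 := mul_le_mul_of_nonneg_left h4 hlam.le
    linarith
  have hF₁ := hF f₁ a b ha hb hf₁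
  have hF₂ := hF f₂ b d hb hd hf₂
  set Φ := (C + μ) * D + C * N * h with hΦ
  have hΦ0 : 0 ≤ Φ := by positivity
  have h6 : |2 * η * w * (f₁ * η₁ + f₂ * η₂)| ≤ 2 * η * (2 * N * h) * (2 * (lam * Φ * G)) := by
    rw [abs_mul, abs_mul, abs_of_nonneg (by positivity : 0 ≤ 2 * η)]
    have : |f₁ * η₁ + f₂ * η₂| ≤ 2 * (lam * Φ * G) := by
      calc |f₁ * η₁ + f₂ * η₂| ≤ |f₁| * |η₁| + |f₂| * |η₂| := by
            rw [← abs_mul, ← abs_mul]; exact abs_add_le _ _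
        _ ≤ lam * Φ * G + lam * Φ * G := by gcongr
        _ = 2 * (lam * Φ * G) := by ring
    gcongr
  have h7 := (abs_le.1 h6).1
  have h8 := mul_le_mul_of_nonneg_left h1 (sq_nonneg η)
  set t := η * D with ht
  have ht0 : 0 ≤ t := by positivity
  have h9 : η ^ 2 * (lam * (μ / 2 * D ^ 2 - e * D)) - 2 * η * (2 * N * h) * (2 * (lam * Φ * G))
      = lam * (3 * μ / 8 * t ^ 2 - t * h * (η * (C * N) + 8 * N * G * (C + μ))
        - η * (8 * N ^ 2 * G * C) * h ^ 2) := by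
    rw [ht, he, hΦ]; ring
  have h10 : μ / 8 * t ^ 2 - ((C * N + 8 * N * G * (C + μ)) ^ 2 / μ + 8 * N ^ 2 * G * C) * h ^ 2
      ≤ 3 * μ / 8 * t ^ 2 - t * h * (η * (C * N) + 8 * N * G * (C + μ))
        - η * (8 * N ^ 2 * G * C) * h ^ 2 := by
    have hX : η * (C * N) + 8 * N * G * (C + μ) ≤ C * N + 8 * N * G * (C + μ) := by
      have := mul_le_of_le_one_left (by positivity : 0 ≤ C * N) hη
      linarith
    generalize C * N + 8 * N * G * (C + μ) = X at hX ⊢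
    have hX' := mul_le_mul_of_nonneg_left hX (mul_nonneg ht0 hh)
    have hY : η * (8 * N ^ 2 * G * C) * h ^ 2 ≤ 8 * N ^ 2 * G * C * h ^ 2 := by
      have := mul_le_of_le_one_left (by positivity : 0 ≤ 8 * N ^ 2 * G * C * h ^ 2) hη
      linarith
    have hZ : t * h * X ≤ μ / 4 * t ^ 2 + X ^ 2 / μ * h ^ 2 := by
      have h11 : μ / 4 * t ^ 2 + X ^ 2 / μ * h ^ 2 - t * h * X
          = (μ * t / 2 - X * h) ^ 2 / μ := by field_simp; ring
      have : 0 ≤ (μ * t / 2 - X * h) ^ 2 / μ := by positivity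
      linarith
    linarith
  have h12 := mul_le_mul_of_nonneg_left h10 hlam.le
  linarith

lemma gnorm_nonneg (u : Plane → ℝ) (x : Plane) : 0 ≤ gnorm u x := by unfold gnorm; positivity

lemma continuous_gnorm {u : Plane → ℝ} (hu : ContDiff ℝ 1 u) : Continuous (gnorm u) :=
  hu.continuous_pd.abs.add hu.continuous_pd.abs

lemma continuous_gosc {u : Plane → ℝ} (hu : ContDiff ℝ 1 u) :
    Continuous fun q : Plane × Plane => gosc u q.1 q.2 := by
  have h := fun i => hu.continuous_pd (i := i)
  unfold gosc
  exact ((((h 0).comp continuous_fst).sub ((h 0).comp continuous_snd)).abs).add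
    ((((h 1).comp continuous_fst).sub ((h 1).comp continuous_snd)).abs)

lemma abs_apply_le_norm (v : Plane) (i : Fin 2) : |v i| ≤ ‖v‖ := by
  simpa using PiLp.norm_apply_le v i

lemma norm_fderiv_le_gnorm (u : Plane → ℝ) (x : Plane) : ‖fderiv ℝ u x‖ ≤ gnorm u x := by
  refine ContinuousLinearMap.opNorm_le_bound _ (gnorm_nonneg u x) fun v => ?_
  rw [fderiv_apply_eq_pd, Real.norm_eq_abs]
  calc |v 0 * pd 0 u x + v 1 * pd 1 u x| ≤ |v 0| * |pd 0 u x| + |v 1| * |pd 1 u x| := by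
        rw [← abs_mul, ← abs_mul]; exact abs_add_le _ _
    _ ≤ ‖v‖ * |pd 0 u x| + ‖v‖ * |pd 1 u x| := by
        gcongr <;> exact abs_apply_le_norm v _
    _ = gnorm u x * ‖v‖ := by unfold gnorm; ring

lemma abs_sub_le_of_gnorm_le {u : Plane → ℝ} (hu : ContDiff ℝ 1 u) {S : Set Plane}
    (hS : Convex ℝ S) {N : ℝ} (hN : ∀ x ∈ S, gnorm u x ≤ N) {x y : Plane} (hx : x ∈ S)
    (hy : y ∈ S) : |u y - u x| ≤ N * ‖y - x‖ := by
  rw [← Real.norm_eq_abs]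
  exact hS.norm_image_sub_le_of_norm_fderiv_le
    (fun x _ => hu.contDiffAt.differentiableAt (by simp))
    (fun x hx => (norm_fderiv_le_gnorm u x).trans (hN x hx)) hx hy

lemma exists_abs_pd_le {η : Plane → ℝ} (hη : ContDiff ℝ 1 η) (hc : HasCompactSupport η) :
    ∃ G, 0 ≤ G ∧ ∀ i x, |pd i η x| ≤ G := by
  obtain ⟨G₀, hG₀⟩ := (hη.continuous_pd (i := 0)).bounded_above_of_compact_support hc.pd
  obtain ⟨G₁, hG₁⟩ := (hη.continuous_pd (i := 1)).bounded_above_of_compact_support hc.pd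
  refine ⟨max G₀ G₁, le_max_of_le_left ((norm_nonneg _).trans (hG₀ 0)), fun i x => ?_⟩
  fin_cases i
  · exact (hG₀ x).trans (le_max_left _ _)
  · exact (hG₁ x).trans (le_max_right _ _)

lemma IsEllipticFlux.integral_translate_sub_eq_zero {O : Set Plane}
    {u F₁ F₂ lam a b d : Plane → ℝ} {μ C : ℝ} (h : IsEllipticFlux O u F₁ F₂ lam a b d μ C)
    {φ : Plane → ℝ} (hφ : ContDiff ℝ 1 φ) (hc : HasCompactSupport φ) {z : Plane}
    (hs : tsupport φ ⊆ O) (hsz : ∀ x ∈ tsupport φ, x + z ∈ O) :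
    Integrable (fun x => (F₁ (x + z) - F₁ x) * pd 0 φ x + (F₂ (x + z) - F₂ x) * pd 1 φ x) ∧
    ∫ x, ((F₁ (x + z) - F₁ x) * pd 0 φ x + (F₂ (x + z) - F₂ x) * pd 1 φ x) = 0 := by
  have hO' : IsOpen {x : Plane | x + z ∈ O} := h.isOpen.preimage (continuous_add_const z)
  have hcz : ∀ F : Plane → ℝ, ContinuousOn F O →
      ContinuousOn (fun x => F (x + z)) {x : Plane | x + z ∈ O} := fun F hF =>
    hF.comp (continuous_add_const z).continuousOn fun x hx => hx
  have hi : ∀ (F : Plane → ℝ) (i : Fin 2), ContinuousOn F O →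
      Integrable fun x => F x * pd i φ x := fun F i hF =>
    integrable_mul_of_tsupport_subset h.isOpen hF hφ.continuous_pd
      (tsupport_pd_subset.trans hs) hc.pd
  have hiz : ∀ (F : Plane → ℝ) (i : Fin 2), ContinuousOn F O →
      Integrable fun x => F (x + z) * pd i φ x := fun F i hF =>
    integrable_mul_of_tsupport_subset hO' (hcz F hF) hφ.continuous_pd
      (fun x hx => hsz x (tsupport_pd_subset hx)) hc.pd
  have i1 := (hi F₁ 0 h.contF₁).add (hi F₂ 1 h.contF₂)
  have i2 := (hiz F₁ 0 h.contF₁).add (hiz F₂ 1 h.contF₂)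
  have e : (fun x => (F₁ (x + z) - F₁ x) * pd 0 φ x + (F₂ (x + z) - F₂ x) * pd 1 φ x)
      = fun x => (F₁ (x + z) * pd 0 φ x + F₂ (x + z) * pd 1 φ x)
        - (F₁ x * pd 0 φ x + F₂ x * pd 1 φ x) := by ext x; ring
  have hw := h.weak φ hφ hc hs
  have hwz : ∫ x, (F₁ (x + z) * pd 0 φ x + F₂ (x + z) * pd 1 φ x) = 0 := by
    have hts : tsupport (fun x => φ (x - z)) ⊆ (fun x => x - z) ⁻¹' tsupport φ :=
      closure_minimal (fun x hx => subset_tsupport _ hx)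
        ((isClosed_tsupport _).preimage (continuous_sub_right z))
    have hcc : HasCompactSupport fun x => φ (x - z) := by
      simpa [sub_eq_add_neg, Function.comp_def] using hc.comp_homeomorph (Homeomorph.addRight (-z))
    have := h.weak (fun x => φ (x - z)) (hφ.comp (contDiff_id.sub contDiff_const)) hcc
      (fun x hx => by simpa using hsz (x - z) (hts hx))
    simp only [pd_comp_sub] at this
    rw [← integral_add_right_eq_self _ z] at this
    simpa using this
  rw [e]
  refine ⟨i2.sub i1, ?_⟩
  have := integral_sub i2 i1
  simp only [Pi.add_apply] at this
  rw [this, hwz, hw, sub_zero]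

lemma IsEllipticFlux.local_gosc_bound {O : Set Plane}
    {u F₁ F₂ lam a b d : Plane → ℝ} {μ C : ℝ} (h : IsEllipticFlux O u F₁ F₂ lam a b d μ C)
    {x₀ : Plane} (hx₀ : x₀ ∈ O) :
    ∃ s > 0, ∃ C₁, 0 ≤ C₁ ∧ ∀ z : Plane, ‖z‖ < s →
      ∫⁻ x in Metric.ball x₀ s, ENNReal.ofReal (gosc u (x + z) x ^ 2)
        ≤ ENNReal.ofReal (C₁ * ‖z‖ ^ 2) := by
  obtain ⟨R, hR, hRO⟩ := Metric.nhds_basis_closedBall.mem_iff.1 (h.isOpen.mem_nhds hx₀)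
  have hμ := h.μ_pos
  have hC := h.C_nonneg
  have hK : IsCompact (Metric.closedBall x₀ R) := isCompact_closedBall _ _
  have hx₀K : x₀ ∈ Metric.closedBall x₀ R := Metric.mem_closedBall_self hR.le
  obtain ⟨s₀, hs₀, hexp⟩ := h.expansion _ hRO hK (μ / 8) (by positivity)
  obtain ⟨xm, hxm, hmin⟩ := hK.exists_isMinOn ⟨x₀, hx₀K⟩ (h.contlam.mono hRO)
  obtain ⟨xM, hxM, hmax⟩ := hK.exists_isMaxOn ⟨x₀, hx₀K⟩ (h.contlam.mono hRO)
  obtain ⟨xN, hxN, hNmax⟩ := hK.exists_isMaxOn ⟨x₀, hx₀K⟩ (continuous_gnorm h.contDiff).continuousOn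
  have hl : 0 < lam xm := h.lam_pos _ (hRO hxm)
  have hL : 0 < lam xM := h.lam_pos _ (hRO hxM)
  have hlle : ∀ x ∈ Metric.closedBall x₀ R, lam xm ≤ lam x := fun x hx => hmin hx
  have hleL : ∀ x ∈ Metric.closedBall x₀ R, lam x ≤ lam xM := fun x hx => hmax hx
  have hgN : ∀ x ∈ Metric.closedBall x₀ R, gnorm u x ≤ gnorm u xN := fun x hx => hNmax hx
  have hN0 := gnorm_nonneg u xN
  generalize gnorm u xN = N at hgN hN0
  generalize lam xm = l at hl hlle
  generalize lam xM = L at hL hleL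
  let η : ContDiffBump x₀ := ⟨R / 4, R / 2, by positivity, by linarith⟩
  have hη1 : ContDiff ℝ 1 η := η.contDiff
  have hηts : tsupport η = Metric.closedBall x₀ (R / 2) := η.tsupport_eq
  obtain ⟨G, hG, hGle⟩ := exists_abs_pd_le hη1 η.hasCompactSupport
  set C' := (C * N + 8 * N * G * (C + μ)) ^ 2 / μ + 8 * N ^ 2 * G * C with hC'
  have hC'0 : 0 ≤ C' := by positivity
  set B := Metric.closedBall x₀ (R / 2) with hB
  have hBvol : volume B ≠ ⊤ := (isCompact_closedBall _ _).measure_ne_top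
  refine ⟨min s₀ (R / 4), by positivity, L * C' * volume.real B / (l * μ / 8),
    by positivity, fun z hz => ?_⟩
  have hzs : ‖z‖ < s₀ := hz.trans_le (min_le_left _ _)
  have hzR : ‖z‖ < R / 4 := hz.trans_le (min_le_right _ _)
  have hBK : ∀ x ∈ B, x ∈ Metric.closedBall x₀ R := fun x hx =>
    Metric.closedBall_subset_closedBall (by linarith) hx
  have hBzK : ∀ x ∈ B, x + z ∈ Metric.closedBall x₀ R := fun x hx => by
    rw [hB, Metric.mem_closedBall] at hx
    rw [Metric.mem_closedBall]
    calc dist (x + z) x₀ ≤ dist (x + z) x + dist x x₀ := dist_triangle _ _ _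
      _ ≤ R / 4 + R / 2 := by
          refine add_le_add ?_ hx
          simpa using hzR.le
      _ ≤ R := by linarith
  set φ : Plane → ℝ := fun x => η x ^ 2 * (u (x + z) - u x) with hφdef
  have huz : ContDiff ℝ 1 fun x => u (x + z) :=
    h.contDiff.comp (contDiff_id.add contDiff_const)
  have hdiff : ∀ {f : Plane → ℝ}, ContDiff ℝ 1 f → ∀ x, DifferentiableAt ℝ f x := fun hf x =>
    hf.contDiffAt.differentiableAt (by simp)
  have hφ : ContDiff ℝ 1 φ := (hη1.pow 2).mul (huz.sub h.contDiff)
  have hφs : tsupport φ ⊆ B := by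
    rw [← hηts]
    refine closure_mono fun x hx => ?_
    contrapose! hx
    simp only [Function.mem_support, ne_eq, not_not] at hx ⊢
    simp [hφdef, hx]
  have hφc : HasCompactSupport φ :=
    (isCompact_closedBall x₀ (R / 2)).of_isClosed_subset (isClosed_tsupport _) hφs
  have hpdφ : ∀ i x, pd i φ x = η x ^ 2 * (pd i u (x + z) - pd i u x)
      + 2 * η x * (u (x + z) - u x) * pd i η x := fun i x => by
    have h1 : pd i (fun y => u (y + z) - u y) x = pd i u (x + z) - pd i u x := by
      rw [← pd_comp_add]
      simp only [pd]
      rw [fderiv_fun_sub (hdiff huz x) (hdiff h.contDiff x)]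
      simp
    rw [hφdef, pd_mul ((hdiff (hη1.pow 2)) x) ((hdiff (huz.sub h.contDiff)) x), h1,
      pd_sq (hdiff hη1 x)]
    ring
  obtain ⟨hintegrable, hzero⟩ := h.integral_translate_sub_eq_zero hφ hφc (z := z)
    (fun x hx => hRO (hBK x (hφs hx))) (fun x hx => hRO (hBzK x (hφs hx)))
  set q : Plane → ℝ := fun x => (η x * gosc u (x + z) x) ^ 2 with hq
  have hqcont : Continuous q := by
    have : Continuous fun x : Plane => gosc u (x + z) x :=
      (continuous_gosc h.contDiff).comp (f := fun x : Plane => (x + z, x)) (by fun_prop)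
    exact (hη1.continuous.mul this).pow 2
  have hqc : HasCompactSupport q := by
    refine η.hasCompactSupport.mono fun x hx => ?_
    contrapose! hx
    simp only [Function.mem_support, ne_eq, not_not] at hx ⊢
    simp [hq, hx]
  have hqi : Integrable q := hqcont.integrable_of_hasCompactSupport hqc
  have hindi : Integrable (B.indicator fun _ => L * C' * ‖z‖ ^ 2) :=
    (integrable_indicator_iff Metric.isClosed_closedBall.measurableSet).2
      (integrableOn_const hBvol)
  have hpt : ∀ x, l * μ / 8 * q x - B.indicator (fun _ => L * C' * ‖z‖ ^ 2) x
      ≤ (F₁ (x + z) - F₁ x) * pd 0 φ x + (F₂ (x + z) - F₂ x) * pd 1 φ x := fun x => by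
    by_cases hx : x ∈ B
    · have hxK := hBK x hx
      have hxO := hRO hxK
      obtain ⟨e1, e2⟩ := hexp x hxK (x + z) (by simpa using hzs)
      have hdist : dist (x + z) x = ‖z‖ := by simp
      rw [hdist] at e1 e2
      have hle : lam x * (C * gnorm u x * ‖z‖ + μ / 8 * gosc u (x + z) x)
          ≤ lam x * (C * N * ‖z‖ + μ / 8 * gosc u (x + z) x) := by
        have := hgN x hxK
        have := (h.lam_pos x hxO).le
        gcongr
      have hw : |u (x + z) - u x| ≤ 2 * N * ‖z‖ := by
        have := abs_sub_le_of_gnorm_le h.contDiff (convex_closedBall x₀ R) hgN hxK (hBzK x hx)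
        rw [add_sub_cancel_left] at this
        have h2 : 0 ≤ N * ‖z‖ := by positivity
        linarith
      have hlow := flux_test_lower_bound hμ hC (h.lam_pos x hxO) hN0 (norm_nonneg z) hG
        (h.abs_a_le x hxO) (h.abs_b_le x hxO) (h.abs_d_le x hxO)
        (h.elliptic x hxO (pd 0 u (x + z) - pd 0 u x) (pd 1 u (x + z) - pd 1 u x))
        (e1.trans hle) (e2.trans hle) (η.nonneg (x := x)) η.le_one (hGle 0 x) (hGle 1 x) hw
      rw [Set.indicator_of_mem hx, hpdφ, hpdφ]
      have hl1 : l * μ / 8 * q x - L * C' * ‖z‖ ^ 2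
          ≤ lam x * (μ / 8 * q x - C' * ‖z‖ ^ 2) := by
        have hq0 : 0 ≤ μ / 8 * q x := by positivity
        have h1 := mul_le_mul_of_nonneg_right (hlle x hxK) hq0
        have h2 := mul_le_mul_of_nonneg_right (hleL x hxK)
          (by positivity : 0 ≤ C' * ‖z‖ ^ 2)
        linarith
      refine hl1.trans (le_trans hlow (le_of_eq ?_))
      ring
    · rw [Set.indicator_of_notMem hx]
      have hx' : x ∉ tsupport φ := fun h' => hx (hφs h')
      have hηx : η x = 0 := image_eq_zero_of_notMem_tsupport (by rwa [hηts])
      have h0 : ∀ i, pd i φ x = 0 := fun i =>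
        image_eq_zero_of_notMem_tsupport fun h' => hx' (tsupport_pd_subset h')
      simp [h0, hq, hηx]
  have hmain : l * μ / 8 * ∫ x, q x ≤ L * C' * ‖z‖ ^ 2 * volume.real B := by
    have h1 := integral_mono ((hqi.const_mul (l * μ / 8)).sub hindi) hintegrable hpt
    simp only [Pi.sub_apply] at h1
    rw [hzero, integral_sub (hqi.const_mul (l * μ / 8)) hindi, integral_const_mul,
      integral_indicator Metric.isClosed_closedBall.measurableSet, setIntegral_const,
      smul_eq_mul] at h1
    linarith
  have hqle : ∫ x, q x ≤ L * C' * volume.real B / (l * μ / 8) * ‖z‖ ^ 2 := by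
    rw [div_mul_eq_mul_div, le_div_iff₀ (by positivity)]
    linarith
  calc ∫⁻ x in Metric.ball x₀ (min s₀ (R / 4)), ENNReal.ofReal (gosc u (x + z) x ^ 2)
      = ∫⁻ x in Metric.ball x₀ (min s₀ (R / 4)), ENNReal.ofReal (q x) := by
        refine setLIntegral_congr_fun Metric.isOpen_ball.measurableSet fun x hx => ?_
        have : η x = 1 := η.one_of_mem_closedBall
          (Metric.mem_closedBall.2 ((Metric.mem_ball.1 hx).le.trans (min_le_right _ _)))
        simp [hq, this]
    _ ≤ ∫⁻ x, ENNReal.ofReal (q x) := setLIntegral_le_lintegral _ _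
    _ = ENNReal.ofReal (∫ x, q x) :=
        (ofReal_integral_eq_lintegral_ofReal hqi (ae_of_all _ fun x => sq_nonneg _)).symm
    _ ≤ _ := ENNReal.ofReal_le_ofReal hqle

lemma IsEllipticFlux.gosc_bound {O K : Set Plane}
    {u F₁ F₂ lam a b d : Plane → ℝ} {μ C : ℝ} (h : IsEllipticFlux O u F₁ F₂ lam a b d μ C)
    (hK : IsCompact K) (hKO : K ⊆ O) :
    ∃ s > 0, ∃ C₁, 0 ≤ C₁ ∧ ∀ z : Plane, ‖z‖ < s →
      ∫⁻ x in K, ENNReal.ofReal (gosc u (x + z) x ^ 2) ≤ ENNReal.ofReal (C₁ * ‖z‖ ^ 2) := by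
  refine hK.induction_on (p := fun S => ∃ s > 0, ∃ C₁, 0 ≤ C₁ ∧ ∀ z : Plane, ‖z‖ < s →
      ∫⁻ x in S, ENNReal.ofReal (gosc u (x + z) x ^ 2) ≤ ENNReal.ofReal (C₁ * ‖z‖ ^ 2))
    ⟨1, one_pos, 0, le_rfl, by simp⟩ ?_ ?_ ?_
  · rintro S T hST ⟨s, hs, C₁, hC₁, hT⟩
    exact ⟨s, hs, C₁, hC₁, fun z hz => (lintegral_mono_set hST).trans (hT z hz)⟩
  · rintro S T ⟨s, hs, C₁, hC₁, hS⟩ ⟨s', hs', C₁', hC₁', hT⟩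
    refine ⟨min s s', lt_min hs hs', C₁ + C₁', by positivity, fun z hz => ?_⟩
    refine (lintegral_union_le _ _ _).trans ?_
    rw [add_mul, ENNReal.ofReal_add (by positivity) (by positivity)]
    exact add_le_add (hS z (hz.trans_le (min_le_left _ _))) (hT z (hz.trans_le (min_le_right _ _)))
  · intro x hx
    obtain ⟨s, hs, C₁, hC₁, hb⟩ := h.local_gosc_bound (hKO hx)
    exact ⟨_, mem_nhdsWithin_of_mem_nhds (Metric.ball_mem_nhds x hs), s, hs, C₁, hC₁, hb⟩

lemma IsMollifier.contDiff_one {Cm ε : ℝ} {ρ : Plane → ℝ} (hρ : IsMollifier Cm ε ρ) :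
    ContDiff ℝ 1 ρ := by
  exact_mod_cast contDiff_infty.1 hρ.contDiff 1

lemma IsMollifier.pd_eq_zero {Cm ε : ℝ} {ρ : Plane → ℝ} (hρ : IsMollifier Cm ε ρ) (i : Fin 2)
    {t : Plane} (ht : ε < ‖t‖) : pd i ρ t = 0 := by
  have hU : IsOpen {t : Plane | ε < ‖t‖} := isOpen_lt continuous_const continuous_norm
  rw [pd_congr (g := fun _ => 0) hU (fun y hy => hρ.support y hy) ht]
  simp [pd]

lemma IsMollifier.integrable_gnorm {Cm ε : ℝ} {ρ : Plane → ℝ} (hρ : IsMollifier Cm ε ρ)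
    {f : Plane → ℝ} (hf : Continuous f) : Integrable fun t => gnorm ρ t * f t := by
  have h1 := hρ.contDiff_one
  refine ((continuous_gnorm h1).mul hf).integrable_of_hasCompactSupport ?_
  refine hρ.compact.mono' fun t ht => ?_
  by_contra h2
  have h3 : ∀ i, pd i ρ t = 0 := fun i =>
    image_eq_zero_of_notMem_tsupport fun h' => h2 (tsupport_pd_subset h')
  simp [gnorm, h3] at ht

lemma IsMollifier.integral_gnorm_le {Cm ε : ℝ} {ρ : Plane → ℝ} (hρ : IsMollifier Cm ε ρ) :
    ∫ t, gnorm ρ t ≤ 2 * Cm / ε := by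
  have h1 := hρ.contDiff_one
  have hi : ∀ i, Integrable fun t => |pd i ρ t| := fun i =>
    (h1.continuous_pd.integrable_of_hasCompactSupport hρ.compact.pd).abs
  unfold gnorm
  rw [integral_add (hi 0) (hi 1)]
  have := hρ.pd_bound 0
  have := hρ.pd_bound 1
  rw [show 2 * Cm / ε = Cm / ε + Cm / ε by ring]
  linarith

/-- The Cauchy–Schwarz inequality for a weighted integral. -/
lemma sq_integral_mul_le {k g : Plane → ℝ} (hk : ∀ t, 0 ≤ k t) (h0 : Integrable k)
    (h1 : Integrable fun t => k t * g t) (h2 : Integrable fun t => k t * g t ^ 2) :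
    (∫ t, k t * g t) ^ 2 ≤ (∫ t, k t) * ∫ t, k t * g t ^ 2 := by
  have hq : ∀ c : ℝ, 0 ≤ (∫ t, k t) * (c * c) + (-2 * ∫ t, k t * g t) * c
      + ∫ t, k t * g t ^ 2 := fun c => by
    have hnn : 0 ≤ ∫ t, k t * (g t - c) ^ 2 :=
      integral_nonneg fun t => mul_nonneg (hk t) (sq_nonneg _)
    have e : (fun t => k t * (g t - c) ^ 2)
        = fun t => k t * g t ^ 2 - (2 * c) * (k t * g t) + (c * c) * k t := by ext t; ring
    have h3 : Integrable fun t => k t * g t ^ 2 - (2 * c) * (k t * g t) := h2.sub (h1.const_mul _)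
    rw [e, integral_add h3 (h0.const_mul _), integral_sub h2 (h1.const_mul _),
      integral_const_mul, integral_const_mul] at hnn
    linarith
  have := discrim_le_zero hq
  unfold discrim at this
  linarith

/-- The mollified gradient oscillation at scale given by `ρ`. -/
noncomputable def oscAvg (ρ u : Plane → ℝ) (x : Plane) : ℝ := ∫ t, gnorm ρ t * gosc u (x - t) x

lemma lintegral_oscAvg_sq_le {Cm ε C₁ s : ℝ} {ρ u : Plane → ℝ} {K : Set Plane}
    (hu : ContDiff ℝ 1 u) (hCm : 0 ≤ Cm) (hC₁ : 0 ≤ C₁)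
    (hs : ∀ z : Plane, ‖z‖ < s → ∫⁻ x in K, ENNReal.ofReal (gosc u (x + z) x ^ 2)
      ≤ ENNReal.ofReal (C₁ * ‖z‖ ^ 2)) (hε : 0 < ε) (hεs : ε < s) (hρ : IsMollifier Cm ε ρ) :
    ∫⁻ x in K, ENNReal.ofReal (oscAvg ρ u x ^ 2) ≤ ENNReal.ofReal (4 * Cm ^ 2 * C₁) := by
  have h1 := hρ.contDiff_one
  have hk := continuous_gnorm h1
  have hg2 : Continuous fun q : Plane × Plane => gosc u (q.1 - q.2) q.1 :=
    (continuous_gosc hu).comp (f := fun q : Plane × Plane => (q.1 - q.2, q.1)) (by fun_prop)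
  have hg : ∀ x, Continuous fun t => gosc u (x - t) x := fun x =>
    hg2.comp (f := fun t : Plane => (x, t)) (by fun_prop)
  have hk0 : Integrable (gnorm ρ) := by
    simpa using hρ.integrable_gnorm (continuous_const (y := (1 : ℝ)))
  have hm0 : 0 ≤ ∫ t, gnorm ρ t := integral_nonneg fun t => gnorm_nonneg _ _
  have hm := hρ.integral_gnorm_le
  have hstep : ∀ x, ENNReal.ofReal (oscAvg ρ u x ^ 2) ≤ ENNReal.ofReal (∫ t, gnorm ρ t) *
      ∫⁻ t, ENNReal.ofReal (gnorm ρ t) * ENNReal.ofReal (gosc u (x - t) x ^ 2) := fun x => by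
    have i2 : Integrable fun t => gnorm ρ t * gosc u (x - t) x ^ 2 :=
      hρ.integrable_gnorm ((hg x).pow 2)
    have := sq_integral_mul_le (fun t => gnorm_nonneg ρ t) hk0 (hρ.integrable_gnorm (hg x)) i2
    refine (ENNReal.ofReal_le_ofReal this).trans ?_
    rw [ENNReal.ofReal_mul hm0, ofReal_integral_eq_lintegral_ofReal i2
      (ae_of_all _ fun t => mul_nonneg (gnorm_nonneg _ _) (sq_nonneg _))]
    simp only [ENNReal.ofReal_mul (gnorm_nonneg _ _)]
    exact le_rfl
  have hmeas : Measurable fun q : Plane × Plane =>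
      ENNReal.ofReal (gnorm ρ q.2) * ENNReal.ofReal (gosc u (q.1 - q.2) q.1 ^ 2) :=
    ((hk.comp continuous_snd).measurable.ennreal_ofReal).mul
      ((hg2.pow 2).measurable.ennreal_ofReal)
  calc ∫⁻ x in K, ENNReal.ofReal (oscAvg ρ u x ^ 2)
      ≤ ∫⁻ x in K, ENNReal.ofReal (∫ t, gnorm ρ t) *
        ∫⁻ t, ENNReal.ofReal (gnorm ρ t) * ENNReal.ofReal (gosc u (x - t) x ^ 2) :=
        lintegral_mono fun x => hstep x
    _ = ENNReal.ofReal (∫ t, gnorm ρ t) * ∫⁻ t, ∫⁻ x in K,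
        ENNReal.ofReal (gnorm ρ t) * ENNReal.ofReal (gosc u (x - t) x ^ 2) := by
        rw [lintegral_const_mul' _ _ ENNReal.ofReal_ne_top, lintegral_lintegral_swap]
        exact hmeas.aemeasurable
    _ ≤ ENNReal.ofReal (∫ t, gnorm ρ t) * ∫⁻ t,
        ENNReal.ofReal (gnorm ρ t) * ENNReal.ofReal (C₁ * ε ^ 2) := by
        gcongr with t
        rw [lintegral_const_mul' _ _ ENNReal.ofReal_ne_top]
        by_cases ht : ε < ‖t‖
        · simp [gnorm, hρ.pd_eq_zero _ ht]
        · rw [not_lt] at ht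
          gcongr
          have := hs (-t) (by rw [norm_neg]; exact ht.trans_lt hεs)
          simp only [← sub_eq_add_neg, norm_neg] at this
          refine this.trans ?_
          gcongr
    _ = ENNReal.ofReal ((∫ t, gnorm ρ t) * ((∫ t, gnorm ρ t) * (C₁ * ε ^ 2))) := by
        rw [lintegral_mul_const' _ _ ENNReal.ofReal_ne_top,
          ← ofReal_integral_eq_lintegral_ofReal hk0 (ae_of_all _ fun t => gnorm_nonneg _ _),
          ENNReal.ofReal_mul hm0, ENNReal.ofReal_mul hm0]
    _ ≤ ENNReal.ofReal (4 * Cm ^ 2 * C₁) := by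
        refine ENNReal.ofReal_le_ofReal ?_
        calc (∫ t, gnorm ρ t) * ((∫ t, gnorm ρ t) * (C₁ * ε ^ 2))
            ≤ (2 * Cm / ε) * ((2 * Cm / ε) * (C₁ * ε ^ 2)) := by gcongr
          _ = 4 * Cm ^ 2 * C₁ := by field_simp; ring

lemma pd_pd_mol_eq {Cm ε : ℝ} {ρ u : Plane → ℝ} (hρ : IsMollifier Cm ε ρ) (hu : ContDiff ℝ 1 u)
    (hc : HasCompactSupport u) (i j : Fin 2) (x : Plane) :
    pd j (pd i (mol ρ u)) x = ∫ t, pd j ρ t * (pd i u (x - t) - pd i u x) := by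
  have h1 := hρ.contDiff_one
  have e : pd i (mol ρ u) = mol ρ (pd i u) := funext fun y =>
    pd_mol_right i hρ.contDiff.continuous hc hu y
  rw [e, pd_mol_left j hρ.compact h1 hu.continuous_pd]
  have i1 := integrable_mol hρ.compact.pd (h1.continuous_pd (i := j)) (hu.continuous_pd (i := i)) x
  have i2 := (h1.continuous_pd (i := j)).integrable_of_hasCompactSupport (μ := volume)
    hρ.compact.pd
  simp only [mul_sub]
  rw [integral_sub i1 (i2.mul_const _), integral_mul_const, integral_pd_eq_zero j h1 hρ.compact]
  simp [mol]

lemma IsEllipticFlux.integral_flux_mollifier {O : Set Plane} {u F₁ F₂ lam a b d : Plane → ℝ}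
    {μ C : ℝ} (h : IsEllipticFlux O u F₁ F₂ lam a b d μ C) {Cm ε : ℝ} {ρ : Plane → ℝ}
    (hρ : IsMollifier Cm ε ρ) {x : Plane} (hx : Metric.closedBall x ε ⊆ O) :
    Integrable (fun t => (F₁ (x - t) - F₁ x) * pd 0 ρ t) ∧
    Integrable (fun t => (F₂ (x - t) - F₂ x) * pd 1 ρ t) ∧
    ∫ t, ((F₁ (x - t) - F₁ x) * pd 0 ρ t + (F₂ (x - t) - F₂ x) * pd 1 ρ t) = 0 := by
  have h1 := hρ.contDiff_one
  have hts : ∀ t ∈ tsupport ρ, ‖t‖ ≤ ε := by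
    have : tsupport ρ ⊆ {t : Plane | ‖t‖ ≤ ε} :=
      closure_minimal (fun t ht => by
        by_contra h'
        exact ht (hρ.support t (not_le.1 h'))) (isClosed_le continuous_norm continuous_const)
    exact fun t ht => this ht
  have hO' : IsOpen {t : Plane | x - t ∈ O} := h.isOpen.preimage (by fun_prop)
  have hi : ∀ (F : Plane → ℝ) (i : Fin 2), ContinuousOn F O →
      Integrable fun t => F (x - t) * pd i ρ t := fun F i hF => by
    refine integrable_mul_of_tsupport_subset hO'
      (hF.comp (f := fun t => x - t) (by fun_prop) fun t ht => ht) h1.continuous_pd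
      (fun t ht => hx ?_) hρ.compact.pd
    simpa using hts t (tsupport_pd_subset ht)
  have hi2 : ∀ i, Integrable (pd i ρ) := fun i =>
    h1.continuous_pd.integrable_of_hasCompactSupport hρ.compact.pd
  have hd : ∀ (F : Plane → ℝ) (i : Fin 2), ContinuousOn F O →
      Integrable fun t => (F (x - t) - F x) * pd i ρ t := fun F i hF => by
    simp only [sub_mul]
    exact (hi F i hF).sub ((hi2 i).const_mul _)
  have hdi : ∀ (F : Plane → ℝ) (i : Fin 2), ContinuousOn F O →
      ∫ t, (F (x - t) - F x) * pd i ρ t = ∫ t, F (x - t) * pd i ρ t := fun F i hF => by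
    simp only [sub_mul]
    rw [integral_sub (hi F i hF) ((hi2 i).const_mul _), integral_const_mul,
      integral_pd_eq_zero i h1 hρ.compact, mul_zero, sub_zero]
  refine ⟨hd _ 0 h.contF₁, hd _ 1 h.contF₂, ?_⟩
  rw [integral_add (hd _ 0 h.contF₁) (hd _ 1 h.contF₂), hdi _ 0 h.contF₁, hdi _ 1 h.contF₂,
    ← integral_add (hi _ 0 h.contF₁) (hi _ 1 h.contF₂)]
  have hsφ : tsupport (fun y => ρ (x - y)) ⊆ (fun y => x - y) ⁻¹' tsupport ρ :=
    closure_minimal (fun t ht => subset_tsupport _ ht)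
      ((isClosed_tsupport _).preimage (by fun_prop))
  have hw := h.weak (fun y => ρ (x - y)) (h1.comp (contDiff_const.sub contDiff_id))
    (by simpa [Function.comp_def] using hρ.compact.comp_homeomorph (Homeomorph.subLeft x))
    (fun y hy => hx (by
      have := hts _ (hsφ hy)
      rwa [Metric.mem_closedBall, dist_eq_norm, norm_sub_rev]))
  simp only [pd_comp_const_sub (h1.differentiable (by simp))] at hw
  rw [← integral_sub_left_eq_self _ volume x] at hw
  simp only [sub_sub_cancel, mul_neg, ← neg_add] at hw
  rw [integral_neg] at hw
  linarith

lemma IsEllipticFlux.abs_residual_le {O : Set Plane} {u F₁ F₂ lam a b d : Plane → ℝ}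
    {μ C : ℝ} (h : IsEllipticFlux O u F₁ F₂ lam a b d μ C) (hc : HasCompactSupport u)
    {Cm ε ε' : ℝ} (hε : 0 < ε) {ρ : Plane → ℝ}
    (hρ : IsMollifier Cm ε ρ) {x : Plane} (hx : Metric.closedBall x ε ⊆ O)
    (hexp : ∀ y, dist y x ≤ ε →
      |F₁ y - F₁ x - lam x * (a x * (pd 0 u y - pd 0 u x) + b x * (pd 1 u y - pd 1 u x))|
        ≤ lam x * (C * gnorm u x * dist y x + ε' * gosc u y x) ∧
      |F₂ y - F₂ x - lam x * (b x * (pd 0 u y - pd 0 u x) + d x * (pd 1 u y - pd 1 u x))|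
        ≤ lam x * (C * gnorm u x * dist y x + ε' * gosc u y x)) :
    |a x * pd 0 (pd 0 (mol ρ u)) x + b x * pd 0 (pd 1 (mol ρ u)) x
      + b x * pd 1 (pd 0 (mol ρ u)) x + d x * pd 1 (pd 1 (mol ρ u)) x|
      ≤ 2 * Cm * C * gnorm u x + ε' * oscAvg ρ u x := by
  have hlam : 0 < lam x := h.lam_pos x (hx (Metric.mem_closedBall_self hε.le))
  have h1 := hρ.contDiff_one
  obtain ⟨i1, i2, hz⟩ := h.integral_flux_mollifier hρ hx
  have hv : ∀ i j, Integrable fun t => pd j ρ t * (pd i u (x - t) - pd i u x) := fun i j => by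
    have hcont : Continuous fun t => pd i u (x - t) - pd i u x :=
      ((h.contDiff.continuous_pd (i := i)).comp (by fun_prop : Continuous fun t => x - t)).sub
        continuous_const
    exact (h1.continuous_pd.mul hcont).integrable_of_hasCompactSupport hρ.compact.pd.mul_right
  have hT : a x * pd 0 (pd 0 (mol ρ u)) x + b x * pd 0 (pd 1 (mol ρ u)) x
      + b x * pd 1 (pd 0 (mol ρ u)) x + d x * pd 1 (pd 1 (mol ρ u)) x
      = ∫ t, (a x * (pd 0 ρ t * (pd 0 u (x - t) - pd 0 u x))
        + b x * (pd 0 ρ t * (pd 1 u (x - t) - pd 1 u x))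
        + b x * (pd 1 ρ t * (pd 0 u (x - t) - pd 0 u x))
        + d x * (pd 1 ρ t * (pd 1 u (x - t) - pd 1 u x))) := by
    rw [integral_add, integral_add, integral_add]
    · simp only [integral_const_mul, ← pd_pd_mol_eq hρ h.contDiff hc]
    all_goals fun_prop
  have hTi : Integrable fun t => (a x * (pd 0 ρ t * (pd 0 u (x - t) - pd 0 u x))
        + b x * (pd 0 ρ t * (pd 1 u (x - t) - pd 1 u x))
        + b x * (pd 1 ρ t * (pd 0 u (x - t) - pd 0 u x))
        + d x * (pd 1 ρ t * (pd 1 u (x - t) - pd 1 u x))) := by fun_prop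
  have hg : Continuous fun t => gosc u (x - t) x :=
    (continuous_gosc h.contDiff).comp (f := fun t : Plane => (x - t, x)) (by fun_prop)
  have hk0 : Integrable (gnorm ρ) := by
    simpa using hρ.integrable_gnorm (continuous_const (y := (1 : ℝ)))
  have hk1 := hρ.integrable_gnorm hg
  have hpt : ∀ t, ‖((F₁ (x - t) - F₁ x) * pd 0 ρ t + (F₂ (x - t) - F₂ x) * pd 1 ρ t)
      - lam x * (a x * (pd 0 ρ t * (pd 0 u (x - t) - pd 0 u x))
        + b x * (pd 0 ρ t * (pd 1 u (x - t) - pd 1 u x))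
        + b x * (pd 1 ρ t * (pd 0 u (x - t) - pd 0 u x))
        + d x * (pd 1 ρ t * (pd 1 u (x - t) - pd 1 u x)))‖
      ≤ lam x * (C * gnorm u x * ε * gnorm ρ t + ε' * (gnorm ρ t * gosc u (x - t) x)) := by
    intro t
    by_cases ht : ε < ‖t‖
    · simp [gnorm, hρ.pd_eq_zero _ ht]
    · rw [not_lt] at ht
      have hdist : dist (x - t) x = ‖t‖ := by simp
      obtain ⟨e1, e2⟩ := hexp (x - t) (by rwa [hdist])
      rw [hdist] at e1 e2
      have hle : lam x * (C * gnorm u x * ‖t‖ + ε' * gosc u (x - t) x)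
          ≤ lam x * (C * gnorm u x * ε + ε' * gosc u (x - t) x) := by
        have := mul_nonneg h.C_nonneg (gnorm_nonneg u x)
        gcongr
      rw [Real.norm_eq_abs]
      calc _ = |(F₁ (x - t) - F₁ x
              - lam x * (a x * (pd 0 u (x - t) - pd 0 u x) + b x * (pd 1 u (x - t) - pd 1 u x)))
              * pd 0 ρ t
            + (F₂ (x - t) - F₂ x
              - lam x * (b x * (pd 0 u (x - t) - pd 0 u x) + d x * (pd 1 u (x - t) - pd 1 u x)))
              * pd 1 ρ t| := by congr 1; ring
        _ ≤ _ := abs_add_le _ _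
        _ ≤ lam x * (C * gnorm u x * ε + ε' * gosc u (x - t) x) * |pd 0 ρ t|
            + lam x * (C * gnorm u x * ε + ε' * gosc u (x - t) x) * |pd 1 ρ t| := by
            rw [abs_mul, abs_mul]
            exact add_le_add (mul_le_mul_of_nonneg_right (e1.trans hle) (abs_nonneg _))
              (mul_le_mul_of_nonneg_right (e2.trans hle) (abs_nonneg _))
        _ = _ := by simp only [gnorm]; ring
  have i12 : Integrable fun t => (F₁ (x - t) - F₁ x) * pd 0 ρ t + (F₂ (x - t) - F₂ x) * pd 1 ρ t :=
    i1.add i2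
  have hk01 : Integrable fun t =>
      C * gnorm u x * ε * gnorm ρ t + ε' * (gnorm ρ t * gosc u (x - t) x) :=
    (hk0.const_mul _).add (hk1.const_mul _)
  have hbound := norm_integral_le_of_norm_le (hk01.const_mul (lam x)) (ae_of_all _ hpt)
  rw [integral_sub i12 (hTi.const_mul _), integral_const_mul, ← hT, hz, zero_sub, norm_neg,
    integral_const_mul, integral_add (hk0.const_mul _) (hk1.const_mul _), integral_const_mul,
    integral_const_mul, norm_mul, Real.norm_of_nonneg hlam.le, Real.norm_eq_abs] at hbound
  have hb := le_of_mul_le_mul_left hbound hlam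
  refine hb.trans ?_
  have h3 : C * gnorm u x * ε * ∫ t, gnorm ρ t ≤ C * gnorm u x * ε * (2 * Cm / ε) := by
    have := mul_nonneg h.C_nonneg (gnorm_nonneg u x)
    have := hρ.integral_gnorm_le
    gcongr
  have h4 : C * gnorm u x * ε * (2 * Cm / ε) = 2 * Cm * C * gnorm u x := by field_simp
  rw [h4] at h3
  unfold oscAvg
  linarith

lemma IsEllipticFlux.exists_residual_bound {O K : Set Plane} {u F₁ F₂ lam a b d : Plane → ℝ}
    {μ C : ℝ} (h : IsEllipticFlux O u F₁ F₂ lam a b d μ C) (hc : HasCompactSupport u)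
    {Cm : ℝ} (hCm : 0 ≤ Cm) (hK : IsCompact K) (hKO : K ⊆ O) :
    ∃ CK, 0 ≤ CK ∧ ∀ ε' > 0, ∃ ε₀ > 0, ∀ ε, 0 < ε → ε < ε₀ → ∀ ρ, IsMollifier Cm ε ρ →
      ∫⁻ x in K, ENNReal.ofReal (oscAvg ρ u x ^ 2) ≤ ENNReal.ofReal CK ∧
      ∀ x ∈ K, |a x * pd 0 (pd 0 (mol ρ u)) x + b x * pd 0 (pd 1 (mol ρ u)) x
        + b x * pd 1 (pd 0 (mol ρ u)) x + d x * pd 1 (pd 1 (mol ρ u)) x|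
        ≤ 2 * Cm * C * gnorm u x + ε' * oscAvg ρ u x := by
  obtain ⟨s, hs, C₁, hC₁, hb⟩ := h.gosc_bound hK hKO
  obtain ⟨s₁, hs₁, hthick⟩ := hK.exists_cthickening_subset_open h.isOpen hKO
  refine ⟨4 * Cm ^ 2 * C₁, by positivity, fun ε' hε' => ?_⟩
  obtain ⟨s₂, hs₂, hexp⟩ := h.expansion K hKO hK ε' hε'
  refine ⟨min s (min s₁ s₂), by positivity, fun ε hε hlt ρ hρ => ⟨?_, fun x hx => ?_⟩⟩
  · exact lintegral_oscAvg_sq_le h.contDiff hCm hC₁ hb hε (hlt.trans_le (min_le_left _ _)) hρ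
  · refine h.abs_residual_le hc hε hρ (fun y hy => hthick ?_) fun y hy => hexp x hx y ?_
    · exact Metric.mem_cthickening_of_dist_le y x _ K hx
        (hy.trans (hlt.le.trans ((min_le_right _ _).trans (min_le_left _ _))))
    · exact hy.trans_lt (hlt.trans_le ((min_le_right _ _).trans (min_le_right _ _)))

lemma contDiff_one_comp {k k' : ℝ → ℝ} {I : Set ℝ} {r : Plane → ℝ}
    (hk : ∀ t ∈ I, HasDerivAt k (k' t) t) (hk' : ContinuousOn k' I) (hr : ContDiff ℝ 1 r)
    (hrI : ∀ x, r x ∈ I) : ContDiff ℝ 1 fun x => k (r x) := by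
  have hd : ∀ x, HasFDerivAt (fun x => k (r x)) (k' (r x) • fderiv ℝ r x) x := fun x =>
    (hk _ (hrI x)).comp_hasFDerivAt x (hr.contDiffAt.differentiableAt (by simp)).hasFDerivAt
  rw [contDiff_one_iff_fderiv]
  refine ⟨fun x => (hd x).differentiableAt, ?_⟩
  rw [show fderiv ℝ (fun x => k (r x)) = fun x => k' (r x) • fderiv ℝ r x from
    funext fun x => (hd x).fderiv]
  exact (hk'.comp_continuous hr.continuous hrI).smul (hr.continuous_fderiv (by simp))

/-- The squared length of the gradient. -/
noncomputable def gsq (w : Plane → ℝ) (x : Plane) : ℝ := pd 0 w x ^ 2 + pd 1 w x ^ 2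

/-- The squared length of the Hessian. -/
noncomputable def hsq (w : Plane → ℝ) (x : Plane) : ℝ :=
  pd 0 (pd 0 w) x ^ 2 + 2 * pd 1 (pd 0 w) x ^ 2 + pd 1 (pd 1 w) x ^ 2

/-- The determinant of the Hessian. -/
noncomputable def hdet (w : Plane → ℝ) (x : Plane) : ℝ :=
  pd 0 (pd 0 w) x * pd 1 (pd 1 w) x - pd 1 (pd 0 w) x ^ 2

lemma gsq_nonneg (w : Plane → ℝ) (x : Plane) : 0 ≤ gsq w x := by unfold gsq; positivity

lemma hsq_nonneg (w : Plane → ℝ) (x : Plane) : 0 ≤ hsq w x := by unfold hsq; positivity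

lemma _root_.ContDiff.pd_two {f : Plane → ℝ} {i : Fin 2} (hf : ContDiff ℝ 3 f) :
    ContDiff ℝ 2 (pd i f) :=
  (hf.fderiv_right (m := 2) (by norm_num)).clm_apply contDiff_const

lemma contDiff_gsq {w : Plane → ℝ} (hw : ContDiff ℝ 2 w) : ContDiff ℝ 1 (gsq w) :=
  (hw.pd_one.pow 2).add (hw.pd_one.pow 2)

lemma pd_gsq {w : Plane → ℝ} (hw : ContDiff ℝ 2 w) (i : Fin 2) (x : Plane) :
    pd i (gsq w) x = 2 * (pd 0 w x * pd i (pd 0 w) x + pd 1 w x * pd i (pd 1 w) x) := by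
  have hd : ∀ j, DifferentiableAt ℝ (pd j w) x := fun j =>
    (hw.pd_one (i := j)).contDiffAt.differentiableAt (by simp)
  unfold gsq
  rw [pd_add (f := fun y => pd 0 w y ^ 2) (g := fun y => pd 1 w y ^ 2) ((hd 0).pow 2)
    ((hd 1).pow 2), pd_sq (hd 0), pd_sq (hd 1)]
  ring

lemma jac_mul {f g h : Plane → ℝ} {x : Plane} (hf : DifferentiableAt ℝ f x)
    (hg : DifferentiableAt ℝ g x) :
    jac (fun y => f y * g y) h x = f x * jac g h x + g x * jac f h x := by
  unfold jac
  rw [pd_mul hf hg, pd_mul hf hg]; ring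

lemma continuous_jac {f g : Plane → ℝ} (hf : ContDiff ℝ 1 f) (hg : ContDiff ℝ 1 g) :
    Continuous (jac f g) :=
  (hf.continuous_pd.mul hg.continuous_pd).sub (hf.continuous_pd.mul hg.continuous_pd)

/-- The integrand of the divergence identity for the Hessian determinant. -/
noncomputable def detForm (K K' : ℝ → ℝ) (η w : Plane → ℝ) (x : Plane) : ℝ :=
  2 * η x ^ 2 * (K (gsq w x) + gsq w x * K' (gsq w x)) * hdet w x
    + 2 * η x * K (gsq w x) * (pd 0 w x * jac η (pd 1 w) x - pd 1 w x * jac η (pd 0 w) x)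

lemma integral_detForm {K K' : ℝ → ℝ} {R₀ : ℝ} {η w : Plane → ℝ} (hw : ContDiff ℝ 3 w)
    (hK : ∀ t ∈ Set.Icc 0 R₀, HasDerivAt K (K' t) t) (hK' : ContinuousOn K' (Set.Icc 0 R₀))
    (hr : ∀ x, gsq w x ≤ R₀) (hη : ContDiff ℝ 1 η) (hc : HasCompactSupport η) :
    Integrable (detForm K K' η w) ∧ ∫ x, detForm K K' η w x = 0 := by
  have hw2 : ContDiff ℝ 2 w := hw.of_le (by norm_num)
  have hrI : ∀ x, gsq w x ∈ Set.Icc 0 R₀ := fun x => ⟨gsq_nonneg w x, hr x⟩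
  have hg := contDiff_gsq hw2
  have hKr : ContDiff ℝ 1 fun x => K (gsq w x) := contDiff_one_comp hK hK' hg hrI
  have hηK : ContDiff ℝ 1 fun x => η x ^ 2 * K (gsq w x) := (hη.pow 2).mul hKr
  have hd : ∀ {f : Plane → ℝ}, ContDiff ℝ 1 f → ∀ x, DifferentiableAt ℝ f x := fun hf x =>
    hf.contDiffAt.differentiableAt (by simp)
  have hη2c : HasCompactSupport fun x => η x ^ 2 := by
    simp only [pow_two]
    exact hc.mul_right
  have hcc : ∀ j, HasCompactSupport fun x => η x ^ 2 * K (gsq w x) * pd j w x := fun j =>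
    hη2c.mul_right.mul_right
  have hC1 : ∀ j, ContDiff ℝ 1 fun x => η x ^ 2 * K (gsq w x) * pd j w x := fun j =>
    hηK.mul hw2.pd_one
  have hji : ∀ i j, Integrable (jac (fun x => η x ^ 2 * K (gsq w x) * pd j w x) (pd i w)) :=
    fun i j => by
      refine (continuous_jac (hC1 j) hw2.pd_one).integrable_of_hasCompactSupport ?_
      exact HasCompactSupport.sub (hcc j).pd.mul_right (hcc j).pd.mul_right
  have hj0 : ∀ i j, ∫ x, jac (fun x => η x ^ 2 * K (gsq w x) * pd j w x) (pd i w) x = 0 :=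
    fun i j => integral_jac_eq_zero (hC1 j) hw.pd_two (hcc j)
  have hJ : ∀ i j x, jac (fun x => η x ^ 2 * K (gsq w x) * pd j w x) (pd i w) x
      = η x ^ 2 * K (gsq w x) * jac (pd j w) (pd i w) x + pd j w x * (η x ^ 2 *
        (K' (gsq w x) * jac (gsq w) (pd i w) x)
        + K (gsq w x) * (2 * η x * jac η (pd i w) x)) := fun i j x => by
    rw [jac_mul (f := fun x => η x ^ 2 * K (gsq w x)) (hd hηK x) (hd hw2.pd_one x),
      jac_mul (f := fun x => η x ^ 2) (g := fun x => K (gsq w x)) (hd (hη.pow 2) x) (hd hKr x)]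
    have e1 : jac (fun x => K (gsq w x)) (pd i w) x
        = K' (gsq w x) * jac (gsq w) (pd i w) x := by
      unfold jac
      rw [pd_comp (hK _ (hrI x)) (hd hg x), pd_comp (hK _ (hrI x)) (hd hg x)]; ring
    have e2 : jac (fun x => η x ^ 2) (pd i w) x = 2 * η x * jac η (pd i w) x := by
      unfold jac
      rw [pd_sq (hd hη x), pd_sq (hd hη x)]; ring
    rw [e1, e2]
  have e : detForm K K' η w = fun x =>
      jac (fun x => η x ^ 2 * K (gsq w x) * pd 0 w x) (pd 1 w) x
        - jac (fun x => η x ^ 2 * K (gsq w x) * pd 1 w x) (pd 0 w) x := by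
    ext x
    rw [hJ, hJ, detForm, hdet]
    have hs := pd_symm hw2 (x := x)
    have j1 : jac (gsq w) (pd 1 w) x = 2 * pd 0 w x * hdet w x := by
      unfold jac hdet; rw [pd_gsq hw2, pd_gsq hw2, hs]; ring
    have j2 : jac (gsq w) (pd 0 w) x = -(2 * pd 1 w x * hdet w x) := by
      unfold jac hdet; rw [pd_gsq hw2, pd_gsq hw2, hs]; ring
    have j3 : jac (pd 0 w) (pd 1 w) x = hdet w x := by unfold jac hdet; rw [hs]; ring
    have j4 : jac (pd 1 w) (pd 0 w) x = -hdet w x := by unfold jac hdet; rw [hs]; ring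
    rw [j1, j2, j3, j4]
    unfold hdet gsq
    ring
  rw [e]
  refine ⟨(hji 1 0).sub (hji 0 1), ?_⟩
  rw [integral_sub (hji 1 0) (hji 0 1), hj0, hj0, sub_zero]

/-- For a symmetric matrix `S` with `tr (M S)` small, the determinant of `S` is negative. -/
lemma neg_det_lower_bound {μ C a b d s₁ s₂ s₃ τ : ℝ} (hμ : 0 < μ) (ha : |a| ≤ C) (hd : |d| ≤ C)
    (hell : ∀ s t : ℝ, μ * (s ^ 2 + t ^ 2) ≤ a * s ^ 2 + 2 * b * s * t + d * t ^ 2)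
    (hτ : a * s₁ + 2 * b * s₂ + d * s₃ = τ) :
    μ / (4 * C) * (s₁ ^ 2 + 2 * s₂ ^ 2 + s₃ ^ 2) ≤ -(s₁ * s₃ - s₂ ^ 2) + τ ^ 2 / (2 * μ ^ 2) := by
  have ha1 : μ ≤ a := by have := hell 1 0; linarith
  have hd1 : μ ≤ d := by have := hell 0 1; linarith
  have ha2 := (abs_le.1 ha).2
  have hd2 := (abs_le.1 hd).2
  have hy : ∀ s, τ * s ≤ μ / 2 * s ^ 2 + τ ^ 2 / (2 * μ) := fun s => by
    have e : μ / 2 * s ^ 2 + τ ^ 2 / (2 * μ) - τ * s = (μ * s - τ) ^ 2 / (2 * μ) := by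
      field_simp; ring
    have : 0 ≤ (μ * s - τ) ^ 2 / (2 * μ) := by positivity
    linarith
  have e1 : (a + d) * -(s₁ * s₃ - s₂ ^ 2) = (a * s₁ ^ 2 + 2 * b * s₁ * s₂ + d * s₂ ^ 2)
      + (a * s₂ ^ 2 + 2 * b * s₂ * s₃ + d * s₃ ^ 2) - τ * s₁ - τ * s₃ := by rw [← hτ]; ring
  have hsum : μ / 2 * (s₁ ^ 2 + 2 * s₂ ^ 2 + s₃ ^ 2) - τ ^ 2 / μ
      ≤ (a + d) * -(s₁ * s₃ - s₂ ^ 2) := by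
    have h1 := hell s₁ s₂
    have h2 := hell s₂ s₃
    have h3 := hy s₁
    have h4 := hy s₃
    have h5 : τ ^ 2 / μ = τ ^ 2 / (2 * μ) + τ ^ 2 / (2 * μ) := by field_simp; ring
    have h6 : 0 ≤ μ * s₂ ^ 2 := by positivity
    rw [e1, h5]
    linarith
  generalize -(s₁ * s₃ - s₂ ^ 2) = D at hsum ⊢
  have hS : 0 ≤ s₁ ^ 2 + 2 * s₂ ^ 2 + s₃ ^ 2 := by positivity
  generalize s₁ ^ 2 + 2 * s₂ ^ 2 + s₃ ^ 2 = S at hsum hS ⊢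
  have hT : 0 ≤ τ ^ 2 := sq_nonneg _
  generalize τ ^ 2 = T at hsum hT ⊢
  have had : 0 < a + d := by linarith
  have hC : 0 < C := by linarith
  rw [← mul_le_mul_iff_of_pos_left had]
  have h7 : (a + d) * (μ / (4 * C) * S) ≤ μ / 2 * S := by
    have : (2 * C) * (μ / (4 * C) * S) = μ / 2 * S := by field_simp; ring
    rw [← this]
    have : a + d ≤ 2 * C := by linarith
    gcongr
  have h8 : T / μ ≤ (a + d) * (T / (2 * μ ^ 2)) := by
    have : (2 * μ) * (T / (2 * μ ^ 2)) = T / μ := by field_simp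
    rw [← this]
    have : 2 * μ ≤ a + d := by linarith
    gcongr
  linarith

lemma cross_term_sq_le {w₁ w₂ s₁ s₂ s₃ e₁ e₂ G : ℝ} (h₁ : |e₁| ≤ G) (h₂ : |e₂| ≤ G) :
    (w₁ * (e₁ * s₃ - e₂ * s₂) - w₂ * (e₁ * s₂ - e₂ * s₁)) ^ 2
      ≤ 4 * G ^ 2 * ((w₁ ^ 2 + w₂ ^ 2) * (s₁ ^ 2 + 2 * s₂ ^ 2 + s₃ ^ 2)) := by
  have hE : e₁ ^ 2 + e₂ ^ 2 ≤ 2 * G ^ 2 := by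
    have h1 := sq_le_sq' (abs_le.1 h₁).1 (abs_le.1 h₁).2
    have h2 := sq_le_sq' (abs_le.1 h₂).1 (abs_le.1 h₂).2
    linarith
  have hX : (w₁ * (e₁ * s₃ - e₂ * s₂) - w₂ * (e₁ * s₂ - e₂ * s₁)) ^ 2
      ≤ (w₁ ^ 2 + w₂ ^ 2) * ((e₁ * s₃ - e₂ * s₂) ^ 2 + (e₁ * s₂ - e₂ * s₁) ^ 2) := by
    linarith [sq_nonneg (w₁ * (e₁ * s₂ - e₂ * s₁) + w₂ * (e₁ * s₃ - e₂ * s₂))]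
  have hY : (e₁ * s₃ - e₂ * s₂) ^ 2 + (e₁ * s₂ - e₂ * s₁) ^ 2
      ≤ (e₁ ^ 2 + e₂ ^ 2) * (s₁ ^ 2 + 2 * s₂ ^ 2 + s₃ ^ 2) := by
    linarith [sq_nonneg (e₁ * s₂ + e₂ * s₃), sq_nonneg (e₁ * s₁ + e₂ * s₂)]
  have hS : 0 ≤ s₁ ^ 2 + 2 * s₂ ^ 2 + s₃ ^ 2 := by positivity
  have hZ := mul_le_mul_of_nonneg_right hE hS
  have hW : 0 ≤ w₁ ^ 2 + w₂ ^ 2 := by positivity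
  have h3 := mul_le_mul_of_nonneg_left (hY.trans hZ) hW
  have h4 : 0 ≤ G ^ 2 * ((w₁ ^ 2 + w₂ ^ 2) * (s₁ ^ 2 + 2 * s₂ ^ 2 + s₃ ^ 2)) := by positivity
  linarith

/-- The weighted Hessian energy density. -/
noncomputable def energy (K K' : ℝ → ℝ) (η w : Plane → ℝ) (x : Plane) : ℝ :=
  η x ^ 2 * (K (gsq w x) + gsq w x * K' (gsq w x)) * hsq w x

lemma energy_le {R₀ r₀ N δ : ℝ} {K K' Ψ Ψ' : ℝ → ℝ} (hP : IsProfile R₀ r₀ N δ K K' Ψ Ψ')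
    {η w : Plane → ℝ} {x : Plane} (hw : ContDiff ℝ 2 w) (hr : gsq w x ≤ R₀) (hδ : 0 < δ)
    (hη0 : 0 ≤ η x) (hη1 : η x ≤ 1) {G c T₁ T₂ e : ℝ} (hG : ∀ i, |pd i η x| ≤ G) (hc : 0 < c)
    (hT₁ : 0 ≤ T₁) (hT₂ : 0 ≤ T₂) (he : 0 ≤ e)
    (hdet : δ < gsq w x → c * hsq w x ≤ -hdet w x + T₁ * gsq w x + T₂ * e) :
    c * energy K K' η w x + detForm K K' η w x ≤ 4 * G ^ 2 / c + 2 * T₁ + 2 * T₂ / δ * e := by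
  have hrI : gsq w x ∈ Set.Icc 0 R₀ := ⟨gsq_nonneg w x, hr⟩
  have hKsq := hP.mul_K_sq_le _ hrI
  have hkr := hP.mul_deriv_le _ hrI
  have hnn : 0 ≤ 4 * G ^ 2 / c + 2 * T₁ + 2 * T₂ / δ * e := by positivity
  rcases le_or_gt (gsq w x) δ with hle | hlt
  · simpa [energy, detForm, hP.K_eq_zero _ hle, hP.K'_eq_zero _ hle] using hnn
  have hdet := hdet hlt
  have hr0 := gsq_nonneg w x
  have hs0 := hsq_nonneg w x
  have hcross := cross_term_sq_le (w₁ := pd 0 w x) (w₂ := pd 1 w x) (s₁ := pd 0 (pd 0 w) x)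
    (s₂ := pd 1 (pd 0 w) x) (s₃ := pd 1 (pd 1 w) x) (hG 0) (hG 1)
  have hX : pd 0 w x * jac η (pd 1 w) x - pd 1 w x * jac η (pd 0 w) x
      = pd 0 w x * (pd 0 η x * pd 1 (pd 1 w) x - pd 1 η x * pd 1 (pd 0 w) x)
        - pd 1 w x * (pd 0 η x * pd 1 (pd 0 w) x - pd 1 η x * pd 0 (pd 0 w) x) := by
    unfold jac; rw [pd_symm hw]
  rw [← hX] at hcross
  change _ ≤ 4 * G ^ 2 * (gsq w x * hsq w x) at hcross
  unfold energy detForm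
  generalize pd 0 w x * jac η (pd 1 w) x - pd 1 w x * jac η (pd 0 w) x = X at hcross
  generalize gsq w x = r at *
  generalize hsq w x = S at *
  generalize PlanarUCP.hdet w x = D at *
  generalize η x = n at *
  generalize K r = k at *
  generalize k + r * K' r = m at *
  have hm0 : 0 ≤ m := le_trans (by positivity) hKsq
  have hn2 : n ^ 2 ≤ 1 := pow_le_one₀ hη0 hη1
  have hmδ : m ≤ 1 / δ := by
    rw [le_div_iff₀ hδ]
    nlinarith
  have h1 : (2 * n * k * X) ^ 2 ≤ 16 * G ^ 2 * (n ^ 2 * m * S) := by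
    calc (2 * n * k * X) ^ 2 = 4 * n ^ 2 * k ^ 2 * X ^ 2 := by ring
      _ ≤ 4 * n ^ 2 * k ^ 2 * (4 * G ^ 2 * (r * S)) := by gcongr
      _ = 16 * G ^ 2 * n ^ 2 * S * (r * k ^ 2) := by ring
      _ ≤ 16 * G ^ 2 * n ^ 2 * S * m := by gcongr
      _ = _ := by ring
  have h2 : 2 * n * k * X ≤ c * (n ^ 2 * m * S) + 4 * G ^ 2 / c := by
    refine abs_le_of_sq_le_sq' (h1.trans ?_) (by positivity) |>.2
    have e2 : c * (4 * G ^ 2 / c) = 4 * G ^ 2 := by field_simp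
    have := four_mul_le_sq_add (c * (n ^ 2 * m * S)) (4 * G ^ 2 / c)
    have e3 : 4 * (c * (n ^ 2 * m * S)) * (4 * G ^ 2 / c)
        = 4 * (c * (4 * G ^ 2 / c)) * (n ^ 2 * m * S) := by
      ring
    rw [e3, e2] at this
    linarith
  have hnm : 0 ≤ n ^ 2 * m := by positivity
  have h3 := mul_le_mul_of_nonneg_left hdet hnm
  have h4 : n ^ 2 * m * (T₁ * r) ≤ T₁ := by
    have e4 : n ^ 2 * m * (T₁ * r) = T₁ * (n ^ 2 * (r * m)) := by ring
    rw [e4]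
    have : n ^ 2 * (r * m) ≤ 1 := mul_le_one₀ hn2 (by positivity) hkr
    exact mul_le_of_le_one_right hT₁ this
  have h5 : n ^ 2 * m * (T₂ * e) ≤ T₂ / δ * e := by
    calc n ^ 2 * m * (T₂ * e) ≤ 1 * (1 / δ) * (T₂ * e) := by gcongr
      _ = T₂ / δ * e := by ring
  have e5 : 2 * T₂ / δ * e = 2 * (T₂ / δ * e) := by ring
  rw [e5]
  have h6 : 0 ≤ c * (n ^ 2 * m * S) := by positivity
  linarith

lemma integral_energy_le {R₀ r₀ N δ : ℝ} {K K' Ψ Ψ' : ℝ → ℝ}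
    (hP : IsProfile R₀ r₀ N δ K K' Ψ Ψ')
    {η w E : Plane → ℝ} {B Kc : Set Plane} (hw : ContDiff ℝ 3 w) (hr : ∀ x, gsq w x ≤ R₀)
    (hδ : 0 < δ) (hη : ContDiff ℝ 1 η) (hηc : HasCompactSupport η) (hηB : tsupport η ⊆ B)
    (hB : IsCompact B)
    (hη0 : ∀ x, 0 ≤ η x) (hη1 : ∀ x, η x ≤ 1) {G c T₁ T₂ Q : ℝ} (hG : ∀ i x, |pd i η x| ≤ G)
    (hc : 0 < c) (hT₁ : 0 ≤ T₁) (hT₂ : 0 ≤ T₂) (hQ : 0 ≤ Q) (hE : Continuous E)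
    (hKc : IsCompact Kc) (hEQ : ∫⁻ x in Kc, ENNReal.ofReal (E x ^ 2) ≤ ENNReal.ofReal Q)
    (hdet : ∀ x ∈ B, δ < gsq w x → x ∈ Kc ∧
      c * hsq w x ≤ -hdet w x + T₁ * gsq w x + T₂ * E x ^ 2) :
    Integrable (energy K K' η w) ∧
    c * ∫ x, energy K K' η w x
      ≤ (4 * G ^ 2 / c + 2 * T₁) * volume.real B + 2 * T₂ / δ * Q := by
  have hw2 : ContDiff ℝ 2 w := hw.of_le (by norm_num)
  obtain ⟨hDi, hD0⟩ := integral_detForm hw hP.hasDerivAt_K hP.continuousOn_K' hr hη hηc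
  have hrI : ∀ x, gsq w x ∈ Set.Icc 0 R₀ := fun x => ⟨gsq_nonneg w x, hr x⟩
  have hgc := (contDiff_gsq hw2).continuous
  have hKcont : ContinuousOn K (Set.Icc 0 R₀) := fun t ht =>
    (hP.hasDerivAt_K t ht).continuousAt.continuousWithinAt
  have hhc : Continuous (hsq w) := by
    have h := fun i j => (hw2.pd_one (i := i)).continuous_pd (i := j)
    exact (((h 0 0).pow 2).add (((h 0 1).pow 2).const_mul 2)).add ((h 1 1).pow 2)
  have hec : Continuous (energy K K' η w) :=
    ((hη.continuous.pow 2).mul ((hKcont.comp_continuous hgc hrI).add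
      (hgc.mul (hP.continuousOn_K'.comp_continuous hgc hrI)))).mul hhc
  have hei : Integrable (energy K K' η w) := by
    refine hec.integrable_of_hasCompactSupport (hηc.mono fun x hx => ?_)
    contrapose! hx
    simp only [Function.mem_support, ne_eq, not_not] at hx ⊢
    simp [energy, hx]
  refine ⟨hei, ?_⟩
  have hE2 : IntegrableOn (fun x => E x ^ 2) Kc := (hE.pow 2).continuousOn.integrableOn_compact hKc
  have hE2Q : ∫ x in Kc, E x ^ 2 ≤ Q := by
    rw [← ENNReal.ofReal_le_ofReal_iff hQ, ofReal_integral_eq_lintegral_ofReal hE2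
      (ae_of_all _ fun x => sq_nonneg _)]
    exact hEQ
  have hi1 : Integrable (B.indicator fun _ => 4 * G ^ 2 / c + 2 * T₁) :=
    (integrable_indicator_iff hB.measurableSet).2 (integrableOn_const hB.measure_ne_top)
  have hi2 : Integrable fun x => 2 * T₂ / δ * Kc.indicator (fun x => E x ^ 2) x :=
    ((integrable_indicator_iff hKc.measurableSet).2 hE2).const_mul _
  have hpt : ∀ x, c * energy K K' η w x + detForm K K' η w x
      ≤ B.indicator (fun _ => 4 * G ^ 2 / c + 2 * T₁) x
        + 2 * T₂ / δ * Kc.indicator (fun x => E x ^ 2) x := fun x => by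
    have hnn : 0 ≤ Kc.indicator (fun x => E x ^ 2) x :=
      Set.indicator_nonneg (fun _ _ => sq_nonneg _) x
    by_cases hx : x ∈ B
    · rw [Set.indicator_of_mem hx]
      refine energy_le hP hw2 (hr x) hδ (hη0 x) (hη1 x) (fun i => hG i x) hc hT₁ hT₂ hnn
        fun hlt => ?_
      obtain ⟨hxK, hb⟩ := hdet x hx hlt
      rwa [Set.indicator_of_mem hxK]
    · rw [Set.indicator_of_notMem hx]
      have h0 : η x = 0 := image_eq_zero_of_notMem_tsupport fun h' => hx (hηB h')
      have : 0 ≤ 2 * T₂ / δ := by positivity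
      simp only [energy, detForm, h0]
      have := mul_nonneg this hnn
      simpa using this
  have hmono := integral_mono ((hei.const_mul c).add hDi) (hi1.add hi2) hpt
  simp only [Pi.add_apply] at hmono
  rw [integral_add (hei.const_mul c) hDi, integral_add hi1 hi2, hD0, add_zero, integral_const_mul,
    integral_const_mul, integral_indicator hB.measurableSet, integral_indicator hKc.measurableSet,
    setIntegral_const, smul_eq_mul] at hmono
  have : 2 * T₂ / δ * ∫ x in Kc, E x ^ 2 ≤ 2 * T₂ / δ * Q := by gcongr
  linarith

lemma continuous_oscAvg {Cm ε : ℝ} {ρ u : Plane → ℝ} (hρ : IsMollifier Cm ε ρ)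
    (hu : ContDiff ℝ 1 u) : Continuous (oscAvg ρ u) := by
  have hg2 : Continuous fun q : Plane × Plane => gosc u (q.1 - q.2) q.1 :=
    (continuous_gosc hu).comp (f := fun q : Plane × Plane => (q.1 - q.2, q.1)) (by fun_prop)
  have hk := continuous_gnorm hρ.contDiff_one
  have e : oscAvg ρ u = fun x => ∫ t in Metric.closedBall (0 : Plane) ε,
      gnorm ρ t * gosc u (x - t) x := by
    ext x
    rw [oscAvg, setIntegral_eq_integral_of_forall_compl_eq_zero]
    intro t ht
    have ht' : ε < ‖t‖ := by simpa using ht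
    simp [gnorm, hρ.pd_eq_zero _ ht']
  rw [e]
  exact continuous_parametric_integral_of_continuous
    (f := fun x t => gnorm ρ t * gosc u (x - t) x) ((hk.comp continuous_snd).mul hg2)
    (isCompact_closedBall _ _)

lemma exists_abs_pd_mol_sub_le {Cm : ℝ} {u : Plane → ℝ} (hu : ContDiff ℝ 1 u)
    (hc : HasCompactSupport u) {κ : ℝ} (hκ : 0 < κ) :
    ∃ ε₁ > 0, ∀ ε < ε₁, ∀ ρ, IsMollifier Cm ε ρ → ∀ i x,
      |pd i (mol ρ u) x - pd i u x| ≤ κ := by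
  have huc : ∀ i, UniformContinuous (pd i u) := fun i =>
    hc.pd.uniformContinuous_of_continuous hu.continuous_pd
  obtain ⟨a, ha, ha'⟩ := Metric.uniformContinuous_iff.1 (huc 0) κ hκ
  obtain ⟨b, hb, hb'⟩ := Metric.uniformContinuous_iff.1 (huc 1) κ hκ
  refine ⟨min a b, lt_min ha hb, fun ε hε ρ hρ i x => ?_⟩
  rw [pd_mol_right i hρ.contDiff.continuous hc hu]
  refine abs_mol_sub_le hρ hu.continuous_pd fun y hy => ?_
  rw [← Real.dist_eq]
  fin_cases i
  · exact (ha' (hy.trans_lt (hε.trans_le (min_le_left _ _)))).le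
  · exact (hb' (hy.trans_lt (hε.trans_le (min_le_right _ _)))).le

lemma gnorm_comp_gsq_le {R₀ r₀ N δ : ℝ} {K K' Ψ Ψ' : ℝ → ℝ}
    (hP : IsProfile R₀ r₀ N δ K K' Ψ Ψ') {w : Plane → ℝ} (hw : ContDiff ℝ 2 w) {x : Plane}
    (hr : gsq w x ≤ R₀) :
    gnorm (fun x => Ψ (gsq w x)) x
      ≤ 1 + 2 * ((K (gsq w x) + gsq w x * K' (gsq w x)) * hsq w x) := by
  have hrI : gsq w x ∈ Set.Icc 0 R₀ := ⟨gsq_nonneg w x, hr⟩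
  have hpd : ∀ i, pd i (fun x => Ψ (gsq w x)) x = Ψ' (gsq w x) *
      (2 * (pd 0 w x * pd i (pd 0 w) x + pd 1 w x * pd i (pd 1 w) x)) := fun i => by
    rw [pd_comp (hP.hasDerivAt_Ψ _ hrI) ((contDiff_gsq hw).contDiffAt.differentiableAt (by simp)),
      pd_gsq hw]
  have hm := mul_le_mul_of_nonneg_right (hP.mul_Ψ'_sq_le _ hrI) (hsq_nonneg w x)
  refine le_trans ?_ (add_le_add_right (mul_le_mul_of_nonneg_left hm zero_le_two) 1)
  rw [gnorm, hpd, hpd, pd_symm hw]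
  generalize Ψ' (gsq w x) = q
  unfold gsq hsq
  generalize pd 0 w x = w₁
  generalize pd 1 w x = w₂
  generalize pd 0 (pd 0 w) x = s₁
  generalize pd 1 (pd 0 w) x = s₂
  generalize pd 1 (pd 1 w) x = s₃
  have h1 : (w₁ * s₁ + w₂ * s₂) ^ 2 + (w₁ * s₂ + w₂ * s₃) ^ 2
      ≤ (w₁ ^ 2 + w₂ ^ 2) * (s₁ ^ 2 + 2 * s₂ ^ 2 + s₃ ^ 2) := by
    linarith [sq_nonneg (w₁ * s₂ - w₂ * s₁), sq_nonneg (w₁ * s₃ - w₂ * s₂)]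
  have h2 := mul_le_mul_of_nonneg_left h1 (sq_nonneg q)
  have hab : ∀ a : ℝ, |a| ≤ 1 / 2 + a ^ 2 / 2 := fun a => by
    rw [← sq_abs a]; linarith [sq_nonneg (|a| - 1)]
  have h3 := hab (q * (2 * (w₁ * s₁ + w₂ * s₂)))
  have h4 := hab (q * (2 * (w₁ * s₂ + w₂ * s₃)))
  linarith

/-- A difference of averages over two translated balls is controlled by the integral of the
gradient over a set containing all intermediate balls. -/
lemma mul_volume_ball_le {f : Plane → ℝ} (hf : ContDiff ℝ 1 f) {W : Set Plane}
    (hW : MeasurableSet W) {z y : Plane} {s N : ℝ}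
    (htube : ∀ t ∈ Set.Icc (0 : ℝ) 1, ∀ x ∈ Metric.ball z s, x + t • y ∈ W)
    (hN : ∀ x ∈ Metric.ball z s, N ≤ f (x + y) - f x) :
    ENNReal.ofReal N * volume (Metric.ball z s)
      ≤ ENNReal.ofReal ‖y‖ * ∫⁻ x in W, ENNReal.ofReal (gnorm f x) := by
  have hgc := continuous_gnorm hf
  have hpt : ∀ x ∈ Metric.ball z s, ENNReal.ofReal N
      ≤ ∫⁻ t in Set.Icc (0 : ℝ) 1, ENNReal.ofReal ‖y‖ * ENNReal.ofReal (gnorm f (x + t • y)) := by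
    intro x hx
    have hline : Continuous fun t : ℝ => x + t • y := by fun_prop
    have hd : ∀ t : ℝ, HasDerivAt (fun t : ℝ => f (x + t • y)) (fderiv ℝ f (x + t • y) y) t :=
      fun t => by
        have h1 : HasDerivAt (fun t : ℝ => x + t • y) y t := by
          simpa using ((hasDerivAt_id t).smul_const y).const_add x
        exact (hf.contDiffAt.differentiableAt (by simp)).hasFDerivAt.comp_hasDerivAt t h1
    have hcd : Continuous fun t : ℝ => fderiv ℝ f (x + t • y) y :=
      ((hf.continuous_fderiv (by simp)).comp hline).clm_apply continuous_const
    have hftc := intervalIntegral.integral_eq_sub_of_hasDerivAt (a := 0) (b := 1)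
      (fun t _ => hd t) (hcd.intervalIntegrable _ _)
    simp only [one_smul, zero_smul, add_zero] at hftc
    have hle : N ≤ ∫ t in Set.Icc (0 : ℝ) 1, ‖y‖ * gnorm f (x + t • y) := by
      refine (hN x hx).trans ?_
      rw [← hftc, intervalIntegral.integral_of_le zero_le_one, integral_Icc_eq_integral_Ioc]
      refine setIntegral_mono hcd.integrableOn_Ioc
        ((hgc.comp hline).const_mul _).integrableOn_Ioc fun t => ?_
      refine (le_abs_self _).trans ?_
      rw [← Real.norm_eq_abs, mul_comm]
      exact (ContinuousLinearMap.le_opNorm _ _).trans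
        (mul_le_mul_of_nonneg_right (norm_fderiv_le_gnorm _ _) (norm_nonneg _))
    refine (ENNReal.ofReal_le_ofReal hle).trans ?_
    have hintegrable : IntegrableOn (fun t : ℝ => ‖y‖ * gnorm f (x + t • y)) (Set.Icc 0 1) :=
      ((hgc.comp hline).const_mul _).continuousOn.integrableOn_Icc
    rw [ofReal_integral_eq_lintegral_ofReal hintegrable
      (ae_of_all _ fun t => mul_nonneg (norm_nonneg _) (gnorm_nonneg _ _))]
    simp only [ENNReal.ofReal_mul (norm_nonneg y)]
    exact le_rfl
  have hmeas : Measurable fun q : Plane × ℝ =>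
      ENNReal.ofReal ‖y‖ * ENNReal.ofReal (gnorm f (q.1 + q.2 • y)) :=
    ((hgc.comp (by fun_prop : Continuous fun q : Plane × ℝ =>
      q.1 + q.2 • y)).measurable.ennreal_ofReal).const_mul _
  calc ENNReal.ofReal N * volume (Metric.ball z s)
      = ∫⁻ _ in Metric.ball z s, ENNReal.ofReal N := by rw [setLIntegral_const]
    _ ≤ ∫⁻ x in Metric.ball z s, ∫⁻ t in Set.Icc (0 : ℝ) 1,
          ENNReal.ofReal ‖y‖ * ENNReal.ofReal (gnorm f (x + t • y)) :=
        setLIntegral_mono' Metric.isOpen_ball.measurableSet hpt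
    _ = ∫⁻ t in Set.Icc (0 : ℝ) 1, ∫⁻ x in Metric.ball z s,
          ENNReal.ofReal ‖y‖ * ENNReal.ofReal (gnorm f (x + t • y)) :=
        lintegral_lintegral_swap hmeas.aemeasurable
    _ ≤ ∫⁻ t in Set.Icc (0 : ℝ) 1, ENNReal.ofReal ‖y‖ *
          ∫⁻ x in W, ENNReal.ofReal (gnorm f x) := by
        refine setLIntegral_mono' measurableSet_Icc fun t ht => ?_
        rw [lintegral_const_mul' _ _ ENNReal.ofReal_ne_top]
        refine mul_le_mul_right ?_ _
        rw [← lintegral_indicator Metric.isOpen_ball.measurableSet, ← lintegral_indicator hW,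
          ← lintegral_add_right_eq_self (W.indicator _) (t • y)]
        refine lintegral_mono fun x => ?_
        by_cases hx : x ∈ Metric.ball z s
        · rw [Set.indicator_of_mem hx, Set.indicator_of_mem (htube t ht x hx)]
        · rw [Set.indicator_of_notMem hx]; exact zero_le
    _ = _ := by simp

lemma gsq_le_gnorm_sq (u : Plane → ℝ) (x : Plane) : gsq u x ≤ gnorm u x ^ 2 := by
  unfold gsq gnorm
  rw [← sq_abs (pd 0 u x), ← sq_abs (pd 1 u x)]
  linarith [mul_nonneg (abs_nonneg (pd 0 u x)) (abs_nonneg (pd 1 u x))]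

lemma gnorm_sq_le_gsq (u : Plane → ℝ) (x : Plane) : gnorm u x ^ 2 ≤ 2 * gsq u x := by
  unfold gsq gnorm
  rw [← sq_abs (pd 0 u x), ← sq_abs (pd 1 u x)]
  linarith [sq_nonneg (|pd 0 u x| - |pd 1 u x|)]

lemma gsq_le_of_close {u w : Plane → ℝ} {x : Plane} {κ : ℝ}
    (h : ∀ i, |pd i w x - pd i u x| ≤ κ) : gsq w x ≤ 2 * gsq u x + 4 * κ ^ 2 := by
  have h0 := sq_le_sq' (abs_le.1 (h 0)).1 (abs_le.1 (h 0)).2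
  have h1 := sq_le_sq' (abs_le.1 (h 1)).1 (abs_le.1 (h 1)).2
  unfold gsq
  linarith [sq_nonneg (pd 0 w x - 2 * pd 0 u x), sq_nonneg (pd 1 w x - 2 * pd 1 u x)]

/-- The Hessian of a mollification has controlled negative determinant wherever its gradient is
not too small. -/
lemma IsEllipticFlux.hessian_bound {O : Set Plane} {u F₁ F₂ lam a b d : Plane → ℝ}
    {μ C : ℝ} (h : IsEllipticFlux O u F₁ F₂ lam a b d μ C) {Cm ε' δ κ e : ℝ} {w : Plane → ℝ}
    (hw : ContDiff ℝ 2 w) {x : Plane} (hx : x ∈ O) (hκ : 8 * κ ^ 2 ≤ δ)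
    (hclose : ∀ i, |pd i w x - pd i u x| ≤ κ) (hδ : δ < gsq w x)
    (hres : |a x * pd 0 (pd 0 w) x + b x * pd 0 (pd 1 w) x
        + b x * pd 1 (pd 0 w) x + d x * pd 1 (pd 1 w) x| ≤ 2 * Cm * C * gnorm u x + ε' * e) :
    μ / (4 * C) * hsq w x
      ≤ -hdet w x + 24 * (Cm * C) ^ 2 / μ ^ 2 * gsq w x + ε' ^ 2 / μ ^ 2 * e ^ 2 := by
  have hμ := h.μ_pos
  have hτ := neg_det_lower_bound (s₁ := pd 0 (pd 0 w) x) (s₂ := pd 1 (pd 0 w) x)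
    (s₃ := pd 1 (pd 1 w) x) hμ (h.abs_a_le x hx) (h.abs_d_le x hx) (h.elliptic x hx) rfl
  rw [pd_symm hw] at hres
  have hu : gnorm u x ^ 2 ≤ 6 * gsq w x := by
    have h1 := gnorm_sq_le_gsq u x
    have h2 := gsq_le_of_close (u := w) (w := u) (fun i => by rw [abs_sub_comm]; exact hclose i)
    linarith [sq_nonneg κ]
  unfold hsq hdet
  refine hτ.trans ?_
  have hsq : (a x * pd 0 (pd 0 w) x + 2 * b x * pd 1 (pd 0 w) x + d x * pd 1 (pd 1 w) x) ^ 2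
      ≤ 48 * (Cm * C) ^ 2 * gsq w x + 2 * ε' ^ 2 * e ^ 2 := by
    have e1 : a x * pd 0 (pd 0 w) x + 2 * b x * pd 1 (pd 0 w) x + d x * pd 1 (pd 1 w) x
        = a x * pd 0 (pd 0 w) x + b x * pd 1 (pd 0 w) x
          + b x * pd 1 (pd 0 w) x + d x * pd 1 (pd 1 w) x := by ring
    rw [e1]
    have h3 := sq_le_sq' (abs_le.1 hres).1 (abs_le.1 hres).2
    have h4 := mul_le_mul_of_nonneg_left hu (by positivity : 0 ≤ 8 * (Cm * C) ^ 2)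
    linarith [sq_nonneg (2 * Cm * C * gnorm u x - ε' * e)]
  have h5 := div_le_div_of_nonneg_right hsq (by positivity : 0 ≤ 2 * μ ^ 2)
  have h6 : (48 * (Cm * C) ^ 2 * gsq w x + 2 * ε' ^ 2 * e ^ 2) / (2 * μ ^ 2)
      = 24 * (Cm * C) ^ 2 / μ ^ 2 * gsq w x + ε' ^ 2 / μ ^ 2 * e ^ 2 := by field_simp; ring
  rw [h6] at h5
  linarith

/-- Unique continuation across a ball for the gradient. -/
theorem IsEllipticFlux.gnorm_eq_zero {O : Set Plane} {u F₁ F₂ lam a b d : Plane → ℝ}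
    {μ C : ℝ} (h : IsEllipticFlux O u F₁ F₂ lam a b d μ C) (hc : HasCompactSupport u)
    {x₀ : Plane} {R : ℝ} (hR : 0 < R)
    (hO : ∀ x ∈ Metric.closedBall x₀ (3 * R), gnorm u x ≠ 0 → x ∈ O)
    (hcl : x₀ ∈ closure (interior {x | gnorm u x = 0})) :
    ∀ x ∈ Metric.ball x₀ R, gnorm u x = 0 := by
  intro x₁ hx₁
  by_contra hne
  have hu := h.contDiff
  have hμ := h.μ_pos
  have hball3 : ∀ x ∈ Metric.ball x₀ R, x ∈ Metric.closedBall x₀ (3 * R) := fun x hx =>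
    Metric.mem_closedBall.2 ((Metric.mem_ball.1 hx).le.trans (by linarith))
  have hC : 0 < C := by
    have hx₁O := hO x₁ (hball3 x₁ hx₁) hne
    have h1 := h.elliptic x₁ hx₁O 1 0
    have h2 := (abs_le.1 (h.abs_a_le x₁ hx₁O)).2
    linarith
  obtain ⟨z₁, hz₁, hz₁R⟩ := mem_closure_iff_nhds_basis Metric.nhds_basis_ball |>.1 hcl R hR
  have hgu := continuous_gnorm hu
  have hgsq : Continuous (gsq u) := (hu.continuous_pd.pow 2).add (hu.continuous_pd.pow 2)
  have hv : 0 < gsq u x₁ := by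
    have := gnorm_sq_le_gsq u x₁
    have := pow_pos (lt_of_le_of_ne (gnorm_nonneg u x₁) (Ne.symm hne)) 2
    linarith
  obtain ⟨sz, hsz, hszZ⟩ := Metric.isOpen_iff.1 isOpen_interior z₁ hz₁
  obtain ⟨sx, hsx, hsxv⟩ := Metric.isOpen_iff.1
    (isOpen_lt (continuous_const (y := gsq u x₁ / 2)) hgsq) x₁ (half_lt_self hv)
  set v := gsq u x₁ with hvdef
  set s := min R (min sz sx) with hsdef
  have hs : 0 < s := by positivity
  obtain ⟨M, hM0, hM⟩ := exists_abs_pd_le hu hc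
  obtain ⟨Cm, hCm, hmol⟩ := exists_mollifier
  let η : ContDiffBump x₀ := ⟨2 * R, 3 * R, by positivity, by linarith⟩
  have hη1 : ContDiff ℝ 1 η := η.contDiff
  obtain ⟨G, hG, hGle⟩ := exists_abs_pd_le hη1 η.hasCompactSupport
  set B := Metric.closedBall x₀ (3 * R) with hB
  have hBc : IsCompact B := isCompact_closedBall _ _
  set c := μ / (4 * C) with hcdef
  have hc0 : 0 < c := by positivity
  set T₁ := 24 * (Cm * C) ^ 2 / μ ^ 2 with hT₁
  have hT₁0 : 0 ≤ T₁ := by positivity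
  set A := ((4 * G ^ 2 / c + 2 * T₁) * volume.real B + 1) / c with hA
  have hA0 : 0 ≤ A := by positivity
  set W := Metric.ball x₀ (2 * R) with hWdef
  set y := x₁ - z₁ with hy
  set Vs := volume.real (Metric.ball z₁ s) with hVs
  have hVtop : volume (Metric.ball z₁ s) ≠ ⊤ := measure_ball_lt_top.ne
  have hVs0 : 0 < Vs := ENNReal.toReal_pos (Metric.measure_ball_pos volume z₁ hs).ne' hVtop
  set N := (‖y‖ * (volume.real W + 2 * A) + 1) / Vs with hN
  have hWtop : volume W ≠ ⊤ := measure_ball_lt_top.ne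
  have hN0 : 0 ≤ N := by positivity
  have hvM : v ≤ 2 * M ^ 2 := by
    have h0 := sq_le_sq' (abs_le.1 (hM 0 x₁)).1 (abs_le.1 (hM 0 x₁)).2
    have h1 := sq_le_sq' (abs_le.1 (hM 1 x₁)).1 (abs_le.1 (hM 1 x₁)).2
    rw [hvdef]; unfold gsq; linarith
  obtain ⟨δ, hδ, K, K', Ψ, Ψ', hP⟩ := exists_profile (R₀ := 4 * M ^ 2 + 4) (r₀ := v / 8) N
    (by positivity) (by nlinarith [sq_nonneg M])
  set Kc := B ∩ {x | δ / 4 ≤ gnorm u x ^ 2} with hKc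
  have hKcc : IsCompact Kc := hBc.inter_right (isClosed_le continuous_const (hgu.pow 2))
  have hKcO : Kc ⊆ O := fun x hx => hO x hx.1 fun h0 => by
    have := hx.2
    rw [Set.mem_ofPred_eq, h0] at this
    linarith
  obtain ⟨CK, hCK, hCKb⟩ := h.exists_residual_bound hc hCm hKcc hKcO
  obtain ⟨ε₀, hε₀, hres⟩ := hCKb (√(μ ^ 2 * δ / (2 * (CK + 1)))) (by positivity)
  set ε' := √(μ ^ 2 * δ / (2 * (CK + 1))) with hε'
  have hε'2 : ε' ^ 2 = μ ^ 2 * δ / (2 * (CK + 1)) := sq_sqrt (by positivity)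
  have hκpos : 0 < min 1 (min (δ / 8) (v / 16)) := by positivity
  obtain ⟨ε₁, hε₁, hclose⟩ := exists_abs_pd_mol_sub_le (Cm := Cm) hu hc (sqrt_pos.2 hκpos)
  set κ := √(min 1 (min (δ / 8) (v / 16))) with hκ
  have hκ2 : κ ^ 2 = min 1 (min (δ / 8) (v / 16)) := sq_sqrt hκpos.le
  have hκ1 : κ ^ 2 ≤ 1 := hκ2.trans_le (min_le_left _ _)
  have hκδ : κ ^ 2 ≤ δ / 8 := hκ2.trans_le ((min_le_right _ _).trans (min_le_left _ _))
  have hκv : κ ^ 2 ≤ v / 16 := hκ2.trans_le ((min_le_right _ _).trans (min_le_right _ _))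
  have hεpos : 0 < min ε₀ ε₁ := lt_min hε₀ hε₁
  obtain ⟨ρ, hρ⟩ := hmol (min ε₀ ε₁ / 2) (half_pos hεpos)
  obtain ⟨hEQ, hresx⟩ := hres _ (half_pos hεpos)
    ((half_lt_self hεpos).trans_le (min_le_left _ _)) ρ hρ
  have hcl := hclose _ ((half_lt_self hεpos).trans_le (min_le_right _ _)) ρ hρ
  have hw3 : ContDiff ℝ 3 (mol ρ u) := by
    have := contDiff_mol hρ.compact hρ.contDiff hu.continuous
    exact_mod_cast contDiff_infty.1 this 3
  have hw2 : ContDiff ℝ 2 (mol ρ u) := hw3.of_le (by norm_num)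
  generalize mol ρ u = w at hresx hcl hw3 hw2
  have hup := fun x => gsq_le_of_close (fun i => hcl i x)
  have hlow := fun x => gsq_le_of_close (u := w) (w := u) (x := x) (κ := κ)
    (fun i => by rw [abs_sub_comm]; exact hcl i x)
  have hr : ∀ x, gsq w x ≤ 4 * M ^ 2 + 4 := fun x => by
    have h0 := sq_le_sq' (abs_le.1 (hM 0 x)).1 (abs_le.1 (hM 0 x)).2
    have h1 := sq_le_sq' (abs_le.1 (hM 1 x)).1 (abs_le.1 (hM 1 x)).2
    have h2 := hup x
    have h3 : gsq u x ≤ 2 * M ^ 2 := by unfold gsq; linarith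
    linarith
  obtain ⟨hei, hebound⟩ := integral_energy_le hP (Kc := Kc) (E := oscAvg ρ u) (T₂ := ε' ^ 2 / μ ^ 2)
    hw3 hr hδ hη1 η.hasCompactSupport (η.tsupport_eq.subset) hBc (fun _ => η.nonneg)
    (fun _ => η.le_one) hGle hc0 hT₁0 (by positivity) hCK (continuous_oscAvg hρ hu) hKcc hEQ
    (fun x hxB hlt => by
      have hxK : x ∈ Kc := ⟨hxB, by
        have h1 := hup x
        have h2 := gsq_le_gnorm_sq u x
        rw [Set.mem_ofPred_eq]
        linarith⟩
      exact ⟨hxK, h.hessian_bound hw2 (hKcO hxK) (by linarith) (fun i => hcl i x) hlt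
        (hresx x hxK)⟩)
  have henergy : ∫ x, energy K K' η w x ≤ A := by
    rw [hA, le_div_iff₀ hc0]
    have : 2 * (ε' ^ 2 / μ ^ 2) / δ * CK ≤ 1 := by
      rw [hε'2]
      have e : 2 * (μ ^ 2 * δ / (2 * (CK + 1)) / μ ^ 2) / δ * CK = CK / (CK + 1) := by field_simp
      rw [e, div_le_one (by positivity)]
      linarith
    linarith
  have hf : ContDiff ℝ 1 fun x => Ψ (gsq w x) :=
    contDiff_one_comp hP.hasDerivAt_Ψ hP.continuousOn_Ψ' (contDiff_gsq hw2)
      fun x => ⟨gsq_nonneg w x, hr x⟩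
  have hWm : MeasurableSet W := Metric.isOpen_ball.measurableSet
  have henn : ∀ x, 0 ≤ energy K K' η w x := fun x => by
    have hrx : gsq w x ∈ Set.Icc 0 (4 * M ^ 2 + 4) := ⟨gsq_nonneg w x, hr x⟩
    have h1 := hP.mul_K_sq_le _ hrx
    have h2 : 0 ≤ gsq w x * K (gsq w x) ^ 2 := mul_nonneg (gsq_nonneg w x) (sq_nonneg _)
    exact mul_nonneg (mul_nonneg (sq_nonneg _) (h2.trans h1)) (hsq_nonneg w x)
  have hgrad : ∫⁻ x in W, ENNReal.ofReal (gnorm (fun x => Ψ (gsq w x)) x)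
      ≤ ENNReal.ofReal (volume.real W + 2 * A) := by
    have hintegrable : IntegrableOn (fun x => 1 + 2 * energy K K' η w x) W :=
      (integrableOn_const hWtop).add (hei.const_mul 2).integrableOn
    calc ∫⁻ x in W, ENNReal.ofReal (gnorm (fun x => Ψ (gsq w x)) x)
        ≤ ∫⁻ x in W, ENNReal.ofReal (1 + 2 * energy K K' η w x) := by
          refine setLIntegral_mono' hWm fun x hx => ENNReal.ofReal_le_ofReal ?_
          have h1 : η x = 1 := η.one_of_mem_closedBall (Metric.ball_subset_closedBall hx)
          simpa [energy, h1] using gnorm_comp_gsq_le hP hw2 (hr x)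
      _ = ENNReal.ofReal (∫ x in W, (1 + 2 * energy K K' η w x)) :=
          (ofReal_integral_eq_lintegral_ofReal hintegrable
            (ae_of_all _ fun x => by have := henn x; positivity)).symm
      _ ≤ _ := by
          refine ENNReal.ofReal_le_ofReal ?_
          have hadd : ∫ x in W, (1 + 2 * energy K K' η w x)
              = volume.real W + 2 * ∫ x in W, energy K K' η w x := by
            rw [integral_add (f := fun _ => (1 : ℝ)) (integrableOn_const hWtop)
              (hei.const_mul 2).integrableOn, setIntegral_const, smul_eq_mul, mul_one,
              integral_const_mul]
          rw [hadd]
          have := setIntegral_le_integral (s := W) hei (ae_of_all _ henn)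
          linarith
  have hfinal := mul_volume_ball_le hf hWm (z := z₁) (y := y) (s := s) (N := N)
    (fun t ht x hx => by
      have hconv : z₁ + t • y ∈ Metric.ball x₀ R :=
        (convex_ball x₀ R).add_smul_sub_mem (by rwa [Metric.mem_ball]) hx₁ ht
      rw [Metric.mem_ball] at hx hconv ⊢
      calc dist (x + t • y) x₀ ≤ dist (x + t • y) (z₁ + t • y) + dist (z₁ + t • y) x₀ :=
            dist_triangle _ _ _
        _ < R + R := by
            refine add_lt_add ?_ hconv
            rw [dist_add_right]
            exact hx.trans_le (min_le_left _ _)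
        _ = 2 * R := by ring)
    (fun x hx => by
      have hxZ : x ∈ {x | gnorm u x = 0} := interior_subset (hszZ (Metric.ball_subset_ball
        ((min_le_right _ _).trans (min_le_left _ _)) hx))
      have hxz : gnorm u x = 0 := hxZ
      have hΨ0 : Ψ (gsq w x) = 0 := hP.Ψ_eq_zero _ (by
        have h1 := hup x
        have h2 := gsq_le_gnorm_sq u x
        rw [hxz] at h2
        linarith)
      have hxy : v / 2 < gsq u (x + y) := hsxv (by
        rw [Metric.mem_ball] at hx ⊢
        have e : dist (x + y) x₁ = dist x z₁ := by
          rw [dist_eq_norm, dist_eq_norm]; congr 1; rw [hy]; abel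
        rw [e]
        exact hx.trans_le ((min_le_right _ _).trans (min_le_right _ _)))
      have hΨN : N ≤ Ψ (gsq w (x + y)) := hP.le_Ψ _ ⟨by
        have := hlow (x + y)
        linarith, hr _⟩
      rw [hΨ0, sub_zero]
      exact hΨN)
  have h1 := hfinal.trans (mul_le_mul_right hgrad (ENNReal.ofReal ‖y‖))
  rw [← ENNReal.ofReal_toReal hVtop, ← ENNReal.ofReal_mul hN0,
    ← ENNReal.ofReal_mul (norm_nonneg _), ENNReal.ofReal_le_ofReal_iff (by positivity)] at h1
  change N * Vs ≤ _ at h1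
  rw [hN, div_mul_cancel₀ _ hVs0.ne'] at h1
  linarith

lemma exists_abs_rpow_sub_le (e : ℝ) {ε : ℝ} (hε : 0 < ε) :
    ∃ δ > 0, ∀ T : ℝ, |T| ≤ δ → |(1 + T) ^ e - 1 - e * T| ≤ ε * |T| := by
  have h : HasDerivAt (fun t : ℝ => t ^ e) e 1 := by
    simpa using Real.hasDerivAt_rpow_const (x := 1) (p := e) (Or.inl one_ne_zero)
  have h2 := (hasDerivAt_iff_isLittleO_nhds_zero.1 h).def hε
  obtain ⟨δ, hδ, hb⟩ := Metric.eventually_nhds_iff.1 h2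
  refine ⟨δ / 2, by positivity, fun T hT => ?_⟩
  have := hb (y := T) (by rw [dist_zero_right, Real.norm_eq_abs]; linarith)
  simpa [mul_comm T e] using this

lemma abs_linear_le {g h a b : ℝ} {M : ℝ} (hg : |g| ≤ M) (hh : |h| ≤ M) :
    |g * a + h * b| ≤ M * (|a| + |b|) := by
  have h1 := abs_add_le (g * a) (h * b)
  rw [abs_mul, abs_mul] at h1
  have h2 := mul_le_mul_of_nonneg_right hg (abs_nonneg a)
  have h3 := mul_le_mul_of_nonneg_right hh (abs_nonneg b)
  linarith

lemma abs_quadratic_le {g h k a b : ℝ} {M : ℝ} (hg : |g| ≤ M) (hh : |h| ≤ M) (hk : |k| ≤ M) :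
    |g * a ^ 2 + 2 * h * a * b + k * b ^ 2| ≤ M * (|a| + |b|) ^ 2 := by
  have h1 := abs_linear_le (a := a) (b := b) hg hh
  have h2 := abs_linear_le (a := a) (b := b) hh hk
  have e : g * a ^ 2 + 2 * h * a * b + k * b ^ 2 = (g * a + h * b) * a + (h * a + k * b) * b := by
    ring
  rw [e, pow_two, ← mul_assoc]
  exact abs_linear_le h1 h2

/-- First order expansion of the normalised flux, with an error controlled linearly by the
variation `r` of the coefficients and sublinearly by the variation of the gradient. -/
lemma flux_expansion_fst {c Λ L : ℝ} (hc : 0 < c) (hΛ : 0 ≤ Λ) (hL : 0 ≤ L) (e : ℝ) :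
    ∃ C ≥ 0, ∀ ε > 0, ∃ τ > 0, ∀ g h k g' h' k' s s' v₀ v₁ v₀' v₁' r : ℝ,
      |g| ≤ Λ → |h| ≤ Λ → |k| ≤ Λ →
      |g' - g| ≤ L * r → |h' - h| ≤ L * r → |k' - k| ≤ L * r → |s' - s| ≤ L * r → c ≤ s →
      |v₀| + |v₁| = 1 → c / 2 ≤ g * v₀ ^ 2 + 2 * h * v₀ * v₁ + k * v₁ ^ 2 →
      |v₀' - v₀| + |v₁' - v₁| ≤ τ → 0 ≤ r → r ≤ τ →
      |s' / s * ((g' * v₀' ^ 2 + 2 * h' * v₀' * v₁' + k' * v₁' ^ 2)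
            / (g * v₀ ^ 2 + 2 * h * v₀ * v₁ + k * v₁ ^ 2)) ^ e * (g' * v₀' + h' * v₁')
          - (g * v₀ + h * v₁)
          - ((g + 2 * e * (g * v₀ + h * v₁) ^ 2
              / (g * v₀ ^ 2 + 2 * h * v₀ * v₁ + k * v₁ ^ 2)) * (v₀' - v₀)
            + (h + 2 * e * ((g * v₀ + h * v₁) * (h * v₀ + k * v₁))
              / (g * v₀ ^ 2 + 2 * h * v₀ * v₁ + k * v₁ ^ 2)) * (v₁' - v₁))|
        ≤ C * r + ε * (|v₀' - v₀| + |v₁' - v₁|) := by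
  set C₁ : ℝ := 2 / c * (3 * Λ + 4 * L) with hC₁
  have hC₁0 : 0 ≤ C₁ := by positivity
  set C₂ : ℝ := (1 + |e|) * C₁ + (2 + |e|) * (L / c) with hC₂
  have hC₂0 : 0 ≤ C₂ := by positivity
  refine ⟨2 * L + 4 * C₂ * L + Λ * (|e| * (8 * L / c) + C₁ + (2 + |e|) * (L / c)),
    by positivity, fun ε hε => ?_⟩
  set ε₁ : ℝ := min 1 (ε / (2 * (Λ * C₁ + 1))) with hε₁
  have hε₁0 : 0 < ε₁ := lt_min one_pos (by positivity)
  have hε₁1 : ε₁ ≤ 1 := min_le_left _ _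
  have hε₁2 : Λ * C₁ * ε₁ ≤ ε / 2 := by
    have h1 : ε₁ ≤ ε / (2 * (Λ * C₁ + 1)) := min_le_right _ _
    rw [le_div_iff₀ (by positivity)] at h1
    have h2 : 0 ≤ Λ * C₁ := by positivity
    linarith
  obtain ⟨δ, hδ, hpow⟩ := exists_abs_rpow_sub_le e hε₁0
  set P : ℝ := 2 * C₂ * Λ + 2 * Λ ^ 2 * |e| / c with hP
  have hP0 : 0 ≤ P := by positivity
  set τ : ℝ := min (min 1 (min δ 1 / (2 * (C₁ + 1)))) (min (c / (L + 1)) (ε / (2 * (P + 1))))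
    with hτ
  have hτ0 : 0 < τ := by
    refine lt_min (lt_min one_pos ?_) (lt_min (by positivity) (by positivity))
    have : 0 < min δ 1 := lt_min hδ one_pos
    positivity
  have hτ1 : τ ≤ 1 := (min_le_left _ _).trans (min_le_left _ _)
  have hτδ : C₁ * (2 * τ) ≤ min δ 1 := by
    have h1 : τ ≤ min δ 1 / (2 * (C₁ + 1)) := (min_le_left _ _).trans (min_le_right _ _)
    rw [le_div_iff₀ (by positivity)] at h1
    linarith
  have hτε : τ * P ≤ ε / 2 := by
    have h1 : τ ≤ ε / (2 * (P + 1)) := (min_le_right _ _).trans (min_le_right _ _)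
    rw [le_div_iff₀ (by positivity)] at h1
    linarith
  refine ⟨τ, hτ0, ?_⟩
  intro g h k g' h' k' s s' v₀ v₁ v₀' v₁' r hg hh hk hg' hh' hk' hs' hs hv hq ho hr hrτ
  set q := g * v₀ ^ 2 + 2 * h * v₀ * v₁ + k * v₁ ^ 2 with hqdef
  set q' := g' * v₀' ^ 2 + 2 * h' * v₀' * v₁' + k' * v₁' ^ 2 with hq'def
  set x := v₀' - v₀ with hx
  set y := v₁' - v₁ with hy
  set o := |x| + |y| with hodef
  have ho0 : 0 ≤ o := by positivity
  have hq0 : 0 < q := lt_of_lt_of_le (by positivity) hq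
  have hs0 : 0 < s := hc.trans_le hs
  have hLr : 0 ≤ L * r := by positivity
  have hv' : |v₀'| + |v₁'| ≤ 2 := by
    have h1 := abs_add_le v₀ x
    have h2 := abs_add_le v₁ y
    rw [show v₀ + x = v₀' by rw [hx]; ring] at h1
    rw [show v₁ + y = v₁' by rw [hy]; ring] at h2
    linarith
  set w := g * v₀ + h * v₁ with hw
  set z := h * v₀ + k * v₁ with hz
  have hwb : |w| ≤ Λ := by
    have := abs_linear_le (a := v₀) (b := v₁) hg hh
    rwa [hv, mul_one] at this
  have hzb : |z| ≤ Λ := by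
    have := abs_linear_le (a := v₀) (b := v₁) hh hk
    rwa [hv, mul_one] at this
  have hqinv : ∀ t B : ℝ, |t| ≤ B → |t / q| ≤ 2 / c * B := by
    intro t B ht
    rw [abs_div, abs_of_pos hq0, div_le_iff₀ hq0]
    have hB : 0 ≤ B := (abs_nonneg t).trans ht
    calc |t| ≤ B := ht
      _ = 2 / c * B * (c / 2) := by field_simp
      _ ≤ 2 / c * B * q := mul_le_mul_of_nonneg_left hq (by positivity)
  set T := (q' - q) / q with hT
  set E := T - 2 * (w * x + z * y) / q with hE
  have hEb : |E| ≤ 2 / c * (Λ * τ * o + 4 * L * r) := by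
    have h1 : E = ((g * x ^ 2 + 2 * h * x * y + k * y ^ 2)
        + ((g' - g) * v₀' ^ 2 + 2 * (h' - h) * v₀' * v₁' + (k' - k) * v₁' ^ 2)) / q := by
      rw [hE, hT, ← sub_div, hqdef, hq'def, hw, hz, hx, hy]
      congr 1
      ring
    rw [h1]
    refine hqinv _ _ ((abs_add_le _ _).trans (add_le_add ?_ ?_))
    · refine (abs_quadratic_le hg hh hk).trans ?_
      have : Λ * (o * o) ≤ Λ * (τ * o) :=
        mul_le_mul_of_nonneg_left (mul_le_mul_of_nonneg_right ho ho0) hΛ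
      linarith
    · refine (abs_quadratic_le hg' hh' hk').trans ?_
      have h2 : (|v₀'| + |v₁'|) ^ 2 ≤ 2 ^ 2 := pow_le_pow_left₀ (by positivity) hv' 2
      have := mul_le_mul_of_nonneg_left h2 hLr
      linarith
  have hTb : |T| ≤ C₁ * (o + r) := by
    have h1 : |2 * (w * x + z * y) / q| ≤ 2 / c * (2 * Λ * o) := by
      refine hqinv _ _ ?_
      rw [abs_mul, abs_two]
      have := abs_linear_le (a := x) (b := y) hwb hzb
      linarith
    have h2 : |T| ≤ |E| + |2 * (w * x + z * y) / q| := by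
      have := abs_add_le E (2 * (w * x + z * y) / q)
      rwa [show E + 2 * (w * x + z * y) / q = T by rw [hE]; ring] at this
    have h3 : Λ * τ * o ≤ Λ * o := by
      have := mul_le_mul_of_nonneg_left hτ1 (mul_nonneg hΛ ho0)
      linarith
    calc |T| ≤ 2 / c * (Λ * τ * o + 4 * L * r) + 2 / c * (2 * Λ * o) := by linarith
      _ = 2 / c * (Λ * τ * o + 4 * L * r + 2 * Λ * o) := by ring
      _ ≤ 2 / c * ((3 * Λ + 4 * L) * (o + r)) := by
          refine mul_le_mul_of_nonneg_left ?_ (by positivity)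
          have h4 : 0 ≤ L * o := by positivity
          have h5 : 0 ≤ Λ * r := by positivity
          linarith
      _ = C₁ * (o + r) := by rw [hC₁]; ring
  have hTsmall : |T| ≤ min δ 1 :=
    hTb.trans ((mul_le_mul_of_nonneg_left (by linarith) hC₁0).trans hτδ)
  have hT1 : |T| ≤ 1 := hTsmall.trans (min_le_right _ _)
  set S := (1 + T) ^ e - 1 - e * T with hS
  have hSb : |S| ≤ ε₁ * |T| := hpow T (hTsmall.trans (min_le_left _ _))
  have hST : |S| ≤ |T| := hSb.trans (by
    have := mul_le_mul_of_nonneg_right hε₁1 (abs_nonneg T); linarith)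
  set η := s' / s - 1 with hη
  have hηb : |η| ≤ L / c * r := by
    have : η = (s' - s) / s := by rw [hη]; field_simp
    rw [this, abs_div, abs_of_pos hs0, div_le_iff₀ hs0]
    calc |s' - s| ≤ L * r := hs'
      _ = L / c * r * c := by field_simp
      _ ≤ L / c * r * s := mul_le_mul_of_nonneg_left hs (by positivity)
  have hm : |1 + e * T + S| ≤ 2 + |e| := by
    have h1 := abs_add_three 1 (e * T) S
    rw [abs_one, abs_mul] at h1
    have := mul_le_mul_of_nonneg_left hT1 (abs_nonneg e)
    linarith
  have hηm : |η * (1 + e * T + S)| ≤ (2 + |e|) * (L / c) * r := by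
    rw [abs_mul]
    calc |η| * |1 + e * T + S| ≤ (L / c * r) * (2 + |e|) :=
          mul_le_mul hηb hm (abs_nonneg _) (by positivity)
      _ = _ := by ring
  set X := e * T + S + η * (1 + e * T + S) with hX
  have hratio : s' / s * (q' / q) ^ e = 1 + X := by
    have h1 : q' / q = 1 + T := by rw [hT]; field_simp; ring
    have h2 : (1 + T) ^ e = 1 + e * T + S := by rw [hS]; ring
    rw [h1, h2, hX, hη]; ring
  have hXb : |X| ≤ C₂ * (o + r) := by
    have h1 := abs_add_three (e * T) S (η * (1 + e * T + S))
    rw [abs_mul e T] at h1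
    have h2 := mul_le_mul_of_nonneg_left hTb (by positivity : 0 ≤ 1 + |e|)
    have h3 : 0 ≤ (2 + |e|) * (L / c) * o := by positivity
    calc |X| ≤ (1 + |e|) * |T| + (2 + |e|) * (L / c) * r := by linarith
      _ ≤ C₂ * (o + r) := by rw [hC₂]; linarith
  have hXτ : |X| ≤ C₂ * (2 * τ) := hXb.trans (mul_le_mul_of_nonneg_left (by linarith) hC₂0)
  set D := (g' - g) * v₀' + (h' - h) * v₁' with hD
  have hDb : |D| ≤ 2 * L * r := by
    refine (abs_linear_le hg' hh').trans ?_
    have := mul_le_mul_of_nonneg_left hv' hLr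
    linarith
  have hdw : |g' * v₀' + h' * v₁' - w| ≤ Λ * o + 2 * L * r := by
    have h1 : g' * v₀' + h' * v₁' - w = (g * x + h * y) + D := by rw [hw, hx, hy, hD]; ring
    rw [h1]
    exact (abs_add_le _ _).trans (add_le_add (abs_linear_le hg hh) hDb)
  have key : s' / s * (q' / q) ^ e * (g' * v₀' + h' * v₁') - w
      - ((g + 2 * e * w ^ 2 / q) * x + (h + 2 * e * (w * z) / q) * y)
      = D + X * (g' * v₀' + h' * v₁' - w) + w * (e * E + S + η * (1 + e * T + S)) := by
    rw [hratio, hE, hX, hD, hx, hy]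
    rw [hw]
    ring
  rw [key]
  have t1 : |X * (g' * v₀' + h' * v₁' - w)| ≤ C₂ * (2 * τ) * (Λ * o + 2 * L * r) := by
    rw [abs_mul]; exact mul_le_mul hXτ hdw (abs_nonneg _) (by positivity)
  have t2 : |w * (e * E + S + η * (1 + e * T + S))|
      ≤ Λ * (|e| * (2 / c * (Λ * τ * o + 4 * L * r)) + ε₁ * (C₁ * (o + r))
        + (2 + |e|) * (L / c) * r) := by
    rw [abs_mul]
    refine mul_le_mul hwb ?_ (abs_nonneg _) hΛ
    refine (abs_add_three _ _ _).trans (add_le_add (add_le_add ?_ ?_) hηm)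
    · rw [abs_mul]; exact mul_le_mul_of_nonneg_left hEb (abs_nonneg _)
    · exact hSb.trans (mul_le_mul_of_nonneg_left hTb hε₁0.le)
  refine (abs_add_three _ _ _).trans ?_
  have f1 : C₂ * (2 * τ) * (2 * L * r) ≤ 4 * C₂ * L * r := by
    have := mul_le_mul_of_nonneg_right hτ1 (by positivity : 0 ≤ 4 * C₂ * L * r)
    linarith
  have f2 : Λ * (ε₁ * (C₁ * r)) ≤ Λ * (C₁ * r) := by
    have := mul_le_mul_of_nonneg_right hε₁1 (by positivity : 0 ≤ Λ * (C₁ * r))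
    linarith
  have f3 : C₂ * (2 * τ) * (Λ * o) + Λ * (|e| * (2 / c * (Λ * τ * o))) = τ * P * o := by
    rw [hP]; ring
  have f4 := mul_le_mul_of_nonneg_right hτε ho0
  have f5 := mul_le_mul_of_nonneg_right hε₁2 ho0
  have f6 : Λ * (|e| * (2 / c * (4 * L * r))) = Λ * (|e| * (8 * L / c)) * r := by ring
  have f7 : C₂ * (2 * τ) * (Λ * o + 2 * L * r)
      = C₂ * (2 * τ) * (Λ * o) + C₂ * (2 * τ) * (2 * L * r) := by ring
  have f8 : Λ * (|e| * (2 / c * (Λ * τ * o + 4 * L * r)) + ε₁ * (C₁ * (o + r))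
        + (2 + |e|) * (L / c) * r)
      = Λ * (|e| * (2 / c * (Λ * τ * o))) + Λ * (|e| * (2 / c * (4 * L * r)))
        + Λ * C₁ * ε₁ * o + Λ * (ε₁ * (C₁ * r)) + Λ * ((2 + |e|) * (L / c)) * r := by ring
  rw [f8, f6] at t2
  rw [f7] at t1
  linarith

/-- Scale invariant form of the first order expansion of the flux. -/
lemma flux_expansion_fst_scaled {c Λ L : ℝ} (hc : 0 < c) (hΛ : 0 ≤ Λ) (hL : 0 ≤ L) (e : ℝ) :
    ∃ C ≥ 0, ∀ ε > 0, ∃ τ > 0, ∀ g h k g' h' k' s s' v₀ v₁ v₀' v₁' r : ℝ,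
      |g| ≤ Λ → |h| ≤ Λ → |k| ≤ Λ →
      |g' - g| ≤ L * r → |h' - h| ≤ L * r → |k' - k| ≤ L * r → |s' - s| ≤ L * r → c ≤ s →
      0 < |v₀| + |v₁| →
      c / 2 * (|v₀| + |v₁|) ^ 2 ≤ g * v₀ ^ 2 + 2 * h * v₀ * v₁ + k * v₁ ^ 2 →
      |v₀' - v₀| + |v₁' - v₁| ≤ τ * (|v₀| + |v₁|) → 0 ≤ r → r ≤ τ →
      |s' / s * ((g' * v₀' ^ 2 + 2 * h' * v₀' * v₁' + k' * v₁' ^ 2)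
            / (g * v₀ ^ 2 + 2 * h * v₀ * v₁ + k * v₁ ^ 2)) ^ e * (g' * v₀' + h' * v₁')
          - (g * v₀ + h * v₁)
          - ((g + 2 * e * (g * v₀ + h * v₁) ^ 2
              / (g * v₀ ^ 2 + 2 * h * v₀ * v₁ + k * v₁ ^ 2)) * (v₀' - v₀)
            + (h + 2 * e * ((g * v₀ + h * v₁) * (h * v₀ + k * v₁))
              / (g * v₀ ^ 2 + 2 * h * v₀ * v₁ + k * v₁ ^ 2)) * (v₁' - v₁))|
        ≤ C * (|v₀| + |v₁|) * r + ε * (|v₀' - v₀| + |v₁' - v₁|) := by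
  obtain ⟨C, hC, hexp⟩ := flux_expansion_fst hc hΛ hL e
  refine ⟨C, hC, fun ε hε => ?_⟩
  obtain ⟨τ, hτ, hexp⟩ := hexp ε hε
  refine ⟨τ, hτ, ?_⟩
  intro g h k g' h' k' s s' v₀ v₁ v₀' v₁' r hg hh hk hg' hh' hk' hs' hs hm hq ho hr hrτ
  obtain ⟨m, hmdef⟩ : ∃ m, m = |v₀| + |v₁| := ⟨_, rfl⟩
  rw [← hmdef] at hm hq ho ⊢
  have hm2 : 0 < m ^ 2 := by positivity
  obtain ⟨a₀, rfl⟩ : ∃ a, v₀ = m * a := ⟨v₀ / m, by field_simp⟩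
  obtain ⟨a₁, rfl⟩ : ∃ a, v₁ = m * a := ⟨v₁ / m, by field_simp⟩
  obtain ⟨b₀, rfl⟩ : ∃ a, v₀' = m * a := ⟨v₀' / m, by field_simp⟩
  obtain ⟨b₁, rfl⟩ : ∃ a, v₁' = m * a := ⟨v₁' / m, by field_simp⟩
  have hsc : ∀ t : ℝ, |m * t| = m * |t| := fun t => by rw [abs_mul, abs_of_pos hm]
  have hnorm : |a₀| + |a₁| = 1 := by
    rw [hsc, hsc, ← mul_add] at hmdef
    exact mul_left_cancel₀ hm.ne' (by linarith)
  rw [← mul_sub, ← mul_sub, hsc, hsc, ← mul_add] at ho ⊢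
  have hQ : ∀ g h k x y : ℝ, g * (m * x) ^ 2 + 2 * h * (m * x) * (m * y) + k * (m * y) ^ 2
      = m ^ 2 * (g * x ^ 2 + 2 * h * x * y + k * y ^ 2) := fun g h k x y => by ring
  have hW : ∀ g h x y : ℝ, g * (m * x) + h * (m * y) = m * (g * x + h * y) :=
    fun g h x y => by ring
  rw [hQ] at hq
  have hq1 : c / 2 ≤ g * a₀ ^ 2 + 2 * h * a₀ * a₁ + k * a₁ ^ 2 :=
    le_of_mul_le_mul_left (by linarith) hm2
  have key := hexp g h k g' h' k' s s' a₀ a₁ b₀ b₁ r hg hh hk hg' hh' hk' hs' hs hnorm hq1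
    (le_of_mul_le_mul_left (by linarith) hm) hr hrτ
  rw [hQ, hQ, hW g' h', hW g h, hW h k, mul_div_mul_left _ _ hm2.ne']
  rw [show 2 * e * (m * (g * a₀ + h * a₁)) ^ 2 = m ^ 2 * (2 * e * (g * a₀ + h * a₁) ^ 2) by ring,
    show 2 * e * (m * (g * a₀ + h * a₁) * (m * (h * a₀ + k * a₁)))
      = m ^ 2 * (2 * e * ((g * a₀ + h * a₁) * (h * a₀ + k * a₁))) by ring,
    mul_div_mul_left _ _ hm2.ne', mul_div_mul_left _ _ hm2.ne']
  have := mul_le_mul_of_nonneg_left key hm.le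
  rw [← hsc] at this
  refine le_trans (le_of_eq ?_) (this.trans (le_of_eq ?_))
  · congr 1; ring
  · ring

/-- Coefficients `s` (a weight) and `g, h, k` (the entries of a symmetric matrix) which are
bounded, Lipschitz and uniformly elliptic on `D`. -/
structure IsCoeff (D : Set Plane) (s g h k : Plane → ℝ) (c Λ L : ℝ) : Prop where
  isOpen : IsOpen D
  c_pos : 0 < c
  Λ_nonneg : 0 ≤ Λ
  L_nonneg : 0 ≤ L
  le_s : ∀ x ∈ D, c ≤ s x
  abs_g_le : ∀ x ∈ D, |g x| ≤ Λ
  abs_h_le : ∀ x ∈ D, |h x| ≤ Λ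
  abs_k_le : ∀ x ∈ D, |k x| ≤ Λ
  lip_s : ∀ x ∈ D, ∀ y ∈ D, |s y - s x| ≤ L * dist y x
  lip_g : ∀ x ∈ D, ∀ y ∈ D, |g y - g x| ≤ L * dist y x
  lip_h : ∀ x ∈ D, ∀ y ∈ D, |h y - h x| ≤ L * dist y x
  lip_k : ∀ x ∈ D, ∀ y ∈ D, |k y - k x| ≤ L * dist y x
  elliptic : ∀ x ∈ D, ∀ a b : ℝ, c * (a ^ 2 + b ^ 2) ≤ g x * a ^ 2 + 2 * h x * a * b + k x * b ^ 2

lemma continuousOn_of_abs_sub_le {D : Set Plane} {f : Plane → ℝ} {L : ℝ}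
    (h : ∀ x ∈ D, ∀ y ∈ D, |f y - f x| ≤ L * dist y x) : ContinuousOn f D :=
  (LipschitzOnWith.of_dist_le' (K := L) fun y hy x hx => h x hx y hy).continuousOn

section quadForm
variable (g h k u : Plane → ℝ)

/-- The quadratic form with entries `g, h, k` evaluated at the gradient. -/
noncomputable def gradForm (x : Plane) : ℝ :=
  g x * pd 0 u x ^ 2 + 2 * h x * pd 0 u x * pd 1 u x + k x * pd 1 u x ^ 2

variable {g h k u}

lemma IsCoeff.le_gradForm {D : Set Plane} {s : Plane → ℝ} {c Λ L : ℝ}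
    (hk : IsCoeff D s g h k c Λ L) {x : Plane} (hx : x ∈ D) :
    c / 2 * gnorm u x ^ 2 ≤ gradForm g h k u x := by
  have h1 := hk.elliptic x hx (pd 0 u x) (pd 1 u x)
  have h2 := gnorm_sq_le_gsq u x
  have h3 := mul_le_mul_of_nonneg_left h2 (by linarith [hk.c_pos] : 0 ≤ c / 2)
  unfold gradForm
  unfold gsq at h3
  linarith

lemma IsCoeff.gradForm_pos {D : Set Plane} {s : Plane → ℝ} {c Λ L : ℝ}
    (hk : IsCoeff D s g h k c Λ L) {x : Plane} (hx : x ∈ D) (hne : gnorm u x ≠ 0) :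
    0 < gradForm g h k u x := by
  have := hk.c_pos
  exact lt_of_lt_of_le (by positivity) (hk.le_gradForm hx)

end quadForm

/-- Cauchy–Schwarz for a positive semidefinite binary quadratic form. -/
lemma sq_polar_le {g h k : ℝ} (hpos : ∀ a b : ℝ, 0 ≤ g * a ^ 2 + 2 * h * a * b + k * b ^ 2)
    (v₀ v₁ a b : ℝ) :
    ((g * v₀ + h * v₁) * a + (h * v₀ + k * v₁) * b) ^ 2
      ≤ (g * v₀ ^ 2 + 2 * h * v₀ * v₁ + k * v₁ ^ 2) * (g * a ^ 2 + 2 * h * a * b + k * b ^ 2) := by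
  have hd : h ^ 2 ≤ g * k := by
    have hg : 0 ≤ g := by simpa using hpos 1 0
    have hk : 0 ≤ k := by simpa using hpos 0 1
    have h1 := hpos h (-g)
    have h2 := hpos (-k) h
    have h3 := hpos 1 (-h)
    have h4 := hpos (-h) 1
    rcases hg.eq_or_lt with rfl | hg
    · rcases hk.eq_or_lt with rfl | hk
      · nlinarith [hpos 1 1, hpos 1 (-1), sq_nonneg h]
      · have : 0 ≤ k * (0 * k - h ^ 2) := by linarith
        have := nonneg_of_mul_nonneg_right this hk
        linarith
    · have : 0 ≤ g * (g * k - h ^ 2) := by linarith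
      have := nonneg_of_mul_nonneg_right this hg
      linarith
  have := mul_nonneg (sub_nonneg.2 hd) (sq_nonneg (v₀ * b - v₁ * a))
  linarith

lemma exists_gosc_lt {u : Plane → ℝ} (hu : ContDiff ℝ 1 u) {K : Set Plane} (hK : IsCompact K)
    {ε : ℝ} (hε : 0 < ε) : ∃ δ > 0, ∀ x ∈ K, ∀ y, dist y x < δ → gosc u y x < ε := by
  have hunif : ∀ i : Fin 2, ∃ δ > 0, ∀ x ∈ K, ∀ y, dist y x < δ →
      |pd i u y - pd i u x| < ε / 2 := by
    intro i
    have h1 := hK.uniformContinuousAt_of_continuousAt (pd i u)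
      (fun x _ => hu.continuous_pd.continuousAt) (Metric.dist_mem_uniformity (half_pos hε))
    obtain ⟨δ, hδ, h2⟩ := Metric.mem_uniformity_dist.1 h1
    refine ⟨δ, hδ, fun x hx y hy => ?_⟩
    rw [dist_comm] at hy
    have h3 : dist (pd i u x) (pd i u y) < ε / 2 := h2 hy hx
    rwa [dist_comm, Real.dist_eq] at h3
  obtain ⟨δ₀, hδ₀, h0⟩ := hunif 0
  obtain ⟨δ₁, hδ₁, h1⟩ := hunif 1
  refine ⟨min δ₀ δ₁, lt_min hδ₀ hδ₁, fun x hx y hy => ?_⟩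
  have := h0 x hx y (hy.trans_le (min_le_left _ _))
  have := h1 x hx y (hy.trans_le (min_le_right _ _))
  unfold gosc
  linarith

/-- Ellipticity of the linearised coefficients. -/
lemma linearised_elliptic {g h k c e : ℝ} (hc : 0 < c)
    (hell : ∀ a b : ℝ, c * (a ^ 2 + b ^ 2) ≤ g * a ^ 2 + 2 * h * a * b + k * b ^ 2)
    {v₀ v₁ q : ℝ} (hq : q = g * v₀ ^ 2 + 2 * h * v₀ * v₁ + k * v₁ ^ 2) (hq0 : 0 < q)
    (he : 0 < 1 + 2 * e) (a b : ℝ) :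
    min 1 (1 + 2 * e) * c * (a ^ 2 + b ^ 2)
      ≤ (g + 2 * e * (g * v₀ + h * v₁) ^ 2 / q) * a ^ 2
        + 2 * (h + 2 * e * ((g * v₀ + h * v₁) * (h * v₀ + k * v₁)) / q) * a * b
        + (k + 2 * e * (h * v₀ + k * v₁) ^ 2 / q) * b ^ 2 := by
  have hpos : ∀ a b : ℝ, 0 ≤ g * a ^ 2 + 2 * h * a * b + k * b ^ 2 := fun a b =>
    le_trans (by positivity) (hell a b)
  have hcs := sq_polar_le hpos v₀ v₁ a b
  rw [← hq] at hcs
  set B := g * a ^ 2 + 2 * h * a * b + k * b ^ 2 with hB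
  set t := ((g * v₀ + h * v₁) * a + (h * v₀ + k * v₁) * b) ^ 2 / q with ht
  have htB : t ≤ B := by rw [ht, div_le_iff₀ hq0]; linarith
  have ht0 : 0 ≤ t := by positivity
  have hrw : (g + 2 * e * (g * v₀ + h * v₁) ^ 2 / q) * a ^ 2
        + 2 * (h + 2 * e * ((g * v₀ + h * v₁) * (h * v₀ + k * v₁)) / q) * a * b
        + (k + 2 * e * (h * v₀ + k * v₁) ^ 2 / q) * b ^ 2 = B + 2 * e * t := by
    rw [hB, ht]; ring
  have hm : 0 < min 1 (1 + 2 * e) := lt_min one_pos he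
  have h1 := mul_le_mul_of_nonneg_left (hell a b) hm.le
  rw [hrw]
  rcases le_total 0 e with h0 | h0
  · have h2 := mul_le_mul_of_nonneg_right (min_le_left 1 (1 + 2 * e)) (hpos a b)
    have h3 : 0 ≤ 2 * e * t := by positivity
    linarith
  · have h2 := mul_le_mul_of_nonneg_right (min_le_right 1 (1 + 2 * e)) (hpos a b)
    have h3 := mul_le_mul_of_nonneg_left htB (by linarith : 0 ≤ -(2 * e))
    linarith

lemma abs_linearised_le {g Λ c e w z q m : ℝ} (hg : |g| ≤ Λ) (hc : 0 < c) (hw : |w| ≤ Λ * m)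
    (hz : |z| ≤ Λ * m) (hm : 0 < m) (hq : c / 2 * m ^ 2 ≤ q) :
    |g + 2 * e * (w * z) / q| ≤ Λ + 4 * |e| * Λ ^ 2 / c := by
  have hq0 : 0 < q := lt_of_lt_of_le (by positivity) hq
  refine (abs_add_le _ _).trans (add_le_add hg ?_)
  rw [abs_div, abs_mul, abs_mul, abs_mul, abs_two, abs_of_pos hq0, div_le_iff₀ hq0]
  have h1 : |w| * |z| ≤ (Λ * m) * (Λ * m) :=
    mul_le_mul hw hz (abs_nonneg _) ((abs_nonneg _).trans hw)
  calc 2 * |e| * (|w| * |z|) ≤ 2 * |e| * ((Λ * m) * (Λ * m)) :=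
        mul_le_mul_of_nonneg_left h1 (by positivity)
    _ = 4 * |e| * Λ ^ 2 / c * (c / 2 * m ^ 2) := by field_simp; ring
    _ ≤ _ := mul_le_mul_of_nonneg_left hq (by positivity)

/-- The scalar weight in front of the linear flux. -/
noncomputable def wgt (s g h k u : Plane → ℝ) (e : ℝ) (x : Plane) : ℝ :=
  s x * gradForm g h k u x ^ e

lemma wgt_ratio {s s' q q' e : ℝ} (hs : 0 < s) (hq : 0 < q) (hq' : 0 ≤ q') :
    s' * q' ^ e = s * q ^ e * (s' / s * (q' / q) ^ e) := by
  rw [Real.div_rpow hq' hq.le]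
  have := (Real.rpow_pos_of_pos hq e).ne'
  field_simp

lemma abs_scaled_sub_le {l ρ W W' N B : ℝ} (hl : 0 < l) (h : |ρ * W' - W - N| ≤ B) :
    |l * ρ * W' - l * W - l * N| ≤ l * B := by
  have h1 : l * ρ * W' - l * W - l * N = l * (ρ * W' - W - N) := by ring
  rw [h1, abs_mul, abs_of_pos hl]
  exact mul_le_mul_of_nonneg_left h hl.le

/-- Weak solutions of weighted `p`-Laplace type equations have an elliptic flux where their
gradient does not vanish. -/
theorem IsCoeff.isEllipticFlux {D : Set Plane} {s g h k u : Plane → ℝ} {c Λ L e : ℝ}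
    (hk : IsCoeff D s g h k c Λ L) (hu : ContDiff ℝ 1 u) (he : 0 < 1 + 2 * e)
    (hweak : ∀ φ : Plane → ℝ, ContDiff ℝ 1 φ → HasCompactSupport φ →
      tsupport φ ⊆ D ∩ {x | gnorm u x ≠ 0} →
      ∫ x, (wgt s g h k u e x * (g x * pd 0 u x + h x * pd 1 u x) * pd 0 φ x
        + wgt s g h k u e x * (h x * pd 0 u x + k x * pd 1 u x) * pd 1 φ x) = 0) :
    ∃ C, IsEllipticFlux (D ∩ {x | gnorm u x ≠ 0}) u
      (fun x => wgt s g h k u e x * (g x * pd 0 u x + h x * pd 1 u x))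
      (fun x => wgt s g h k u e x * (h x * pd 0 u x + k x * pd 1 u x))
      (wgt s g h k u e)
      (fun x => g x + 2 * e * (g x * pd 0 u x + h x * pd 1 u x) ^ 2 / gradForm g h k u x)
      (fun x => h x + 2 * e * ((g x * pd 0 u x + h x * pd 1 u x)
        * (h x * pd 0 u x + k x * pd 1 u x)) / gradForm g h k u x)
      (fun x => k x + 2 * e * (h x * pd 0 u x + k x * pd 1 u x) ^ 2 / gradForm g h k u x)
      (min 1 (1 + 2 * e) * c) C := by
  have hc := hk.c_pos
  have hΛ := hk.Λ_nonneg
  have hL := hk.L_nonneg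
  obtain ⟨C₁, hC₁, hexp⟩ := flux_expansion_fst_scaled hc hΛ hL e
  have hpos : ∀ x ∈ D ∩ {x | gnorm u x ≠ 0}, 0 < gradForm g h k u x := fun x hx =>
    hk.gradForm_pos hx.1 hx.2
  have hmpos : ∀ x ∈ D ∩ {x | gnorm u x ≠ 0}, 0 < gnorm u x := fun x hx =>
    lt_of_le_of_ne (gnorm_nonneg u x) (Ne.symm hx.2)
  have hp0 := (hu.continuous_pd (i := 0)).continuousOn (s := D ∩ {x | gnorm u x ≠ 0})
  have hp1 := (hu.continuous_pd (i := 1)).continuousOn (s := D ∩ {x | gnorm u x ≠ 0})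
  have hs := (continuousOn_of_abs_sub_le hk.lip_s).mono
    (Set.inter_subset_left (t := {x | gnorm u x ≠ 0}))
  have hg := (continuousOn_of_abs_sub_le hk.lip_g).mono
    (Set.inter_subset_left (t := {x | gnorm u x ≠ 0}))
  have hh := (continuousOn_of_abs_sub_le hk.lip_h).mono
    (Set.inter_subset_left (t := {x | gnorm u x ≠ 0}))
  have hkk := (continuousOn_of_abs_sub_le hk.lip_k).mono
    (Set.inter_subset_left (t := {x | gnorm u x ≠ 0}))
  have hq : ContinuousOn (gradForm g h k u) (D ∩ {x | gnorm u x ≠ 0}) := by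
    unfold gradForm; fun_prop
  have hwgt : ContinuousOn (wgt s g h k u e) (D ∩ {x | gnorm u x ≠ 0}) :=
    hs.mul (hq.rpow_const fun x hx => Or.inl (hpos x hx).ne')
  have hlam : ∀ x ∈ D ∩ {x | gnorm u x ≠ 0}, 0 < wgt s g h k u e x := fun x hx =>
    mul_pos (hc.trans_le (hk.le_s x hx.1)) (Real.rpow_pos_of_pos (hpos x hx) e)
  have hw : ∀ x ∈ D, |g x * pd 0 u x + h x * pd 1 u x| ≤ Λ * gnorm u x := fun x hx =>
    abs_linear_le (hk.abs_g_le x hx) (hk.abs_h_le x hx)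
  have hz : ∀ x ∈ D, |h x * pd 0 u x + k x * pd 1 u x| ≤ Λ * gnorm u x := fun x hx =>
    abs_linear_le (hk.abs_h_le x hx) (hk.abs_k_le x hx)
  have hC₂ : 0 ≤ Λ + 4 * |e| * Λ ^ 2 / c := by positivity
  refine ⟨C₁ + (Λ + 4 * |e| * Λ ^ 2 / c), ?_⟩
  exact
  { isOpen := hk.isOpen.inter (isOpen_ne_fun (continuous_gnorm hu) continuous_const)
    contDiff := hu
    contF₁ := hwgt.mul ((hg.mul hp0).add (hh.mul hp1))
    contF₂ := hwgt.mul ((hh.mul hp0).add (hkk.mul hp1))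
    weak := hweak
    contlam := hwgt
    lam_pos := hlam
    μ_pos := mul_pos (lt_min one_pos he) hc
    C_nonneg := by positivity
    abs_a_le := fun x hx => by
      have := abs_linearised_le (e := e) (hk.abs_g_le x hx.1) hc (hw x hx.1) (hw x hx.1)
        (hmpos x hx) (hk.le_gradForm hx.1)
      rw [← pow_two] at this
      linarith
    abs_b_le := fun x hx => by
      have := abs_linearised_le (e := e) (hk.abs_h_le x hx.1) hc (hw x hx.1) (hz x hx.1)
        (hmpos x hx) (hk.le_gradForm hx.1)
      linarith
    abs_d_le := fun x hx => by
      have := abs_linearised_le (e := e) (hk.abs_k_le x hx.1) hc (hz x hx.1) (hz x hx.1)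
        (hmpos x hx) (hk.le_gradForm hx.1)
      rw [← pow_two] at this
      linarith
    elliptic := fun x hx => linearised_elliptic hc (hk.elliptic x hx.1) rfl (hpos x hx) he
    expansion := by
      intro K hKO hK ε hε
      obtain ⟨τ, hτ, hexp⟩ := hexp ε hε
      obtain ⟨m₀, hm₀, hm₀le⟩ := hK.exists_forall_le' (continuous_gnorm hu).continuousOn
        (a := 0) fun x hx => hmpos x (hKO hx)
      obtain ⟨δ₁, hδ₁, hosc⟩ := exists_gosc_lt hu hK (mul_pos hτ hm₀)
      obtain ⟨δ₂, hδ₂, hthick⟩ := hK.exists_thickening_subset_open hk.isOpen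
        (hKO.trans Set.inter_subset_left)
      refine ⟨min τ (min δ₁ δ₂), lt_min hτ (lt_min hδ₁ hδ₂), fun x hx y hy => ?_⟩
      have hxO := hKO hx
      have hxD := hxO.1
      have hyτ : dist y x ≤ τ := (hy.trans_le (min_le_left _ _)).le
      have hyD : y ∈ D := hthick (Metric.mem_thickening_iff.2 ⟨x, hx,
        hy.trans_le ((min_le_right _ _).trans (min_le_right _ _))⟩)
      have ho : gosc u y x ≤ τ * gnorm u x :=
        (hosc x hx y (hy.trans_le ((min_le_right _ _).trans (min_le_left _ _)))).le.trans
          (mul_le_mul_of_nonneg_left (hm₀le x hx) hτ.le)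
      have hqy : 0 ≤ gradForm g h k u y := le_trans (by positivity) (hk.le_gradForm hyD)
      have hsx := hc.trans_le (hk.le_s x hxD)
      have hC : C₁ * gnorm u x * dist y x
          ≤ (C₁ + (Λ + 4 * |e| * Λ ^ 2 / c)) * gnorm u x * dist y x := by
        gcongr
        · exact gnorm_nonneg u x
        · linarith
      have hlamy : wgt s g h k u e y = wgt s g h k u e x
          * (s y / s x * (gradForm g h k u y / gradForm g h k u x) ^ e) :=
        wgt_ratio hsx (hpos x hxO) hqy
      have e1 := hexp (g x) (h x) (k x) (g y) (h y) (k y) (s x) (s y) (pd 0 u x) (pd 1 u x)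
        (pd 0 u y) (pd 1 u y) (dist y x) (hk.abs_g_le x hxD) (hk.abs_h_le x hxD)
        (hk.abs_k_le x hxD) (hk.lip_g x hxD y hyD) (hk.lip_h x hxD y hyD)
        (hk.lip_k x hxD y hyD) (hk.lip_s x hxD y hyD) (hk.le_s x hxD) (hmpos x hxO)
        (hk.le_gradForm hxD) ho dist_nonneg hyτ
      have e2 := hexp (k x) (h x) (g x) (k y) (h y) (g y) (s x) (s y) (pd 1 u x) (pd 0 u x)
        (pd 1 u y) (pd 0 u y) (dist y x) (hk.abs_k_le x hxD) (hk.abs_h_le x hxD)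
        (hk.abs_g_le x hxD) (hk.lip_k x hxD y hyD) (hk.lip_h x hxD y hyD)
        (hk.lip_g x hxD y hyD) (hk.lip_s x hxD y hyD) (hk.le_s x hxD)
        (by rw [add_comm]; exact hmpos x hxO)
        (by
          rw [add_comm |pd 1 u x|]
          exact (hk.le_gradForm hxD).trans (le_of_eq (by unfold gradForm; ring)))
        (by rw [add_comm, add_comm |pd 1 u x|]; exact ho) dist_nonneg hyτ
      have swapQ : ∀ a b d p q : ℝ, d * q ^ 2 + 2 * b * q * p + a * p ^ 2
          = a * p ^ 2 + 2 * b * p * q + d * q ^ 2 := fun a b d p q => by ring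
      rw [swapQ, swapQ] at e2
      have f1 := abs_scaled_sub_le (hlam x hxO) e1
      have f2 := abs_scaled_sub_le (hlam x hxO) e2
      constructor
      · simp only [hlamy]
        refine f1.trans (mul_le_mul_of_nonneg_left ?_ (hlam x hxO).le)
        exact add_le_add_left hC _
      · simp only [hlamy]
        have hB : C₁ * (|pd 1 u x| + |pd 0 u x|) * dist y x
            + ε * (|pd 1 u y - pd 1 u x| + |pd 0 u y - pd 0 u x|)
            ≤ (C₁ + (Λ + 4 * |e| * Λ ^ 2 / c)) * gnorm u x * dist y x + ε * gosc u y x := by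
          rw [add_comm |pd 1 u x|, add_comm |pd 1 u y - pd 1 u x|]
          exact add_le_add_left hC _
        refine le_trans (le_of_eq ?_) (f2.trans (mul_le_mul_of_nonneg_left hB (hlam x hxO).le))
        unfold gradForm
        congr 1
        ring_nf }

lemma gradient_apply (f : Plane → ℝ) (x : Plane) (i : Fin 2) : gradient f x i = pd i f x := by
  have h := inner_gradient_left (𝕜 := ℝ) (f := f) (x := x) (y := EuclideanSpace.single i (1 : ℝ))
  rw [EuclideanSpace.inner_single_right] at h
  simpa [pd] using h

lemma inner_matCLM (M : Matrix (Fin 2) (Fin 2) ℝ) (v w : Plane) :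
    ⟪matCLM M v, w⟫ = (M 0 0 * v 0 + M 0 1 * v 1) * w 0 + (M 1 0 * v 0 + M 1 1 * v 1) * w 1 := by
  simp [matCLM, PiLp.inner_apply, Matrix.mulVec, dotProduct, Fin.sum_univ_two]
  ring

lemma abs_sub_le_of_lipschitzOnWith {K : NNReal} {f : Plane → ℝ} {Ω : Set Plane}
    (h : LipschitzOnWith K f Ω) : ∀ x ∈ Ω, ∀ y ∈ Ω, |f y - f x| ≤ K * dist y x := by
  intro x hx y hy
  rw [← Real.dist_eq]
  exact h.dist_le_mul y hy x hx

lemma abs_le_of_lipschitzOnWith {K : NNReal} {f : Plane → ℝ} {x₀ : Plane} {R : ℝ}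
    (h : LipschitzOnWith K f (Metric.ball x₀ R)) :
    ∀ x ∈ Metric.ball x₀ R, |f x| ≤ |f x₀| + K * R := by
  intro x hx
  have hR : 0 < R := dist_nonneg.trans_lt (Metric.mem_ball.1 hx)
  have h1 := abs_sub_le_of_lipschitzOnWith h x₀ (Metric.mem_ball_self hR) x hx
  have h2 := abs_sub_abs_le_abs_sub (f x) (f x₀)
  have h3 := mul_le_mul_of_nonneg_left (Metric.mem_ball.1 hx).le K.coe_nonneg
  linarith

lemma exists_isCoeff {Ω : Set Plane} {x₀ : Plane} {R : ℝ} (hball : Metric.ball x₀ R ⊆ Ω)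
    {c₀ : ℝ} (hc₀ : 0 < c₀) {σ : Plane → ℝ} {Kσ : NNReal} (hσlip : LipschitzOnWith Kσ σ Ω)
    (hσpos : ∀ x ∈ Ω, c₀ ≤ σ x) {A : Plane → Matrix (Fin 2) (Fin 2) ℝ} {KA : NNReal}
    (hAlip : ∀ i j : Fin 2, LipschitzOnWith KA (fun x => A x i j) Ω)
    (hAsymm : ∀ x ∈ Ω, (A x).IsSymm)
    (hAell : ∀ x ∈ Ω, ∀ ξ : Plane, c₀ * ‖ξ‖ ^ 2 ≤ ⟪matCLM (A x) ξ, ξ⟫) :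
    ∃ Λ L, IsCoeff (Metric.ball x₀ R) σ (fun x => A x 0 0) (fun x => A x 0 1)
      (fun x => A x 1 1) c₀ Λ L := by
  have hb : ∀ i j : Fin 2, ∀ x ∈ Metric.ball x₀ R, |A x i j|
      ≤ |A x₀ 0 0| + |A x₀ 0 1| + |A x₀ 1 0| + |A x₀ 1 1| + KA * |R| := by
    intro i j x hx
    refine (abs_le_of_lipschitzOnWith ((hAlip i j).mono hball) x hx).trans ?_
    have h1 := mul_le_mul_of_nonneg_left (le_abs_self R) KA.coe_nonneg
    have := abs_nonneg (A x₀ 0 0)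
    have := abs_nonneg (A x₀ 0 1)
    have := abs_nonneg (A x₀ 1 0)
    have := abs_nonneg (A x₀ 1 1)
    fin_cases i <;> fin_cases j <;> simp <;> linarith
  have hl : ∀ (K : NNReal) (f : Plane → ℝ), LipschitzOnWith K f Ω → K ≤ Kσ + KA →
      ∀ x ∈ Metric.ball x₀ R, ∀ y ∈ Metric.ball x₀ R,
        |f y - f x| ≤ ((Kσ + KA : NNReal) : ℝ) * dist y x := fun K f hf hK =>
    abs_sub_le_of_lipschitzOnWith ((hf.mono hball).weaken hK)
  have hA' : KA ≤ Kσ + KA := le_add_of_nonneg_left zero_le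
  refine ⟨|A x₀ 0 0| + |A x₀ 0 1| + |A x₀ 1 0| + |A x₀ 1 1| + KA * |R|, (Kσ + KA : NNReal), ?_⟩
  exact
  { isOpen := Metric.isOpen_ball
    c_pos := hc₀
    Λ_nonneg := by positivity
    L_nonneg := NNReal.coe_nonneg _
    le_s := fun x hx => hσpos x (hball hx)
    abs_g_le := hb 0 0
    abs_h_le := hb 0 1
    abs_k_le := hb 1 1
    lip_s := hl Kσ σ hσlip (le_add_of_nonneg_right zero_le)
    lip_g := hl KA _ (hAlip 0 0) hA'
    lip_h := hl KA _ (hAlip 0 1) hA'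
    lip_k := hl KA _ (hAlip 1 1) hA'
    elliptic := fun x hx a b => by
      have h := hAell x (hball hx) !₂[a, b]
      have hs : A x 1 0 = A x 0 1 := (hAsymm x (hball hx)).apply 0 1
      rw [inner_matCLM, hs, EuclideanSpace.norm_sq_eq] at h
      simp [Fin.sum_univ_two] at h
      linarith }

/-- Cutting off a function which is `C¹` near a ball. -/
lemma exists_cutoff {Ω : Set Plane} (hΩ : IsOpen Ω) {u : Plane → ℝ} (hu : ContDiffOn ℝ 1 u Ω)
    {x₀ : Plane} {r r' : ℝ} (hr : 0 < r) (hr' : r < r') (hball : Metric.closedBall x₀ r' ⊆ Ω) :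
    ∃ w : Plane → ℝ, ContDiff ℝ 1 w ∧ HasCompactSupport w ∧
      ∀ x ∈ Metric.ball x₀ r, w x = u x := by
  let θ : ContDiffBump x₀ := ⟨r, r', hr, hr'⟩
  have hsub : tsupport (fun x => θ x * u x) ⊆ Metric.closedBall x₀ r' := by
    refine (tsupport_mul_subset_left (f := θ) (g := u)).trans ?_
    rw [θ.tsupport_eq]
  refine ⟨fun x => θ x * u x, ?_, ?_, ?_⟩
  · refine contDiff_iff_contDiffAt.2 fun x => ?_
    by_cases hx : x ∈ tsupport (fun x => θ x * u x)
    · exact θ.contDiff.contDiffAt.mul (hu.contDiffAt (hΩ.mem_nhds (hball (hsub hx))))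
    · exact contDiffAt_const.congr_of_eventuallyEq (notMem_tsupport_iff_eventuallyEq.1 hx)
  · exact θ.hasCompactSupport.mul_right
  · intro x hx
    simp [θ.one_of_mem_closedBall (Metric.ball_subset_closedBall hx)]

lemma gnorm_congr {f g : Plane → ℝ} {U : Set Plane} (hU : IsOpen U) (h : ∀ y ∈ U, f y = g y)
    {x : Plane} (hx : x ∈ U) : gnorm f x = gnorm g x := by
  unfold gnorm
  rw [pd_congr hU h hx, pd_congr hU h hx]

lemma pd_eq_zero_of_notMem {φ : Plane → ℝ} {x : Plane} (hx : x ∉ tsupport φ) (i : Fin 2) :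
    pd i φ x = 0 :=
  image_eq_zero_of_notMem_tsupport fun h => hx (tsupport_pd_subset h)

/-- The weak formulation in coordinates, for a function agreeing with `u` on `D`. -/
lemma weak_formulation {Ω D : Set Plane} (hD : IsOpen D) (hDΩ : D ⊆ Ω)
    {σ : Plane → ℝ} {A : Plane → Matrix (Fin 2) (Fin 2) ℝ} (hAsymm : ∀ x ∈ Ω, (A x).IsSymm)
    {c₀ : ℝ} (hc₀ : 0 < c₀)
    (hAell : ∀ x ∈ Ω, ∀ ξ : Plane, c₀ * ‖ξ‖ ^ 2 ≤ ⟪matCLM (A x) ξ, ξ⟫)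
    {e : ℝ} {u w φ : Plane → ℝ} (hw : ∀ x ∈ D, w x = u x) (hφ : tsupport φ ⊆ D)
    (hu : ∫ x in Ω, σ x * |⟪matCLM (A x) (gradient u x), gradient u x⟫| ^ e
        * ⟪matCLM (A x) (gradient u x), gradient φ x⟫ = 0) :
    ∫ x, (wgt σ (fun x => A x 0 0) (fun x => A x 0 1) (fun x => A x 1 1) w e x
          * (A x 0 0 * pd 0 w x + A x 0 1 * pd 1 w x) * pd 0 φ x
        + wgt σ (fun x => A x 0 0) (fun x => A x 0 1) (fun x => A x 1 1) w e x
          * (A x 0 1 * pd 0 w x + A x 1 1 * pd 1 w x) * pd 1 φ x) = 0 := by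
  rw [setIntegral_eq_integral_of_forall_compl_eq_zero] at hu
  · rw [← hu]
    refine integral_congr_ae (ae_of_all _ fun x => ?_)
    beta_reduce
    rw [inner_matCLM _ _ (gradient φ x), gradient_apply φ, gradient_apply φ]
    by_cases hx : x ∈ tsupport φ
    · have hxD := hφ hx
      have hs : A x 1 0 = A x 0 1 := (hAsymm x (hDΩ hxD)).apply 0 1
      have hnn : 0 ≤ ⟪matCLM (A x) (gradient u x), gradient u x⟫ :=
        le_trans (by positivity) (hAell x (hDΩ hxD) _)
      rw [abs_of_nonneg hnn, inner_matCLM, gradient_apply, gradient_apply, hs,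
        pd_congr hD hw hxD, pd_congr hD hw hxD, wgt, gradForm, pd_congr hD hw hxD,
        pd_congr hD hw hxD]
      have hq : (A x 0 0 * pd 0 u x + A x 0 1 * pd 1 u x) * pd 0 u x
          + (A x 0 1 * pd 0 u x + A x 1 1 * pd 1 u x) * pd 1 u x
          = A x 0 0 * pd 0 u x ^ 2 + 2 * A x 0 1 * pd 0 u x * pd 1 u x
            + A x 1 1 * pd 1 u x ^ 2 := by ring
      rw [hq]
      ring
    · simp [pd_eq_zero_of_notMem hx]
  · intro x hx
    have hx' : x ∉ tsupport φ := fun h => hx (hDΩ (hφ h))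
    rw [inner_matCLM _ _ (gradient φ x), gradient_apply φ, gradient_apply φ,
      pd_eq_zero_of_notMem hx', pd_eq_zero_of_notMem hx']
    ring

end PlanarUCP

/-- **Unique continuation principle in the plane** (Theorem 2.3): a `C¹` weak
solution of `div(σ |A∇u·∇u|^((p-2)/2) A∇u) = 0` in a connected planar open set
`Ω`, with Lipschitz coefficients, which is constant on some nonempty open
subset of `Ω`, is constant on all of `Ω`. -/
theorem unique_continuation_2d
    (Ω : Set (EuclideanSpace ℝ (Fin 2)))
    (hΩopen : IsOpen Ω) (hΩconn : IsConnected Ω)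
    (p : ℝ) (hp1 : 1 < p) (c₀ : ℝ) (hc₀ : 0 < c₀)
    (σ : EuclideanSpace ℝ (Fin 2) → ℝ)
    (hσlip : ∃ K : NNReal, LipschitzOnWith K σ Ω)
    (hσpos : ∀ x ∈ Ω, c₀ ≤ σ x)
    (A : EuclideanSpace ℝ (Fin 2) → Matrix (Fin 2) (Fin 2) ℝ)
    (hAlip : ∃ K : NNReal, ∀ i j : Fin 2, LipschitzOnWith K (fun x => A x i j) Ω)
    (hAsymm : ∀ x ∈ Ω, (A x).IsSymm)
    (hAell : ∀ x ∈ Ω, ∀ ξ : EuclideanSpace ℝ (Fin 2),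
      c₀ * ‖ξ‖ ^ 2 ≤ ⟪matCLM (A x) ξ, ξ⟫)
    (u : EuclideanSpace ℝ (Fin 2) → ℝ)
    (huC1 : ContDiffOn ℝ 1 u Ω)
    (husol : ∀ φ : EuclideanSpace ℝ (Fin 2) → ℝ, ContDiff ℝ 1 φ →
      HasCompactSupport φ → tsupport φ ⊆ Ω →
      ∫ x in Ω, σ x * |⟪matCLM (A x) (gradient u x), gradient u x⟫| ^ ((p - 2) / 2)
        * ⟪matCLM (A x) (gradient u x), gradient φ x⟫ = 0)
    (hconst : ∃ U : Set (EuclideanSpace ℝ (Fin 2)), IsOpen U ∧ U.Nonempty ∧ U ⊆ Ω ∧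
      ∃ c : ℝ, ∀ x ∈ U, u x = c) :
    ∃ c : ℝ, ∀ x ∈ Ω, u x = c := by
  obtain ⟨Kσ, hσlip⟩ := hσlip
  obtain ⟨KA, hAlip⟩ := hAlip
  obtain ⟨U, hUopen, ⟨y, hy⟩, hUΩ, c, hUc⟩ := hconst
  have hZ : Ω ⊆ interior {x | PlanarUCP.gnorm u x = 0} := by
    refine hΩconn.isPreconnected.subset_of_closure_inter_subset isOpen_interior ⟨y, hUΩ hy, ?_⟩ ?_
    · refine mem_interior.2 ⟨U, fun x hx => ?_, hUopen, hy⟩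
      rw [Set.mem_ofPred_eq, PlanarUCP.gnorm_congr hUopen hUc hx]
      simp [PlanarUCP.gnorm, PlanarUCP.pd]
    · rintro x₀ ⟨hcl, hx₀⟩
      obtain ⟨r, hr, hrΩ⟩ := Metric.isOpen_iff.1 hΩopen x₀ hx₀
      have hR : 0 < r / 8 := by positivity
      have hDΩ : Metric.ball x₀ (r / 2) ⊆ Ω :=
        (Metric.ball_subset_ball (by linarith)).trans hrΩ
      obtain ⟨w, hw, hwc, hwu⟩ := PlanarUCP.exists_cutoff hΩopen huC1 (r := r / 2)
        (r' := 3 * r / 4) (x₀ := x₀) (by positivity) (by linarith)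
        ((Metric.closedBall_subset_ball (by linarith)).trans hrΩ)
      have hgn : ∀ x ∈ Metric.ball x₀ (r / 2), PlanarUCP.gnorm w x = PlanarUCP.gnorm u x :=
        fun x hx => PlanarUCP.gnorm_congr Metric.isOpen_ball hwu hx
      obtain ⟨Λ, L, hcoeff⟩ := PlanarUCP.exists_isCoeff hDΩ hc₀ hσlip hσpos hAlip hAsymm hAell
      obtain ⟨C, hflux⟩ := hcoeff.isEllipticFlux (e := (p - 2) / 2) hw (by linarith)
        fun φ hφ hφc hφD => PlanarUCP.weak_formulation Metric.isOpen_ball hDΩ hAsymm hc₀ hAell hwu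
          (hφD.trans Set.inter_subset_left)
          (husol φ hφ hφc ((hφD.trans Set.inter_subset_left).trans hDΩ))
      have hzero := hflux.gnorm_eq_zero hwc hR (x₀ := x₀)
        (fun x hx hne => ⟨Metric.closedBall_subset_ball (by linarith) hx, hne⟩) (by
          have h1 := Metric.isOpen_ball.inter_closure
            ⟨Metric.mem_ball_self (half_pos hr), hcl⟩
          refine closure_mono ?_ h1
          refine interior_maximal ?_ (Metric.isOpen_ball.inter isOpen_interior)
          intro x hx
          have hxZ := interior_subset hx.2
          rw [Set.mem_ofPred_eq] at hxZ ⊢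
          rw [hgn x hx.1, hxZ])
      refine mem_interior.2 ⟨Metric.ball x₀ (r / 8), fun x hx => ?_, Metric.isOpen_ball,
        Metric.mem_ball_self hR⟩
      rw [Set.mem_ofPred_eq, ← hgn x (Metric.ball_subset_ball (by linarith) hx)]
      exact hzero x hx
  refine hΩopen.exists_is_const_of_fderiv_eq_zero hΩconn.isPreconnected
    (huC1.differentiableOn (by simp)) fun x hx => ?_
  have h0 := interior_subset (hZ hx)
  rw [Set.mem_ofPred_eq] at h0
  exact norm_le_zero_iff.1 ((PlanarUCP.norm_fderiv_le_gnorm u x).trans h0.le)
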